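/- Let k_0, k⁰ ∈ 𝒮(ℝⁿ) with ∫ k_0(x) dx ≠ 0 and ∫ k⁰(x) dx ≠ 0, let N ∈ ℕ, and set k := Δ^N k⁰ (Δ the Laplacian). Let 0 < p_i < ∞ (i = 1,…,n), 0 < q ≤ ∞, and s < 2N·a_0. Let (ψ_0, ψ) be a pair in 𝒮(ℝⁿ) satisfying the Tauberian conditions for some ε > 0 and with ψ satisfying the moment condition of order M_ψ where s < (M_ψ+1)·a_0. Then there exist constants c_1, c_2 > 0 such that for every f ∈ 𝒮′(ℝⁿ): c_1·‖(2^{sj} ψ_j*f)_{j≥0} | L_{p̄}(ℓ_q)‖ ≤ ‖k_0*f | L_{p̄}‖ + ‖(2^{sj} k_j*f)_{j≥1} | L_{p̄}(ℓ_q)‖ ≤ c_2·‖(2^{sj} ψ_j*f)_{j≥0} | L_{p̄}(ℓ_q)‖; in particular one side is finite if and only if the other is. -/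

import Mathlib

open MeasureTheory Complex
open scoped ENNReal NNReal BigOperators

noncomputable section

/-- Points of `ℝⁿ`, written `x = (x 0, …, x (n-1))`. -/
abbrev RV (n : ℕ) := Fin n → ℝ

/-- Tempered distributions `𝒮′(ℝⁿ)`. -/
abbrev TD (n : ℕ) := SchwartzMap (RV n) ℂ →L[ℂ] ℂ

/-- The Fourier transform `𝓕g(ξ) = ∫ e^{-i x·ξ} g(x) dx`. -/
def FT (n : ℕ) (g : RV n → ℂ) (ξ : RV n) : ℂ :=
  ∫ x : RV n, Complex.exp (-Complex.I * ((∑ i, x i * ξ i : ℝ) : ℂ)) * g x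

/-- The partial derivative `∂_i`. -/
def pderiv1 (n : ℕ) (i : Fin n) (g : RV n → ℂ) : RV n → ℂ :=
  fun x => fderiv ℝ g x (Pi.single i 1)

def pderivIter (n : ℕ) (i : Fin n) : ℕ → (RV n → ℂ) → RV n → ℂ
  | 0, g => g
  | k + 1, g => pderiv1 n i (pderivIter n i k g)

/-- `D^α = (-i ∂_1)^{α_1} ⋯ (-i ∂_n)^{α_n}`. -/
def Dop (n : ℕ) (α : Fin n → ℕ) (g : RV n → ℂ) : RV n → ℂ :=
  fun x => (-Complex.I) ^ (∑ i, α i) *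
    ((List.finRange n).foldr (fun i h => pderivIter n i (α i) h) g) x

/-- `anorm` is the anisotropic distance function `|·|_a` :
`anorm 0 = 0`, and for `x ≠ 0`, `anorm x` is the (unique) `t > 0` with
`x 1 ^ 2 / t ^ (2 a 1) + … + x n ^ 2 / t ^ (2 a n) = 1`. -/
def IsAnorm (n : ℕ) (a : Fin n → ℝ) (anorm : RV n → ℝ) : Prop :=
  anorm 0 = 0 ∧
    ∀ x : RV n, x ≠ 0 → 0 < anorm x ∧ ∑ i, (x i : ℝ) ^ 2 / (anorm x) ^ (2 * a i) = 1

/-- Moment condition of order `M` : `D^α (𝓕ψ)(0) = 0` for all `|α| ≤ M` (void for `M = -1`). -/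
def MomentCond (n : ℕ) (M : ℤ) (ψ : RV n → ℂ) : Prop :=
  ∀ α : Fin n → ℕ, (∑ i, (α i : ℤ)) ≤ M → Dop n α (FT n ψ) 0 = 0

/-- Tauberian conditions for `ε > 0` for the pair `(ψ0, ψ)`. -/
def Tauber (n : ℕ) (anorm : RV n → ℝ) (ψ0 ψ : RV n → ℂ) (ε : ℝ) : Prop :=
  (∀ ξ, anorm ξ < 2 * ε → 0 < ‖FT n ψ0 ξ‖) ∧
    (∀ ξ, ε / 2 < anorm ξ → anorm ξ < 2 * ε → 0 < ‖FT n ψ ξ‖)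

/-- The family `φ_j`, `φ_0` at `j = 0` and `φ_j(x) = 2^{j|a|} φ(2^{ja}x)` for `j ≥ 1`. -/
def fam (n : ℕ) (a : Fin n → ℝ) (φ0 φ : RV n → ℂ) : ℕ → RV n → ℂ
  | 0 => φ0
  | j + 1 => fun x =>
      (((2 : ℝ) ^ (((j : ℝ) + 1) * ∑ i, a i) : ℝ) : ℂ) *
        φ (fun i => (2 : ℝ) ^ (((j : ℝ) + 1) * a i) * x i)

/-- Peetre–Fefferman–Stein maximal function attached to the function `F` (intended: `F = ψ_j * f`). -/
def pfs (n : ℕ) (a r : Fin n → ℝ) (F : RV n → ℂ) (j : ℕ) (x : RV n) : ℝ≥0∞ :=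
  ⨆ y : RV n,
    ENNReal.ofReal (‖F y‖ / ∏ l, (1 + (2 : ℝ) ^ ((j : ℝ) * a l) * |x l - y l|) ^ (r l))

/-- Iterated-integral construction of the mixed Lebesgue norm : integrate out the
coordinates one at a time, first `x 0`, last `x (n-1)`. -/
def mixAux (n : ℕ) (p : Fin n → ℝ≥0∞) : ℕ → ((RV n) → ℝ≥0∞) → (RV n) → ℝ≥0∞
  | 0, F => F
  | l + 1, F => fun x =>
      if h : l < n then
        (if p ⟨l, h⟩ = ∞ then
          essSup (fun t : ℝ => mixAux n p l F (Function.update x ⟨l, h⟩ t)) volume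
        else
          (∫⁻ t : ℝ, (mixAux n p l F (Function.update x ⟨l, h⟩ t)) ^ (p ⟨l, h⟩).toReal) ^
            (1 / (p ⟨l, h⟩).toReal))
      else mixAux n p l F x

/-- The mixed Lebesgue quasi-norm `‖F | L_{p̄}‖` of an extended-nonnegative-valued `F`. -/
def mixedNorm (n : ℕ) (p : Fin n → ℝ≥0∞) (F : RV n → ℝ≥0∞) : ℝ≥0∞ :=
  mixAux n p n F fun _ => 0

/-- `‖(u_k) | L_{p̄}(ℓ_q)‖`. -/
def seqNorm (n : ℕ) (p : Fin n → ℝ≥0∞) (q : ℝ≥0∞) (u : ℕ → RV n → ℝ≥0∞) : ℝ≥0∞ :=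
  mixedNorm n p fun x =>
    if q = ∞ then ⨆ k, u k x else (∑' k, u k x ^ q.toReal) ^ (1 / q.toReal)

/-- Convolution of (Schwartz) functions. -/
def conv2 (n : ℕ) (f g : RV n → ℂ) (x : RV n) : ℂ := ∫ y : RV n, f y * g (x - y)

/-- Schwartz seminorm `p_{α,β}(φ) = sup_x |x^α D^β φ(x)|`, valued in `[0,∞]`. -/
def pSemiE (n : ℕ) (α β : Fin n → ℕ) (g : RV n → ℂ) : ℝ≥0∞ :=
  ⨆ x : RV n, (‖((∏ i, x i ^ α i : ℝ) : ℂ) * Dop n β g x‖₊ : ℝ≥0∞)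

/-- Schwartz seminorm `q_{N,γ}(φ) = ∫ (1+|x|²)^{N/2} |D^γ φ(x)| dx`, valued in `[0,∞]`. -/
def qSemiE (n : ℕ) (N : ℝ) (γ : Fin n → ℕ) (g : RV n → ℂ) : ℝ≥0∞ :=
  ∫⁻ x : RV n, ENNReal.ofReal ((1 + ∑ i, (x i) ^ 2) ^ (N / 2)) * (‖Dop n γ g x‖₊ : ℝ≥0∞)

/-- Iterated Laplacian `Δ^N`. -/
def lapIter (n : ℕ) : ℕ → (RV n → ℂ) → RV n → ℂ
  | 0, g => g
  | N + 1, g => fun x => ∑ i, pderiv1 n i (pderiv1 n i (lapIter n N g)) x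

/-- The box `B_{R,j} = {ξ : |ξ_k| ≤ R 2^{j a_k}}`. -/
def specBox (n : ℕ) (a : Fin n → ℝ) (R : ℝ) (j : ℕ) : Set (RV n) :=
  {ξ | ∀ k, |ξ k| ≤ R * (2 : ℝ) ^ ((j : ℝ) * a k)}

/-- The spectral condition `supp 𝓕u ⊆ B_{R,j}` for a temperate-growth function `u`. -/
def SpecCond (n : ℕ) (a : Fin n → ℝ) (R : ℝ) (j : ℕ) (u : RV n → ℂ) : Prop :=
  ∀ φ : SchwartzMap (RV n) ℂ,
    tsupport (⇑φ) ∩ specBox n a R j = ∅ → (∫ x : RV n, u x * FT n (⇑φ) x) = 0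

/-- The maximal function `u^*` of Section 3. -/
def ustar (n : ℕ) (a r : Fin n → ℝ) (R : ℝ) (j : ℕ) (u : RV n → ℂ) (x : RV n) : ℝ≥0∞ :=
  ⨆ y : RV n,
    ENNReal.ofReal (‖u y‖ / ∏ l, (1 + R * (2 : ℝ) ^ ((j : ℝ) * a l) * |x l - y l|) ^ (r l))


lemma mink_div {I J : ℝ≥0∞} {p q : ℝ} (hpq : p.HolderConjugate q) (hI : I ≠ ∞)
    (h : I ≤ J * I ^ (1 / q)) : I ^ (1 / p) ≤ J := by
  rcases eq_or_ne I 0 with rfl | h0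
  · rw [ENNReal.zero_rpow_of_pos (by simpa using hpq.pos)]; exact zero_le
  · have e : I = I ^ (1 / p) * I ^ (1 / q) := by
      rw [← ENNReal.rpow_add _ _ h0 hI, one_div, one_div, hpq.inv_add_inv_eq_one, ENNReal.rpow_one]
    have h1 : I ^ (1 / q) ≠ 0 := by simp [h0, hI]
    have h2 : I ^ (1 / q) ≠ ∞ := ENNReal.rpow_ne_top_of_nonneg (by simpa using hpq.symm.pos.le) hI
    exact (ENNReal.mul_le_mul_iff_left h1 h2).1 (e.symm.le.trans h)

lemma mink {Y T : Type*} [MeasurableSpace Y] [MeasurableSpace T] (μ : Measure Y) [SigmaFinite μ]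
    (ν : Measure T) [SFinite ν] {p : ℝ} (hp : 1 ≤ p) {g : Y → T → ℝ≥0∞}
    (hg : Measurable (Function.uncurry g)) :
    (∫⁻ y, (∫⁻ t, g y t ∂ν) ^ p ∂μ) ^ (1 / p) ≤ ∫⁻ t, (∫⁻ y, (g y t) ^ p ∂μ) ^ (1 / p) ∂ν := by
  rcases hp.eq_or_lt with rfl | hp
  · simp only [ENNReal.rpow_one, one_div, inv_one]
    rw [lintegral_lintegral_swap hg.aemeasurable]
  have hpq := Real.HolderConjugate.conjExponent hp
  set q := p.conjExponent
  have hp0 : 0 < p := by linarith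
  set h : Y → ℝ≥0∞ := fun y => ∫⁻ t, g y t ∂ν with hh
  have hm : Measurable h := Measurable.lintegral_prod_right hg
  let hN : ℕ → Y → ℝ≥0∞ := fun N => (spanningSets μ N).indicator fun y => min (h y) N
  have hNm : ∀ N, Measurable (hN N) := fun N =>
    (hm.min measurable_const).indicator (measurableSet_spanningSets μ N)
  have hNle : ∀ N y, hN N y ≤ h y := fun N y => by
    simp only [hN, Set.indicator]; split_ifs <;> simp
  have hmono : Monotone hN := by
    intro N M hNM y
    simp only [hN, Set.indicator]
    split_ifs with h1 h2
    · exact min_le_min le_rfl (by exact_mod_cast hNM)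
    · exact absurd (monotone_spanningSets μ hNM h1) h2
    · simp
    · simp
  have hsup : ∀ y, h y = ⨆ N, hN N y := by
    intro y
    refine le_antisymm (le_of_forall_lt fun c hc => ?_) (iSup_le fun N => hNle N y)
    obtain ⟨N, hN1⟩ := ENNReal.exists_nat_gt (hc.ne_top)
    have hy := mem_spanningSetsIndex μ y
    refine lt_of_lt_of_le ?_ (le_iSup _ (max N (spanningSetsIndex μ y)))
    simp only [hN]
    rw [Set.indicator_of_mem (monotone_spanningSets μ (le_max_right _ _) hy)]
    exact lt_min hc (hN1.trans_le (by exact_mod_cast le_max_left _ _))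
  have key : ∀ N, (∫⁻ y, hN N y ^ p ∂μ) ^ (1 / p) ≤ ∫⁻ t, (∫⁻ y, (g y t) ^ p ∂μ) ^ (1 / p) ∂ν := by
    intro N
    refine mink_div hpq ?_ ?_
    · have : ∫⁻ y, hN N y ^ p ∂μ ≤ ∫⁻ y in spanningSets μ N, (N : ℝ≥0∞) ^ p ∂μ := by
        rw [← lintegral_indicator (measurableSet_spanningSets μ N)]
        refine lintegral_mono fun y => ?_
        simp only [hN, Set.indicator]
        split_ifs
        · gcongr; exact min_le_right _ _
        · simp [hp0]
      refine (this.trans_lt ?_).ne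
      rw [setLIntegral_const]
      exact ENNReal.mul_lt_top (ENNReal.rpow_lt_top_of_nonneg hp0.le (by simp))
        (measure_spanningSets_lt_top μ N)
    · calc ∫⁻ y, hN N y ^ p ∂μ ≤ ∫⁻ y, ∫⁻ t, g y t * hN N y ^ (p - 1) ∂ν ∂μ := by
            refine lintegral_mono fun y => ?_
            rw [lintegral_mul_const _ (show Measurable (g y) from hg.comp measurable_prodMk_left)]
            calc hN N y ^ p = hN N y ^ (1 + (p - 1)) := by congr 1; ring
              _ = hN N y * hN N y ^ (p - 1) := by
                rw [ENNReal.rpow_add_of_nonneg _ _ zero_le_one (by linarith), ENNReal.rpow_one]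
              _ ≤ _ := by gcongr; exact hNle N y
        _ = ∫⁻ t, ∫⁻ y, g y t * hN N y ^ (p - 1) ∂μ ∂ν := by
            rw [lintegral_lintegral_swap]
            exact (hg.mul (((hNm N).comp measurable_fst).pow_const _)).aemeasurable
        _ ≤ ∫⁻ t, (∫⁻ y, (g y t) ^ p ∂μ) ^ (1 / p) * (∫⁻ y, hN N y ^ p ∂μ) ^ (1 / q) ∂ν := by
            refine lintegral_mono fun t => ?_
            refine (ENNReal.lintegral_mul_le_Lp_mul_Lq μ hpq
              (hg.comp measurable_prodMk_right).aemeasurable ((hNm N).pow_const _).aemeasurable).trans ?_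
            simp only [← ENNReal.rpow_mul, hpq.sub_one_mul_conj]; rfl
        _ = _ := by
            rw [lintegral_mul_const]
            exact (Measurable.lintegral_prod_left (hg.pow_const p)).pow_const _
  have : ∫⁻ y, h y ^ p ∂μ = ⨆ N, ∫⁻ y, hN N y ^ p ∂μ := by
    rw [← lintegral_iSup (fun N => (hNm N).pow_const p)
      (fun N M hNM y => ENNReal.rpow_le_rpow (hmono hNM y) hp0.le)]
    refine lintegral_congr fun y => ?_
    rw [hsup]
    exact (ENNReal.orderIsoRpow p hp0).map_iSup _
  rw [this]
  have e2 := (ENNReal.orderIsoRpow (1 / p) (by positivity)).map_iSup (fun N => ∫⁻ y, hN N y ^ p ∂μ)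
  simp only [ENNReal.orderIsoRpow_apply] at e2
  rw [e2]
  exact iSup_le key


lemma jensen_ker {T : Type*} [MeasurableSpace T] (μ : Measure T) {K g : T → ℝ≥0∞}
    (hK : Measurable K) (hg : Measurable g) {P : ℝ} (hP : 1 ≤ P) :
    (∫⁻ t, K t * g t ∂μ) ^ P ≤ (∫⁻ t, K t ∂μ) ^ (P - 1) * ∫⁻ t, K t * g t ^ P ∂μ := by
  rcases hP.eq_or_lt with rfl | hP
  · simp
  have hpq := Real.HolderConjugate.conjExponent hP
  set q := P.conjExponent
  have hp0 : 0 < P := by linarith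
  have h1 := ENNReal.lintegral_mul_le_Lp_mul_Lq μ hpq.symm (f := fun t => K t ^ (1 / q))
    (g := fun t => K t ^ (1 / P) * g t) (hK.pow_const _).aemeasurable
    ((hK.pow_const _).mul hg).aemeasurable
  have e : ∀ t, K t ^ (1 / q) * (K t ^ (1 / P) * g t) = K t * g t := fun t => by
    rw [← mul_assoc, ← ENNReal.rpow_add_of_nonneg _ _ (by simpa using hpq.symm.pos.le) (by positivity),
      one_div, one_div, add_comm, hpq.inv_add_inv_eq_one, ENNReal.rpow_one]
  simp only [Pi.mul_apply, e, ENNReal.mul_rpow_of_nonneg _ _ hp0.le, ← ENNReal.rpow_mul] at h1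
  rw [one_div_mul_cancel hpq.symm.pos.ne', one_div_mul_cancel hp0.ne'] at h1
  simp only [ENNReal.rpow_one] at h1
  refine (ENNReal.rpow_le_rpow h1 hp0.le).trans ?_
  rw [ENNReal.mul_rpow_of_nonneg _ _ hp0.le, ← ENNReal.rpow_mul, ← ENNReal.rpow_mul,
    one_div_mul_cancel hp0.ne', ENNReal.rpow_one]
  have : 1 / q * P = P - 1 := by
    have := hpq.inv_add_inv_eq_one
    have h2 : 1 / q = 1 - P⁻¹ := by rw [one_div]; linarith
    rw [h2]; field_simp
  rw [this]

lemma lc_pt (u : ℝ≥0∞) {c : ℝ} (hc : 0 < c) :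
    ∫⁻ l in Set.Ioi (0:ℝ), (if ENNReal.ofReal l < u then ENNReal.ofReal (l ^ (c - 1)) else 0)
      = u ^ c / ENNReal.ofReal c := by
  have fin : ∀ x : ℝ, 0 ≤ x → ∫⁻ l in Set.Ioi (0:ℝ),
      (if ENNReal.ofReal l < ENNReal.ofReal x then ENNReal.ofReal (l ^ (c - 1)) else 0)
      = ENNReal.ofReal x ^ c / ENNReal.ofReal c := by
    intro x hx
    have h1 : ∫⁻ l in Set.Ioi (0:ℝ),
        (if ENNReal.ofReal l < ENNReal.ofReal x then ENNReal.ofReal (l ^ (c - 1)) else 0)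
        = ∫⁻ l in Set.Ioo (0:ℝ) x, ENNReal.ofReal (l ^ (c - 1)) := by
      rw [← lintegral_indicator measurableSet_Ioi, ← lintegral_indicator measurableSet_Ioo]
      refine lintegral_congr fun l => ?_
      by_cases hl : 0 < l
      · simp [Set.indicator, hl, ENNReal.ofReal_lt_ofReal_iff_of_nonneg hl.le]
      · simp [Set.indicator, hl]
    rw [h1, restrict_Ioo_eq_restrict_Ioc, ← ofReal_integral_eq_lintegral_ofReal,
      ← intervalIntegral.integral_of_le hx, integral_rpow (Or.inl (by linarith))]
    · simp only [sub_add_cancel, Real.zero_rpow hc.ne', sub_zero]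
      rw [ENNReal.ofReal_div_of_pos hc, ENNReal.ofReal_rpow_of_nonneg hx hc.le]
    · exact (intervalIntegrable_iff_integrableOn_Ioc_of_le hx).1
        (intervalIntegral.intervalIntegrable_rpow' (by linarith))
    · exact (ae_restrict_mem measurableSet_Ioc).mono fun l hl => Real.rpow_nonneg hl.1.le _
  rcases eq_or_ne u ∞ with rfl | hu
  · rw [ENNReal.top_rpow_of_pos hc, ENNReal.top_div_of_ne_top ENNReal.ofReal_ne_top]
    refine ENNReal.eq_top_of_forall_nnreal_le fun r => ?_
    set x : ℝ := (r * c) ^ (1 / c)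
    have hx : 0 ≤ x := by positivity
    have h2 : ENNReal.ofReal x ^ c / ENNReal.ofReal c = r := by
      rw [ENNReal.ofReal_rpow_of_nonneg hx hc.le, ← Real.rpow_mul (by positivity),
        one_div_mul_cancel hc.ne', Real.rpow_one, ← ENNReal.ofReal_div_of_pos hc,
        mul_div_cancel_right₀ _ hc.ne', ENNReal.ofReal_coe_nnreal]
    rw [← h2, ← fin x hx]
    refine lintegral_mono fun l => ?_
    dsimp only; split_ifs <;> simp_all
  · rw [← ENNReal.ofReal_toReal hu]; exact fin _ ENNReal.toReal_nonneg

lemma lc_int {T : Type*} [MeasurableSpace T] (μ : Measure T) [SFinite μ] {u v : T → ℝ≥0∞}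
    (hu : Measurable u) (hv : Measurable v) {c : ℝ} (hc : 0 < c) :
    ∫⁻ t, v t * u t ^ c ∂μ = ENNReal.ofReal c * ∫⁻ l in Set.Ioi (0:ℝ),
      ENNReal.ofReal (l ^ (c - 1)) * ∫⁻ t, (if ENNReal.ofReal l < u t then v t else 0) ∂μ := by
  have hm : Measurable (fun z : ℝ × T => if ENNReal.ofReal z.1 < u z.2 then v z.2 else 0) :=
    Measurable.ite (measurableSet_lt (by fun_prop) (hu.comp measurable_snd))
      (hv.comp measurable_snd) measurable_const
  have h0 : ENNReal.ofReal c ≠ 0 := by simpa using hc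
  calc ∫⁻ t, v t * u t ^ c ∂μ = ENNReal.ofReal c * ∫⁻ t, v t * (u t ^ c / ENNReal.ofReal c) ∂μ := by
        rw [← lintegral_const_mul _ (by fun_prop)]
        refine lintegral_congr fun t => ?_
        rw [mul_left_comm, ENNReal.mul_div_cancel h0 ENNReal.ofReal_ne_top]
    _ = ENNReal.ofReal c * ∫⁻ t, (∫⁻ l in Set.Ioi (0:ℝ), ENNReal.ofReal (l ^ (c - 1)) *
          (if ENNReal.ofReal l < u t then v t else 0)) ∂μ := by
        congr 1
        refine lintegral_congr fun t => ?_
        rw [← lc_pt _ hc, ← lintegral_const_mul]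
        · refine lintegral_congr fun l => ?_
          split_ifs <;> simp [mul_comm]
        · exact Measurable.ite (measurableSet_lt (by fun_prop) measurable_const) (by fun_prop)
            measurable_const
    _ = _ := by
        rw [lintegral_lintegral_swap]
        · congr 1
          refine lintegral_congr fun l => ?_
          rw [lintegral_const_mul]
          exact hm.comp measurable_prodMk_left
        · exact Measurable.aemeasurable (Measurable.mul (by fun_prop) (hm.comp measurable_swap))


/-- averages over the cells of a partition -/
def av (c : ℕ → ℝ → ℤ) (m : Measure ℝ) (k : ℕ) (g : ℝ → ℝ≥0∞) (t : ℝ) : ℝ≥0∞ :=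
  (m (c k ⁻¹' {c k t}))⁻¹ * ∫⁻ s in c k ⁻¹' {c k t}, g s ∂m

structure Prt (c : ℕ → ℝ → ℤ) : Prop where
  meas : ∀ k, Measurable (c k)
  ref : ∀ k s t, c (k + 1) s = c (k + 1) t → c k s = c k t

def Gd (c : ℕ → ℝ → ℤ) (m : Measure ℝ) : Prop :=
  ∀ k t, m (c k ⁻¹' {c k t}) ≠ 0 ∧ m (c k ⁻¹' {c k t}) ≠ ∞

section
variable {c : ℕ → ℝ → ℤ} (hc : Prt c) {m : Measure ℝ}
include hc

lemma Prt.ms (k : ℕ) (z : ℤ) : MeasurableSet (c k ⁻¹' {z}) := hc.meas k (measurableSet_singleton z)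

lemma Prt.ref' {j k : ℕ} (h : j ≤ k) {s t : ℝ} (e : c k s = c k t) : c j s = c j t := by
  induction k, h using Nat.le_induction with
  | base => exact e
  | succ k _ ih => exact ih (hc.ref _ _ _ e)

lemma av_meas (k : ℕ) (g : ℝ → ℝ≥0∞) : Measurable (av c m k g) :=
  (measurable_of_countable (fun z : ℤ => (m (c k ⁻¹' {z}))⁻¹ * ∫⁻ s in c k ⁻¹' {z}, g s ∂m)).comp
    (hc.meas k)

lemma sum_cells (k : ℕ) (g : ℝ → ℝ≥0∞) :
    ∫⁻ t, g t ∂m = ∑' z : ℤ, ∫⁻ t in c k ⁻¹' {z}, g t ∂m := by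
  rw [← lintegral_iUnion (fun z => hc.ms k z), ← setLIntegral_univ]
  · congr 2; ext t; simp
  · intro a b hab
    exact Disjoint.preimage _ (by simpa using hab)

lemma av_int (hm : Gd c m) (k : ℕ) {φ g : ℝ → ℝ≥0∞} (hg : Measurable g)
    (hφ : ∀ s t, c k s = c k t → φ s = φ t) :
    ∫⁻ t, φ t * av c m k g t ∂m = ∫⁻ t, φ t * g t ∂m := by
  rw [sum_cells hc k, sum_cells hc k]
  refine tsum_congr fun z => ?_
  rcases (c k ⁻¹' {z}).eq_empty_or_nonempty with h | ⟨t, rfl⟩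
  · simp [h]
  rw [setLIntegral_congr_fun (g := fun s => φ t * av c m k g t) (hc.ms k _) fun s hs => by
      simp only [Set.mem_preimage, Set.mem_singleton_iff] at hs
      simp only [hφ s t hs, av, hs],
    setLIntegral_congr_fun (f := fun s => φ s * g s) (g := fun s => φ t * g s) (hc.ms k _)
      fun s hs => by simp only [hφ s t hs], lintegral_const_mul _ hg, setLIntegral_const, av, mul_assoc]
  congr 1
  rw [mul_right_comm, ENNReal.inv_mul_cancel (hm k t).1 (hm k t).2, one_mul]

lemma doob_weak (hm : Gd c m) {g : ℝ → ℝ≥0∞} (hg : Measurable g) (l : ℝ≥0∞) :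
    l * m {t | l < ⨆ k, av c m k g t} ≤ ∫⁻ t, g t ∂m := by
  set S : ℕ → Set ℝ := fun k => {t | l < av c m k g t ∧ ∀ j < k, av c m j g t ≤ l}
  have hS : ∀ k, MeasurableSet (S k) := fun k => by
    have : S k = {t | l < av c m k g t} ∩ ⋂ j, ⋂ (_ : j < k), {t | av c m j g t ≤ l} := by
      ext; simp [S]
    rw [this]
    exact (measurableSet_lt measurable_const (av_meas hc k g)).inter
      (.iInter fun j => .iInter fun _ => measurableSet_le (av_meas hc j g) measurable_const)
  have hd : Pairwise (Function.onFun Disjoint S) := by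
    have : ∀ a b t, a < b → t ∈ S a → t ∉ S b := fun a b t h h1 h2 => (h1.1.trans_le (h2.2 a h)).false
    intro a b hab
    refine Set.disjoint_left.2 fun t h1 h2 => ?_
    rcases lt_or_gt_of_ne hab with h | h
    · exact this a b t h h1 h2
    · exact this b a t h h2 h1
  have hU : {t | l < ⨆ k, av c m k g t} ⊆ ⋃ k, S k := by
    intro t ht
    classical
    have ht : l < ⨆ k, av c m k g t := ht
    have ht := lt_iSup_iff.1 ht
    exact Set.mem_iUnion.2 ⟨Nat.find ht, Nat.find_spec ht, fun j hj => not_lt.1 (Nat.find_min ht hj)⟩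
  have key : ∀ k, l * m (S k) ≤ ∫⁻ t in S k, g t ∂m := by
    intro k
    rw [← lintegral_indicator (hS k), ← setLIntegral_const, ← lintegral_indicator (hS k)]
    have h1 := av_int hc hm k (φ := (S k).indicator 1) hg (by
      intro s t e
      have : ∀ j ≤ k, av c m j g s = av c m j g t := fun j hj => by simp only [av, hc.ref' hj e]
      have : s ∈ S k ↔ t ∈ S k := by
        simp only [S, Set.mem_ofPred_eq, this k le_rfl]
        refine and_congr_right fun _ => forall_congr' fun j => forall_congr' fun hj => by
          rw [this j hj.le]
      by_cases hs : s ∈ S k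
      · simp [hs, this.1 hs]
      · rw [Set.indicator_of_notMem hs, Set.indicator_of_notMem fun h => hs (this.2 h)])
    calc _ ≤ ∫⁻ t, (S k).indicator 1 t * av c m k g t ∂m := lintegral_mono fun t => by
          by_cases ht : t ∈ S k
          · simpa [ht] using ht.1.le
          · simp [ht]
      _ ≤ _ := by
          rw [h1]
          refine lintegral_mono fun t => ?_
          by_cases ht : t ∈ S k <;> simp [ht]
  calc _ ≤ l * ∑' k, m (S k) := by gcongr; exact (measure_mono hU).trans (measure_iUnion_le _)
    _ = ∑' k, l * m (S k) := ENNReal.tsum_mul_left.symm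
    _ ≤ ∑' k, ∫⁻ t in S k, g t ∂m := ENNReal.tsum_le_tsum key
    _ = ∫⁻ t in ⋃ k, S k, g t ∂m := (lintegral_iUnion hS hd _).symm
    _ ≤ _ := setLIntegral_le_lintegral _ _

lemma doob (hm : Gd c m) [SFinite m] {g : ℝ → ℝ≥0∞} (hg : Measurable g) {P : ℝ} (hP : 1 < P) :
    ∫⁻ t, (⨆ k, av c m k g t) ^ P ∂m ≤
      (2 ^ P * ENNReal.ofReal (P / (P - 1))) * ∫⁻ t, g t ^ P ∂m := by
  have hP0 : 0 < P := by linarith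
  set M := fun t => (⨆ k, av c m k g t)
  have hM : Measurable M := .iSup fun k => av_meas hc k g
  have h1 : ∀ l : ℝ, 0 < l → ∫⁻ t, (if ENNReal.ofReal l < M t / 2 then 1 else 0) ∂m ≤
      (ENNReal.ofReal l)⁻¹ * ∫⁻ t, (if ENNReal.ofReal l < g t then g t else 0) ∂m := by
    intro l hl
    set L := ENNReal.ofReal l
    have hL0 : L ≠ 0 := by simpa [L] using hl
    have hLt : L ≠ ∞ := ENNReal.ofReal_ne_top
    have hg' : Measurable fun t => if L < g t then g t else 0 :=
      Measurable.ite (measurableSet_lt measurable_const hg) hg measurable_const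
    have h2 := doob_weak hc hm hg' L
    rw [← ENNReal.mul_le_iff_le_inv hL0 hLt]
    refine le_trans ?_ h2
    gcongr
    rw [← lintegral_indicator_one (measurableSet_lt measurable_const (.iSup fun k => av_meas hc k _))]
    refine lintegral_mono fun t => ?_
    dsimp only
    split_ifs with ht
    · have : L < ⨆ k, av c m k (fun t => if L < g t then g t else 0) t := by
        have h3 : L * 2 < M t := by
          rwa [ENNReal.lt_div_iff_mul_lt (by simp) (by simp)] at ht
        obtain ⟨k, hk⟩ := lt_iSup_iff.1 h3
        refine lt_iSup_iff.2 ⟨k, ?_⟩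
        have : av c m k g t ≤ av c m k (fun t => if L < g t then g t else 0) t + L := by
          have e : L = (m (c k ⁻¹' {c k t}))⁻¹ * ∫⁻ s in c k ⁻¹' {c k t}, L ∂m := by
            rw [setLIntegral_const, mul_left_comm, ENNReal.inv_mul_cancel (hm k t).1 (hm k t).2, mul_one]
          conv_rhs => rw [e]
          simp only [av]
          rw [← mul_add, ← lintegral_add_left (by rw [← e]; exact hg')]
          gcongr with s
          rw [← e]
          split_ifs with h
          · exact le_self_add
          · simpa using h
        rw [mul_two] at hk
        exact lt_of_add_lt_add_right (hk.trans_le this)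
      simp [Set.indicator, this]
    · simp
  have e1 := lc_int m (u := fun t => M t / 2) (v := fun _ => 1) (by fun_prop) measurable_const hP0
  have e2 := lc_int m hg hg (c := P - 1) (by linarith)
  have e3 : ∀ t, M t ^ P = 2 ^ P * (1 * (M t / 2) ^ P) := fun t => by
    rw [one_mul, ← ENNReal.mul_rpow_of_nonneg _ _ hP0.le, ENNReal.mul_div_cancel (by simp) (by simp)]
  have e4 : ∀ t, g t ^ P = g t * g t ^ (P - 1) := fun t => by
    conv_rhs => enter [1]; rw [← ENNReal.rpow_one (g t)]
    rw [← ENNReal.rpow_add_of_nonneg _ _ zero_le_one (by linarith)]; congr 1; ring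
  change ∫⁻ t, M t ^ P ∂m ≤ _
  simp_rw [e3, e4]
  rw [lintegral_const_mul _ (by fun_prop), e1, e2, mul_assoc, ← mul_assoc (ENNReal.ofReal (P / (P - 1))),
    ← ENNReal.ofReal_mul (by apply div_nonneg <;> linarith), div_mul_cancel₀ _ (by linarith)]
  gcongr 2 ^ P * (ENNReal.ofReal P * ?_)
  refine setLIntegral_mono' measurableSet_Ioi fun l hl => ?_
  have hl : 0 < l := hl
  refine (mul_le_mul_right (h1 l hl) _).trans ?_
  rw [← mul_assoc, ← ENNReal.ofReal_inv_of_pos hl, ← ENNReal.ofReal_mul (by positivity)]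
  gcongr
  rw [← Real.rpow_neg_one, ← Real.rpow_add hl]
  ring_nf; rfl
end


/-- dyadic A_P weights -/
structure AP (c : ℕ → ℝ → ℤ) (P : ℝ) (C : ℝ≥0∞) (w : ℝ → ℝ≥0∞) : Prop where
  m : Measurable w
  p : ∀ t, w t ≠ 0
  f : ∀ t, w t ≠ ∞
  b : ∀ k t, av c volume k w t * av c volume k (fun s => w s ^ (-(1 / (P - 1)))) t ^ (P - 1) ≤ C

lemma av_mul (c : ℕ → ℝ → ℤ) (m : Measure ℝ) (k : ℕ) {g : ℝ → ℝ≥0∞} (hg : Measurable g) (x : ℝ≥0∞)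
    (t : ℝ) : av c m k (fun s => x * g s) t = x * av c m k g t := by
  simp only [av]; rw [lintegral_const_mul _ hg]; ring

lemma av_mono_ae {c : ℕ → ℝ → ℤ} (hc : Prt c) {m : Measure ℝ} {k : ℕ} {g h : ℝ → ℝ≥0∞} {t : ℝ}
    (hgh : ∀ᵐ s ∂m, c k s = c k t → g s ≤ h s) : av c m k g t ≤ av c m k h t := by
  refine mul_le_mul_right (setLIntegral_mono_ae' (hc.ms k _) ?_) _
  filter_upwards [hgh] with s hs h2 using hs h2

lemma av_ne_zero {c : ℕ → ℝ → ℤ} (hc : Prt c) (hv : Gd c volume) {k : ℕ} {g : ℝ → ℝ≥0∞}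
    (hg : Measurable g) (h0 : ∀ t, g t ≠ 0) (t : ℝ) : av c volume k g t ≠ 0 := by
  refine mul_ne_zero (ENNReal.inv_ne_zero.2 (hv k t).2) ?_
  rw [Ne, lintegral_eq_zero_iff hg, Filter.EventuallyEq, ae_iff]
  simpa [h0] using (hv k t).1

lemma AP.dual {c : ℕ → ℝ → ℤ} {P Q : ℝ} {C : ℝ≥0∞} {w : ℝ → ℝ≥0∞} (hw : AP c P C w)
    (hPQ : P.HolderConjugate Q) :
    AP c Q (C ^ (1 / (P - 1))) (fun s => w s ^ (-(1 / (P - 1)))) := by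
  have h1 : 0 < P - 1 := by linarith [hPQ.lt]
  have h2 : (P - 1) * (Q - 1) = 1 := by have := hPQ.mul_eq_add; linarith
  have h3 : Q - 1 = 1 / (P - 1) := by field_simp; linarith
  refine ⟨hw.m.pow_const _, fun t => ?_, fun t => ?_, fun k t => ?_⟩
  · simp [hw.p t, hw.f t]
  · simp [hw.p t, hw.f t]
  · have e : ∀ s, (w s ^ (-(1 / (P - 1)))) ^ (-(1 / (Q - 1))) = w s := fun s => by
      rw [← ENNReal.rpow_mul, h3]; field_simp; simp
    simp only [e]
    refine le_of_eq_of_le ?_ (ENNReal.rpow_le_rpow (hw.b k t) (by positivity : 0 ≤ 1 / (P - 1)))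
    rw [ENNReal.mul_rpow_of_nonneg _ _ (by positivity), ← ENNReal.rpow_mul,
      mul_one_div_cancel h1.ne', ENNReal.rpow_one, h3, mul_comm]

lemma av_wd (c : ℕ → ℝ → ℤ) (hc : Prt c) {w : ℝ → ℝ≥0∞} (hw : Measurable w) {k : ℕ} {g : ℝ → ℝ≥0∞}
    (hg : Measurable g) (t : ℝ) : av c (volume.withDensity w) k g t =
      (∫⁻ s in c k ⁻¹' {c k t}, w s)⁻¹ * ∫⁻ s in c k ⁻¹' {c k t}, w s * g s := by
  rw [av, withDensity_apply _ (hc.ms k _), setLIntegral_withDensity_eq_setLIntegral_mul _ hw hg (hc.ms k _)]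
  rfl

section
variable {c : ℕ → ℝ → ℤ} (hc : Prt c) (hv : Gd c volume) {P : ℝ} {C : ℝ≥0∞} {w : ℝ → ℝ≥0∞}
include hc hv

lemma AP.fin (hP : 1 < P) (hC : C ≠ ∞) (hw : AP c P C w) (k : ℕ) (t : ℝ) :
    av c volume k w t ≠ ∞ := fun h => by
  have h1 := hw.b k t
  have h2 : av c volume k (fun s => w s ^ (-(1 / (P - 1)))) t ≠ 0 :=
    av_ne_zero hc hv (hw.m.pow_const _) (fun t => by simp [hw.p t, hw.f t]) t
  rw [h, ENNReal.top_mul] at h1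
  · exact hC (top_le_iff.1 h1)
  · intro h3
    rcases ENNReal.rpow_eq_zero_iff.1 h3 with h3 | h3
    · exact h2 h3.1
    · linarith [h3.2]

lemma gd_wd (hw : Measurable w) (h0 : ∀ t, w t ≠ 0) (hf : ∀ k t, av c volume k w t ≠ ∞) :
    Gd c (volume.withDensity w) := fun k t => by
  rw [withDensity_apply _ (hc.ms k _)]
  refine ⟨fun h => av_ne_zero hc hv hw h0 t (k := k) (by rw [av, h, mul_zero]), fun h => hf k t ?_⟩
  rw [av, h, ENNReal.mul_top]
  exact ENNReal.inv_ne_zero.2 (hv k t).2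

lemma muck (hP : 1 < P) (hC : C ≠ ∞) (hw : AP c P C w) {g : ℝ → ℝ≥0∞} (hg : Measurable g) :
    ∫⁻ t, w t * (⨆ k, av c volume k g t) ^ P ≤
      (C ^ (P / (P - 1)) * (2 ^ (P / (P - 1)) * ENNReal.ofReal (P / (P - 1) / (P / (P - 1) - 1))) *
        (2 ^ P * ENNReal.ofReal (P / (P - 1)))) * ∫⁻ t, w t * g t ^ P := by
  set Q := P / (P - 1) with hQ
  have hPQ : P.HolderConjugate Q := Real.HolderConjugate.conjExponent hP
  have h1 : 0 < P - 1 := by linarith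
  have hP0 : 0 < P := by linarith
  have hd := hw.dual hPQ
  have hCd : C ^ (1 / (P - 1)) ≠ ∞ := ENNReal.rpow_ne_top_of_nonneg (by positivity) hC
  set σ : ℝ → ℝ≥0∞ := fun s => w s ^ (-(1 / (P - 1))) with hσ
  have gw := gd_wd hc hv hw.m hw.p (fun k t => hw.fin hc hv hP hC k t)
  have gσ := gd_wd hc hv hd.m hd.p (fun k t => hd.fin hc hv hPQ.symm.lt hCd k t)
  set H : ℝ → ℝ≥0∞ := fun t => ⨆ k, av c (volume.withDensity σ) k (fun s => g s / σ s) t with hH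
  have hgσ : Measurable fun s => g s / σ s := hg.div hd.m
  have mH : Measurable H := .iSup fun k => av_meas hc k _
  have mK : Measurable fun s => H s ^ (P - 1) / w s := (mH.pow_const _).div hw.m
  have key : ∀ k t, av c volume k g t ^ (P - 1) ≤
      C * av c (volume.withDensity w) k (fun s => H s ^ (P - 1) / w s) t := by
    intro k t
    set Qs := c k ⁻¹' {c k t}
    set V := volume Qs
    set W := ∫⁻ s in Qs, w s with hW
    set S := ∫⁻ s in Qs, σ s with hS
    have hV := hv k t
    have hW1 := gw k t
    have hS1 := gσ k t
    rw [withDensity_apply _ (hc.ms k _)] at hW1 hS1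
    have e1 : av c (volume.withDensity σ) k (fun s => g s / σ s) t = S⁻¹ * ∫⁻ s in Qs, g s := by
      rw [av_wd c hc hd.m hgσ]
      congr 1
      refine lintegral_congr fun s => ?_
      rw [ENNReal.mul_div_cancel (hd.p s) (hd.f s)]
    have e2 : av c (volume.withDensity w) k (fun s => H s ^ (P - 1) / w s) t =
        W⁻¹ * ∫⁻ s in Qs, H s ^ (P - 1) := by
      rw [av_wd c hc hw.m mK]
      congr 1
      refine lintegral_congr fun s => ?_
      rw [ENNReal.mul_div_cancel (hw.p s) (hw.f s)]
    set x := S⁻¹ * ∫⁻ s in Qs, g s with hx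
    have e3 : x ^ (P - 1) * V ≤ ∫⁻ s in Qs, H s ^ (P - 1) := by
      rw [← setLIntegral_const]
      refine setLIntegral_mono' (hc.ms k _) fun s hs => ?_
      refine ENNReal.rpow_le_rpow ?_ h1.le
      rw [← e1]
      have : av c (volume.withDensity σ) k (fun s => g s / σ s) t =
        av c (volume.withDensity σ) k (fun s => g s / σ s) s := by
          have hs : c k s = c k t := hs
          simp only [av, hs]
      rw [this]
      exact le_iSup (fun k => av c (volume.withDensity σ) k (fun s => g s / σ s) s) k
    have e4 : av c volume k g t = x * (V⁻¹ * S) := by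
      have : x * (V⁻¹ * S) = (S⁻¹ * S) * (V⁻¹ * ∫⁻ s in Qs, g s) := by rw [hx]; ring
      rw [this, ENNReal.inv_mul_cancel hS1.1 hS1.2, one_mul]; rfl
    have e5 : (V⁻¹ * W) * (V⁻¹ * S) ^ (P - 1) ≤ C := hw.b k t
    rw [e4, e2, ENNReal.mul_rpow_of_nonneg _ _ h1.le]
    calc x ^ (P - 1) * (V⁻¹ * S) ^ (P - 1)
        = ((V⁻¹ * V) * (W⁻¹ * W)) * (x ^ (P - 1) * (V⁻¹ * S) ^ (P - 1)) := by
          rw [ENNReal.inv_mul_cancel hV.1 hV.2, ENNReal.inv_mul_cancel hW1.1 hW1.2]; simp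
      _ = ((V⁻¹ * W) * (V⁻¹ * S) ^ (P - 1)) * (W⁻¹ * (x ^ (P - 1) * V)) := by ring
      _ ≤ C * (W⁻¹ * ∫⁻ s in Qs, H s ^ (P - 1)) := by gcongr
  have k2 : ∀ t, (⨆ k, av c volume k g t) ^ P ≤
      C ^ Q * (⨆ k, av c (volume.withDensity w) k (fun s => H s ^ (P - 1) / w s) t) ^ Q := by
    intro t
    have h3 : (⨆ k, av c volume k g t) ≤
        (C * ⨆ k, av c (volume.withDensity w) k (fun s => H s ^ (P - 1) / w s) t) ^ (1 / (P - 1)) := by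
      refine iSup_le fun k => ?_
      rw [← ENNReal.rpow_rpow_inv h1.ne' (av c volume k g t), ← one_div]
      refine ENNReal.rpow_le_rpow ((key k t).trans ?_) (by positivity)
      gcongr
      exact le_iSup (fun k => av c (volume.withDensity w) k (fun s => H s ^ (P - 1) / w s) t) k
    refine (ENNReal.rpow_le_rpow h3 hP0.le).trans ?_
    rw [← ENNReal.rpow_mul, ← ENNReal.mul_rpow_of_nonneg _ _ hPQ.symm.nonneg]
    apply le_of_eq; congr 1; rw [hQ]; ring
  have d1 := doob hc gw mK hPQ.symm.lt
  have d2 := doob hc gσ hgσ hP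
  have tw : ∀ {u f : ℝ → ℝ≥0∞}, Measurable u → Measurable f →
      ∫⁻ t, f t ∂(volume.withDensity u) = ∫⁻ t, u t * f t := fun hu hf => by
    rw [lintegral_withDensity_eq_lintegral_mul _ hu hf]; rfl
  rw [tw hw.m (by refine Measurable.pow_const (.iSup fun k => av_meas hc k _) _), tw hw.m (mK.pow_const _)] at d1
  rw [tw hd.m (by refine Measurable.pow_const (.iSup fun k => av_meas hc k _) _), tw hd.m (hgσ.pow_const _)] at d2
  have s1 : ∀ s, w s * (H s ^ (P - 1) / w s) ^ Q = σ s * H s ^ P := fun s => by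
    rw [ENNReal.div_rpow_of_nonneg _ _ hPQ.symm.nonneg, ← ENNReal.rpow_mul,
      hPQ.sub_one_mul_conj, div_eq_mul_inv, mul_left_comm, mul_comm, ← ENNReal.rpow_neg]
    congr 1
    conv_lhs => enter [1]; rw [← ENNReal.rpow_one (w s)]
    rw [← ENNReal.rpow_add _ _ (hw.p s) (hw.f s)]; congr 1
    rw [hQ]; field_simp; ring
  have s2 : ∀ s, σ s * (g s / σ s) ^ P = w s * g s ^ P := fun s => by
    rw [ENNReal.div_rpow_of_nonneg _ _ hP0.le, div_eq_mul_inv, mul_left_comm, mul_comm, ← ENNReal.rpow_neg]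
    congr 1
    conv_lhs => enter [1]; rw [← ENNReal.rpow_one (σ s)]
    rw [← ENNReal.rpow_add _ _ (hd.p s) (hd.f s), hσ]
    dsimp only
    rw [← ENNReal.rpow_mul]
    conv_rhs => rw [← ENNReal.rpow_one (w s)]
    congr 1
    field_simp; ring
  simp_rw [s1] at d1
  simp_rw [s2] at d2
  calc _ ≤ ∫⁻ t, C ^ Q * (w t * (⨆ k, av c (volume.withDensity w) k (fun s => H s ^ (P - 1) / w s) t) ^ Q) :=
        lintegral_mono fun t => by
          rw [mul_left_comm]; gcongr; exact k2 t
    _ = C ^ Q * ∫⁻ t, (w t * (⨆ k, av c (volume.withDensity w) k (fun s => H s ^ (P - 1) / w s) t) ^ Q) :=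
        lintegral_const_mul _ (hw.m.mul (Measurable.pow_const (.iSup fun k => av_meas hc k _) _))
    _ ≤ _ := by
        refine (mul_le_mul_right (d1.trans (mul_le_mul_right d2 _)) _).trans ?_
        apply le_of_eq; ring
end


/-- weighted norm -/
def wn (w : ℝ → ℝ≥0∞) (P : ℝ) (g : ℝ → ℝ≥0∞) : ℝ≥0∞ := (∫⁻ t, w t * g t ^ P) ^ (1 / P)

lemma wn_eq {w g : ℝ → ℝ≥0∞} {P : ℝ} (hw : Measurable w) (hg : Measurable g) :
    wn w P g = (∫⁻ t, g t ^ P ∂(volume.withDensity w)) ^ (1 / P) := by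
  rw [lintegral_withDensity_eq_lintegral_mul _ hw (hg.pow_const _)]; rfl

lemma wn_sum {w : ℝ → ℝ≥0∞} {P : ℝ} (hw : Measurable w) (hf : ∀ t, w t ≠ ∞) (hP : 1 ≤ P)
    {g : ℕ → ℝ → ℝ≥0∞} (hg : ∀ i, Measurable (g i)) :
    wn w P (fun t => ∑' i, g i t) ≤ ∑' i, wn w P (g i) := by
  have : SigmaFinite (volume.withDensity w) :=
    SigmaFinite.withDensity_of_ne_top (ae_of_all _ hf)
  have h := mink (volume.withDensity w) (Measure.count : Measure ℕ) hP (g := fun t i => g i t)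
    (measurable_from_prod_countable_left fun i => hg i)
  simp only [lintegral_count] at h
  rw [wn_eq hw (.tsum hg)]
  simp_rw [fun i => wn_eq (P := P) hw (hg i)]
  exact h

lemma rdf (P : ℝ) (hP : 1 < P) (C : ℝ≥0∞) (hC : C ≠ ∞) : ∃ B : ℝ≥0∞, B ≠ ∞ ∧ B ≠ 0 ∧
    ∀ c, Prt c → Gd c volume → ∀ w, AP c P C w → ∀ g, Measurable g → wn w P g ≠ ∞ → ∀ δ ≠ 0,
    ∃ v : ℝ → ℝ≥0∞, Measurable v ∧ (∀ t, v t ≠ 0) ∧ (∀ t, v t ≠ ∞) ∧ (∀ᵐ t, g t ≤ v t) ∧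
      (∀ k, ∀ᵐ t, av c volume k v t ≤ B * v t) ∧ wn w P v ≤ 2 * wn w P g + δ := by
  set A := (C ^ (P / (P - 1)) * (2 ^ (P / (P - 1)) * ENNReal.ofReal (P / (P - 1) / (P / (P - 1) - 1))) *
        (2 ^ P * ENNReal.ofReal (P / (P - 1)))) + 1 with hA
  have hP0 : 0 < P := by linarith
  have hPQ : 0 < P / (P - 1) := div_pos hP0 (by linarith)
  have hA1 : A ≠ ∞ := by
    simp only [hA]
    have h2 : ∀ x : ℝ, 0 < x → (2 : ℝ≥0∞) ^ x ≠ ∞ := fun x hx =>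
      ENNReal.rpow_ne_top_of_nonneg hx.le (by simp)
    have h3 := ENNReal.rpow_ne_top_of_nonneg hPQ.le hC
    finiteness [h2 P hP0, h2 _ hPQ, h3]
  have hA0 : A ≠ 0 := by simp [hA]
  set a := A ^ (1 / P) with ha
  have ha1 : a ≠ ∞ := ENNReal.rpow_ne_top_of_nonneg (by positivity) hA1
  have ha0 : a ≠ 0 := by simp [ha, hA0, hP0.le]
  have h2a0 : 2 * a ≠ 0 := mul_ne_zero (by simp) ha0
  have h2a1 : 2 * a ≠ ∞ := ENNReal.mul_ne_top (by simp) ha1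
  refine ⟨2 * a, h2a1, h2a0, fun c hc hv w hw g hg hgf δ hδ => ?_⟩
  obtain ⟨η, hη0, hηm, hη⟩ := exists_pos_lintegral_lt_of_sigmaFinite (volume : Measure ℝ)
    (ε := (min (δ / 2) 1) ^ P) (by simp [hδ, hP0.le])
  let e : ℝ → ℝ≥0∞ := fun t => (η t / w t) ^ (1 / P)
  have em : Measurable e := (Measurable.div (by fun_prop) hw.m).pow_const _
  have e0 : ∀ t, e t ≠ 0 := fun t => by
    have h1 : (η t : ℝ≥0∞) ≠ 0 := by simpa using (hη0 t).ne'
    simp [e, h1, hw.f t, hP0.le]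
  have en : wn w P e ≤ min (δ / 2) 1 := by
    have : ∀ t, w t * e t ^ P = η t := fun t => by
      simp only [e]
      rw [← ENNReal.rpow_mul, one_div_mul_cancel hP0.ne', ENNReal.rpow_one,
        ENNReal.mul_div_cancel (hw.p t) (hw.f t)]
    simp only [wn, this]
    refine (ENNReal.rpow_le_rpow hη.le (by positivity)).trans ?_
    rw [← ENNReal.rpow_mul, mul_one_div_cancel hP0.ne', ENNReal.rpow_one]
  let G : ℝ → ℝ≥0∞ := fun t => g t + e t
  have Gm : Measurable G := hg.add em
  have Gn : wn w P G ≤ wn w P g + min (δ / 2) 1 := by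
    rw [wn_eq hw.m Gm]
    refine (ENNReal.lintegral_Lp_add_le hg.aemeasurable em.aemeasurable hP.le).trans ?_
    rw [← wn_eq hw.m hg, ← wn_eq hw.m em]
    gcongr
  let M : (ℝ → ℝ≥0∞) → ℝ → ℝ≥0∞ := fun h t => ⨆ k, av c volume k h t
  have Mm : ∀ h, Measurable (M h) := fun h => .iSup fun k => av_meas hc k h
  have Mn : ∀ h, Measurable h → wn w P (M h) ≤ a * wn w P h := fun h hh => by
    simp only [wn, ha]
    rw [← ENNReal.mul_rpow_of_nonneg _ _ (by positivity)]
    refine ENNReal.rpow_le_rpow ((muck hc hv hP hC hw hh).trans ?_) (by positivity)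
    gcongr; exact le_self_add
  let It : ℕ → ℝ → ℝ≥0∞ := fun j => M^[j] G
  have Is : ∀ j, It (j + 1) = M (It j) := fun j => Function.iterate_succ_apply' _ _ _
  have Im : ∀ j, Measurable (It j) := fun j => by
    cases j with
    | zero => exact Gm
    | succ j => rw [Is]; exact Mm _
  have In : ∀ j, wn w P (It j) ≤ a ^ j * wn w P G := fun j => by
    induction j with
    | zero => simp [It]
    | succ j ih => rw [Is, pow_succ', mul_assoc]; exact (Mn _ (Im j)).trans (mul_le_mul_right ih _)
  let S : ℝ → ℝ≥0∞ := fun t => ∑' j, ((2 * a)⁻¹) ^ j * It j t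
  have Sm : Measurable S := .tsum fun j => (Im j).const_mul _
  have Sn : wn w P S ≤ 2 * wn w P G := by
    refine (wn_sum hw.m hw.f hP.le fun j => (Im j).const_mul _).trans ?_
    calc _ ≤ ∑' j : ℕ, (2⁻¹ : ℝ≥0∞) ^ j * wn w P G := by
          refine ENNReal.tsum_le_tsum fun j => ?_
          have : wn w P (fun t => ((2 * a)⁻¹) ^ j * It j t) = ((2 * a)⁻¹) ^ j * wn w P (It j) := by
            simp only [wn, ENNReal.mul_rpow_of_nonneg _ _ hP0.le, mul_left_comm (w _)]
            rw [lintegral_const_mul _ (show Measurable fun t => w t * It j t ^ P from hw.m.mul ((Im j).pow_const _)),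
              ENNReal.mul_rpow_of_nonneg _ _ (by positivity), ← ENNReal.rpow_mul,
              mul_one_div_cancel hP0.ne', ENNReal.rpow_one]
          rw [this]
          refine (mul_le_mul_right (In j) _).trans ?_
          rw [← mul_assoc, ← mul_pow, ENNReal.mul_inv (by simp) (by simp), mul_assoc,
            ENNReal.inv_mul_cancel ha0 ha1, mul_one]
      _ = _ := by rw [ENNReal.tsum_mul_right, ENNReal.tsum_geometric]; simp
  have GS : ∀ t, G t ≤ S t := fun t => by
    refine le_trans ?_ (ENNReal.le_tsum 0); simp [It]
  have SA : ∀ k t, av c volume k S t ≤ (2 * a) * S t := fun k t => by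
    have : av c volume k S t = ∑' j, ((2 * a)⁻¹) ^ j * av c volume k (It j) t := by
      simp only [av, S]
      rw [lintegral_tsum fun j => ((Im j).const_mul _).aemeasurable, ← ENNReal.tsum_mul_left]
      refine tsum_congr fun j => ?_
      rw [lintegral_const_mul _ (Im j)]; ring
    rw [this]
    calc _ ≤ ∑' j, (2 * a) * (((2 * a)⁻¹) ^ (j + 1) * It (j + 1) t) := by
          refine ENNReal.tsum_le_tsum fun j => ?_
          rw [pow_succ', ← mul_assoc, ← mul_assoc, ENNReal.mul_inv_cancel h2a0 h2a1, one_mul, Is]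
          gcongr
          exact le_iSup (fun k => av c volume k (It j) t) k
      _ ≤ _ := by
          rw [ENNReal.tsum_mul_left]; gcongr
          exact ENNReal.tsum_comp_le_tsum_of_injective (add_left_injective 1) _
  have Sf : ∀ᵐ t, S t ≠ ∞ := by
    have h1 : wn w P S ≠ ∞ := by
      refine ne_top_of_le_ne_top ?_ (Sn.trans (mul_le_mul_right Gn _))
      have : min (δ / 2) 1 ≠ ∞ := ne_top_of_le_ne_top (by simp) (min_le_right _ _)
      finiteness
    have h2 : ∫⁻ t, w t * S t ^ P ≠ ∞ := fun h => h1 (by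
      rw [wn, h, ENNReal.top_rpow_of_pos (by positivity)])
    filter_upwards [ae_lt_top (hw.m.mul (Sm.pow_const _)) h2] with t ht h
    simp [h, ENNReal.top_rpow_of_pos hP0, ENNReal.mul_top (hw.p t)] at ht
  refine ⟨fun t => if S t = ∞ then 1 else S t, Measurable.ite (Sm (measurableSet_singleton _))
    measurable_const Sm, fun t => ?_, fun t => ?_, ?_, fun k => ?_, ?_⟩
  · dsimp only; split_ifs
    · simp
    · exact fun h => by
        have := GS t; rw [h] at this; simp [G, e0 t] at this
  · dsimp only; split_ifs with h
    · simp
    · exact h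
  · filter_upwards [Sf] with t ht
    simp only [ht, if_false]; exact le_self_add.trans (GS t)
  · filter_upwards [Sf] with t ht
    simp only [ht, if_false]
    refine le_trans (av_mono_ae hc ?_) (SA k t)
    filter_upwards [Sf] with s hs _; simp [hs]
  · have : wn w P (fun t => if S t = ∞ then 1 else S t) = wn w P S := by
      simp only [wn]; congr 1
      refine lintegral_congr_ae ?_
      filter_upwards [Sf] with s hs; simp [hs]
    rw [this]
    refine (Sn.trans (mul_le_mul_right Gn _)).trans ?_
    rw [mul_add]; gcongr
    calc 2 * min (δ / 2) 1 ≤ 2 * (δ / 2) := by gcongr; exact min_le_left _ _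
      _ = δ := ENNReal.mul_div_cancel (by simp) (by simp)

lemma AP.mk' {c : ℕ → ℝ → ℤ} (hc : Prt c) (hv : Gd c volume) {P : ℝ} (hP : 1 < P) {B1 B2 : ℝ≥0∞}
    (hB1 : B1 ≠ 0) (hB1' : B1 ≠ ∞) (hB2 : B2 ≠ 0) (hB2' : B2 ≠ ∞) {u v : ℝ → ℝ≥0∞}
    (um : Measurable u) (u0 : ∀ t, u t ≠ 0) (uf : ∀ t, u t ≠ ∞)
    (ua : ∀ k, ∀ᵐ t, av c volume k u t ≤ B1 * u t)
    (vm : Measurable v) (v0 : ∀ t, v t ≠ 0) (vf : ∀ t, v t ≠ ∞)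
    (va : ∀ k, ∀ᵐ t, av c volume k v t ≤ B2 * v t) :
    AP c P (B1 * B2 ^ (P - 1)) (fun t => u t * v t ^ (1 - P)) := by
  have h1 : 0 < P - 1 := by linarith
  have fin : ∀ {B : ℝ≥0∞} {u : ℝ → ℝ≥0∞}, B ≠ ∞ → (∀ t, u t ≠ ∞) →
      (∀ k, ∀ᵐ t, av c volume k u t ≤ B * u t) → ∀ k t, av c volume k u t ≠ ∞ := by
    intro B u hB uf ua k t h
    have h3 : ∃ s, c k s = c k t ∧ av c volume k u s ≤ B * u s := by
      by_contra! h4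
      refine (hv k t).1 (measure_mono_null (fun s hs => ?_) (ae_iff.1 (ua k)))
      exact (h4 s hs).not_ge
    obtain ⟨s, hs, h4⟩ := h3
    have : av c volume k u s = av c volume k u t := by simp only [av, hs]
    rw [this, h, top_le_iff] at h4
    exact ENNReal.mul_ne_top hB (uf s) h4
  have ge : ∀ {B : ℝ≥0∞} {u w : ℝ → ℝ≥0∞} {r : ℝ}, B ≠ 0 → B ≠ ∞ → r ≤ 0 → Measurable w →
      Measurable u → (∀ t, u t ≠ 0) →
      (∀ k, ∀ᵐ t, av c volume k u t ≤ B * u t) → ∀ k t,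
      av c volume k (fun s => w s * u s ^ r) t ≤ B ^ (-r) * av c volume k u t ^ r * av c volume k w t := by
    intro B u w r hB hB' hr wm um u0 ua k t
    rw [← av_mul _ _ _ wm]
    refine av_mono_ae hc ?_
    filter_upwards [ua k] with s hs e
    have : av c volume k u s = av c volume k u t := by simp only [av, e]
    rw [mul_comm (w s)]; gcongr
    rw [this] at hs
    have h5 : B⁻¹ * av c volume k u t ≤ u s := by
      rw [mul_comm, ← div_eq_mul_inv]; exact ENNReal.div_le_of_le_mul' hs
    calc u s ^ r ≤ (B⁻¹ * av c volume k u t) ^ r := by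
          obtain ⟨r', rfl⟩ : ∃ r', r = -r' := ⟨-r, by simp⟩
          rw [ENNReal.rpow_neg, ENNReal.rpow_neg]
          exact ENNReal.inv_le_inv.2 (ENNReal.rpow_le_rpow h5 (by linarith))
      _ = _ := by
          rw [ENNReal.mul_rpow_of_ne_zero (ENNReal.inv_ne_zero.2 hB') (av_ne_zero hc hv um u0 t),
            ENNReal.inv_rpow, ENNReal.rpow_neg]
  refine ⟨um.mul (vm.pow_const _), fun t => ?_, fun t => ?_, fun k t => ?_⟩
  · exact mul_ne_zero (u0 t) (by simp [v0 t, vf t])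
  · exact ENNReal.mul_ne_top (uf t) (by simp [v0 t, vf t])
  · have i1 := ge (r := 1 - P) hB2 hB2' (by linarith) um vm v0 va k t
    have i2 := ge (r := -(1 / (P - 1))) hB1 hB1' (by simp [h1.le]) vm um u0 ua k t
    have e1 : ∀ s, (u s * v s ^ (1 - P)) ^ (-(1 / (P - 1))) = v s * u s ^ (-(1 / (P - 1))) := fun s => by
      rw [ENNReal.mul_rpow_of_ne_zero (u0 s) (by simp [v0 s, vf s]), ← ENNReal.rpow_mul, mul_comm]
      congr 1
      conv_rhs => rw [← ENNReal.rpow_one (v s)]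
      congr 1; field_simp; ring
    simp only [e1]
    refine (mul_le_mul' i1 (ENNReal.rpow_le_rpow i2 h1.le)).trans ?_
    have U0 := av_ne_zero hc hv um u0 t (k := k)
    have V0 := av_ne_zero hc hv vm v0 t (k := k)
    have U1 := fin hB1' uf ua k t
    have V1 := fin hB2' vf va k t
    set U := av c volume k u t
    set V := av c volume k v t
    rw [ENNReal.mul_rpow_of_nonneg _ _ h1.le, ENNReal.mul_rpow_of_nonneg _ _ h1.le, ← ENNReal.rpow_mul,
      ← ENNReal.rpow_mul, neg_neg, one_div_mul_cancel h1.ne', ENNReal.rpow_one, neg_mul,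
      one_div_mul_cancel h1.ne', ENNReal.rpow_neg_one, neg_sub]
    calc _ = (B1 * B2 ^ (P - 1)) * (U⁻¹ * U) * (V ^ (1 - P) * V ^ (P - 1)) := by ring
      _ ≤ _ := by
        rw [ENNReal.inv_mul_cancel U0 U1, ← ENNReal.rpow_add _ _ V0 V1]; simp


lemma wn_hold {w u v : ℝ → ℝ≥0∞} {P Q : ℝ} (hPQ : P.HolderConjugate Q) (wm : Measurable w)
    (um : Measurable u) (vm : Measurable v) (w0 : ∀ t, w t ≠ 0) (wf : ∀ t, w t ≠ ∞) :
    ∫⁻ t, u t * v t ≤ wn (fun t => w t ^ (-(1 / (P - 1)))) Q u * wn w P v := by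
  have h1 : 0 < P - 1 := by linarith [hPQ.lt]
  have h2 : (P - 1) * (Q - 1) = 1 := by have := hPQ.mul_eq_add; linarith
  have h := ENNReal.lintegral_mul_le_Lp_mul_Lq volume hPQ.symm (f := fun t => u t * w t ^ (-(1 / P)))
    (g := fun t => v t * w t ^ (1 / P)) (by fun_prop) (by fun_prop)
  have e0 : ∀ t, u t * w t ^ (-(1 / P)) * (v t * w t ^ (1 / P)) = u t * v t := fun t => by
    have : w t ^ (-(1 / P)) * w t ^ (1 / P) = 1 := by
      rw [← ENNReal.rpow_add _ _ (w0 t) (wf t)]; simp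
    calc _ = u t * v t * (w t ^ (-(1 / P)) * w t ^ (1 / P)) := by ring
      _ = _ := by rw [this, mul_one]
  simp only [Pi.mul_apply, e0] at h
  refine h.trans (le_of_eq ?_)
  have hP := hPQ.pos
  have hQ := hPQ.symm.pos
  simp only [wn, ENNReal.mul_rpow_of_nonneg _ _ hP.le, ENNReal.mul_rpow_of_nonneg _ _ hQ.le,
    ← ENNReal.rpow_mul, one_div_mul_cancel hP.ne', ENNReal.rpow_one]
  have : -(1 / P) * Q = -(1 / (P - 1)) := by
    have := hPQ.mul_eq_add; field_simp; linarith
  simp only [this]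
  congr 2 <;> exact lintegral_congr fun t => mul_comm _ _

lemma extrap {P0 P : ℝ} (hP0 : 1 < P0) (hP : 1 < P) {C : ℝ≥0∞} (hC : C ≠ ∞) :
    ∃ c0 : ℝ≥0∞, c0 ≠ ∞ ∧ ∀ C0 : ℝ≥0∞, C0 ≠ ∞ → ∃ C1 : ℝ≥0∞, C1 ≠ ∞ ∧
    ∀ c, Prt c → Gd c volume → ∀ U ν : ℝ → ℝ≥0∞, Measurable U → Measurable ν →
    (∀ w, AP c P0 c0 w → ∫⁻ t, w t * U t ^ P0 ≤ C0 * ∫⁻ t, w t * ν t ^ P0) →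
    ∀ w, AP c P C w → ∫⁻ t, w t * U t ^ P ≤ C1 * ∫⁻ t, w t * ν t ^ P := by
  have hPQ := Real.HolderConjugate.conjExponent hP
  set Q := P.conjExponent
  have hPQ0 := Real.HolderConjugate.conjExponent hP0
  set Q0 := P0.conjExponent
  have p1 : 0 < P := by linarith
  have p01 : 0 < P0 := by linarith
  obtain ⟨B2, B2f, B20, rd2⟩ := rdf P hP C hC
  obtain ⟨B1, B1f, B10, rd1⟩ := rdf Q hPQ.symm.lt (C ^ (1 / (P - 1)))
    (ENNReal.rpow_ne_top_of_nonneg (by simp [hP.le]) hC)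
  refine ⟨B1 * B2 ^ (P0 - 1), ENNReal.mul_ne_top B1f (ENNReal.rpow_ne_top_of_nonneg (by linarith) B2f),
    fun C0 hC0 => ⟨(6 * (C0 + 1) ^ (1 / P0)) ^ P, ENNReal.rpow_ne_top_of_nonneg p1.le
      (ENNReal.mul_ne_top (by simp) (ENNReal.rpow_ne_top_of_nonneg (by positivity) (by finiteness))),
    fun c hc hv U ν Um νm H w hw => ?_⟩⟩
  set σ : ℝ → ℝ≥0∞ := fun t => w t ^ (-(1 / (P - 1)))
  replace H : ∀ w, AP c P0 (B1 * B2 ^ (P0 - 1)) w →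
      ∫⁻ t, w t * U t ^ P0 ≤ (C0 + 1) * ∫⁻ t, w t * ν t ^ P0 := fun w h => (H w h).trans (by
        gcongr; exact le_self_add)
  have hC00 : C0 + 1 ≠ 0 := by simp
  replace hC0 : C0 + 1 ≠ ∞ := by finiteness
  generalize C0 + 1 = C0 at *
  rcases eq_or_ne (wn w P ν) ∞ with hν | hν
  · have : ∫⁻ t, w t * ν t ^ P = ∞ := by
      by_contra h; exact ENNReal.rpow_ne_top_of_nonneg (by positivity) h hν
    rw [this, ENNReal.mul_top]
    · exact le_top
    · simp [hC00, hC0, p1.le, p01.le]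
  suffices hs : wn w P U ≤ 6 * C0 ^ (1 / P0) * wn w P ν by
    have := ENNReal.rpow_le_rpow hs p1.le
    rw [ENNReal.mul_rpow_of_nonneg _ _ p1.le] at this
    simpa only [wn, ← ENNReal.rpow_mul, one_div_mul_cancel p1.ne', ENNReal.rpow_one] using this
  have ms : ∀ T : ℕ, MeasurableSet {t : ℝ | |t| ≤ (T:ℝ) ∧ w t ≤ T} := fun T => by
    have e : {t : ℝ | |t| ≤ (T:ℝ) ∧ w t ≤ T} = {t : ℝ | |t| ≤ (T:ℝ)} ∩ {t : ℝ | w t ≤ T} := by ext; simp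
    rw [e]
    exact (measurableSet_le (by fun_prop) measurable_const).inter (measurableSet_le hw.m measurable_const)
  have main : ∀ (T : ℕ) (δ : ℝ≥0∞), δ ≠ 0 →
      wn w P (fun t => if |t| ≤ T ∧ w t ≤ T then min (U t) T else 0) ≤
        3 * C0 ^ (1 / P0) * (2 * wn w P ν + δ) := by
    intro T δ hδ
    set V : ℝ → ℝ≥0∞ := fun t => if |t| ≤ T ∧ w t ≤ T then min (U t) T else 0
    have Vm : Measurable V := Measurable.ite (ms T) (Um.min measurable_const) measurable_const
    have VU : ∀ t, V t ≤ U t := fun t => by simp only [V]; split_ifs <;> simp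
    set I := ∫⁻ t, w t * V t ^ P with hI
    have If : I ≠ ∞ := by
      refine ne_top_of_le_ne_top (b := ∫⁻ t in Set.Icc (-(T:ℝ)) T, (T : ℝ≥0∞) * T ^ P) ?_ ?_
      · rw [setLIntegral_const]; simp; finiteness
      · rw [← lintegral_indicator measurableSet_Icc]
        refine lintegral_mono fun t => ?_
        simp only [V]
        split_ifs with h
        · rw [Set.indicator_of_mem (by simpa [abs_le] using h.1)]
          gcongr
          · exact h.2
          · exact min_le_right _ _
        · simp [p1]
    rcases eq_or_ne I 0 with I0 | I0
    · rw [wn, ← hI, I0, ENNReal.zero_rpow_of_pos (by positivity)]; exact zero_le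
    refine mink_div hPQ If ?_
    let h : ℝ → ℝ≥0∞ := fun t => w t * V t ^ (P - 1)
    have hm : Measurable h := hw.m.mul (Vm.pow_const _)
    have hn : wn σ Q h = I ^ (1 / Q) := by
      simp only [wn, hI]; congr 1
      refine lintegral_congr fun t => ?_
      simp only [h, σ]
      rw [ENNReal.mul_rpow_of_nonneg _ _ hPQ.symm.nonneg, ← ENNReal.rpow_mul (V t),
        hPQ.sub_one_mul_conj, ← mul_assoc, ← ENNReal.rpow_add _ _ (hw.p t) (hw.f t)]
      congr 1
      conv_rhs => rw [← ENNReal.rpow_one (w t)]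
      congr 1
      have h1 : 0 < P - 1 := by linarith
      have := hPQ.mul_eq_add; field_simp; linarith
    have Iq0 : I ^ (1 / Q) ≠ 0 := by simp [I0, If]
    have Iqf : I ^ (1 / Q) ≠ ∞ := ENNReal.rpow_ne_top_of_nonneg (by simpa using hPQ.symm.nonneg) If
    obtain ⟨u, um, u0, uf, hu, ua, un⟩ := rd1 c hc hv σ (hw.dual hPQ) h hm (by rwa [hn]) _ Iq0
    obtain ⟨v, vm, v0, vf, hv', va, vn⟩ := rd2 c hc hv w hw ν νm hν δ hδ
    have hW := H _ (AP.mk' hc hv hP0 B10 B1f B20 B2f um u0 uf ua vm v0 vf va)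
    have huv : ∫⁻ t, u t * v t ≤ 3 * I ^ (1 / Q) * (2 * wn w P ν + δ) := by
      refine (wn_hold hPQ hw.m um vm hw.p hw.f).trans (mul_le_mul' (un.trans ?_) vn)
      rw [hn]; apply le_of_eq; ring
    have hνv : ∫⁻ t, u t * v t ^ (1 - P0) * ν t ^ P0 ≤ ∫⁻ t, u t * v t := by
      refine lintegral_mono_ae ?_
      filter_upwards [hv'] with t ht
      calc _ ≤ u t * v t ^ (1 - P0) * v t ^ P0 := by gcongr
        _ = _ := by rw [mul_assoc, ← ENNReal.rpow_add _ _ (v0 t) (vf t)]; simp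
    calc I ≤ ∫⁻ t, U t * u t := by
          refine lintegral_mono_ae ?_
          filter_upwards [hu] with t ht
          calc w t * V t ^ P = V t * h t := by
                have : V t ^ P = V t * V t ^ (P - 1) := by
                  conv_rhs => enter [1]; rw [← ENNReal.rpow_one (V t)]
                  rw [← ENNReal.rpow_add_of_nonneg _ _ zero_le_one (by linarith)]; congr 1; ring
                simp only [h]; rw [this]; ring
            _ ≤ _ := mul_le_mul' (VU t) ht
      _ = ∫⁻ t, (U t * (u t ^ (1 / P0) * v t ^ (-(1 / Q0)))) * (u t ^ (1 / Q0) * v t ^ (1 / Q0)) := by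
          refine lintegral_congr fun t => ?_
          have e1 : u t ^ (1 / P0) * u t ^ (1 / Q0) = u t := by
            rw [← ENNReal.rpow_add _ _ (u0 t) (uf t), one_div, one_div, hPQ0.inv_add_inv_eq_one,
              ENNReal.rpow_one]
          have e2 : v t ^ (-(1 / Q0)) * v t ^ (1 / Q0) = 1 := by
            rw [← ENNReal.rpow_add _ _ (v0 t) (vf t)]; simp
          calc _ = U t * (u t ^ (1 / P0) * u t ^ (1 / Q0)) * (v t ^ (-(1 / Q0)) * v t ^ (1 / Q0)) := by
                rw [e1, e2, mul_one]
            _ = _ := by ring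
      _ ≤ (∫⁻ t, u t * v t ^ (1 - P0) * U t ^ P0) ^ (1 / P0) * (∫⁻ t, u t * v t) ^ (1 / Q0) := by
          refine (ENNReal.lintegral_mul_le_Lp_mul_Lq volume hPQ0 (by fun_prop) (by fun_prop)).trans
            (le_of_eq ?_)
          have q0 := hPQ0.symm.pos
          simp only [ENNReal.mul_rpow_of_nonneg _ _ p01.le, ENNReal.mul_rpow_of_nonneg _ _ q0.le,
            ← ENNReal.rpow_mul, one_div_mul_cancel p01.ne', one_div_mul_cancel q0.ne', ENNReal.rpow_one]
          have : -(1 / Q0) * P0 = 1 - P0 := by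
            have := hPQ0.mul_eq_add; field_simp; linarith
          simp only [this]
          congr 2; exact lintegral_congr fun t => mul_comm _ _
      _ ≤ (C0 * ∫⁻ t, u t * v t) ^ (1 / P0) * (∫⁻ t, u t * v t) ^ (1 / Q0) := by
          gcongr; exact hW.trans (mul_le_mul_right hνv _)
      _ = C0 ^ (1 / P0) * ∫⁻ t, u t * v t := by
          rw [ENNReal.mul_rpow_of_nonneg _ _ (by positivity), mul_assoc, ← ENNReal.rpow_add_of_nonneg _ _
            (by positivity) (by simpa using hPQ0.symm.nonneg), one_div, one_div, hPQ0.inv_add_inv_eq_one,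
            ENNReal.rpow_one]
      _ ≤ C0 ^ (1 / P0) * (3 * I ^ (1 / Q) * (2 * wn w P ν + δ)) := by gcongr
      _ = _ := by ring
  have main2 : ∀ T : ℕ, wn w P (fun t => if |t| ≤ T ∧ w t ≤ T then min (U t) T else 0) ≤
      6 * C0 ^ (1 / P0) * wn w P ν := by
    intro T
    have hCf : C0 ^ (1 / P0) ≠ ∞ := ENNReal.rpow_ne_top_of_nonneg (by positivity) hC0
    have hC0' : C0 ^ (1 / P0) ≠ 0 := by simp [hC00, p01.le]
    refine ENNReal.le_of_forall_pos_le_add fun δ hδ _ => ?_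
    have h3 : 3 * C0 ^ (1 / P0) ≠ 0 := mul_ne_zero (by simp) hC0'
    have h4 : 3 * C0 ^ (1 / P0) ≠ ∞ := ENNReal.mul_ne_top (by simp) hCf
    refine (main T (δ / (3 * C0 ^ (1 / P0))) ?_).trans ?_
    · exact (ENNReal.div_pos (by simpa using hδ.ne') h4).ne'
    · rw [mul_add, ENNReal.mul_div_cancel h3 h4]; apply le_of_eq; ring
  have lim : ∀ t, Filter.Tendsto (fun T : ℕ => w t *
      (if |t| ≤ T ∧ w t ≤ T then min (U t) T else 0) ^ P) Filter.atTop (nhds (w t * U t ^ P)) := by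
    intro t
    refine ENNReal.Tendsto.const_mul (((ENNReal.continuous_rpow_const).tendsto _).comp ?_) (Or.inr (hw.f t))
    have h1 : Filter.Tendsto (fun T : ℕ => min (U t) (T : ℝ≥0∞)) Filter.atTop (nhds (min (U t) ∞)) :=
      tendsto_const_nhds.min ENNReal.tendsto_nat_nhds_top
    rw [min_top_right] at h1
    refine h1.congr' ?_
    obtain ⟨n1, hn1⟩ := exists_nat_ge |t|
    obtain ⟨n2, hn2⟩ := ENNReal.exists_nat_gt (hw.f t)
    filter_upwards [Filter.eventually_ge_atTop n1, Filter.eventually_ge_atTop n2] with T h2 h3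
    rw [if_pos ⟨hn1.trans (by exact_mod_cast h2), hn2.le.trans (by exact_mod_cast h3)⟩]
  rw [wn, one_div, ENNReal.rpow_inv_le_iff p1, lintegral_congr fun t => (lim t).liminf_eq.symm]
  refine (lintegral_liminf_le fun T => hw.m.mul (Measurable.pow_const (Measurable.ite (ms T)
    (Um.min measurable_const) measurable_const) _)).trans ?_
  refine Filter.liminf_le_of_frequently_le' (Filter.Frequently.of_forall fun T => ?_)
  rw [← ENNReal.rpow_inv_le_iff p1, ← one_div]
  exact main2 T


lemma mixAux_succ {n : ℕ} {p : Fin n → ℝ≥0∞} (hp : ∀ i, p i ≠ ∞) {l : ℕ} (h : l < n)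
    (F : RV n → ℝ≥0∞) (x : RV n) : mixAux n p (l + 1) F x =
      (∫⁻ t : ℝ, (mixAux n p l F (Function.update x ⟨l, h⟩ t)) ^ (p ⟨l, h⟩).toReal) ^
            (1 / (p ⟨l, h⟩).toReal) := by
  simp [mixAux, h, hp]

lemma mixAux_meas {n : ℕ} {p : Fin n → ℝ≥0∞} (hp : ∀ i, p i ≠ ∞) {F : RV n → ℝ≥0∞}
    (hF : Measurable F) (l : ℕ) : Measurable (mixAux n p l F) := by
  induction l with
  | zero => exact hF
  | succ l ih =>
    by_cases h : l < n
    · have : mixAux n p (l + 1) F = fun x =>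
        (∫⁻ t : ℝ, (mixAux n p l F (Function.update x ⟨l, h⟩ t)) ^ (p ⟨l, h⟩).toReal) ^
            (1 / (p ⟨l, h⟩).toReal) := funext fun x => mixAux_succ hp h F x
      rw [this]
      refine Measurable.pow_const (Measurable.lintegral_prod_right'
        (f := fun z : RV n × ℝ => mixAux n p l F (Function.update z.1 ⟨l, h⟩ z.2) ^ (p ⟨l, h⟩).toReal)
        ((ih.comp measurable_update').pow_const _)) _
    · have : mixAux n p (l + 1) F = mixAux n p l F := funext fun x => by simp [mixAux, h]
      rwa [this]

lemma mixAux_le {n : ℕ} {p : Fin n → ℝ≥0∞} (hp : ∀ i, p i ≠ ∞) (hp0 : ∀ i, p i ≠ 0)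
    {F G : RV n → ℝ≥0∞} {B : ℝ≥0∞} (hB : B ≠ ∞) {l0 : ℕ}
    (h : ∀ x, mixAux n p l0 F x ≤ B * mixAux n p l0 G x) {l : ℕ} (hl : l0 ≤ l) (x : RV n) :
    mixAux n p l F x ≤ B * mixAux n p l G x := by
  induction l, hl using Nat.le_induction generalizing x with
  | base => exact h x
  | succ l _ ih =>
    by_cases h : l < n
    · rw [mixAux_succ hp h, mixAux_succ hp h]
      have p0 : 0 < (p ⟨l, h⟩).toReal := ENNReal.toReal_pos (hp0 _) (hp _)
      calc _ ≤ (∫⁻ t : ℝ, B ^ (p ⟨l, h⟩).toReal * (mixAux n p l G (Function.update x ⟨l, h⟩ t)) ^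
              (p ⟨l, h⟩).toReal) ^ (1 / (p ⟨l, h⟩).toReal) := by
            refine ENNReal.rpow_le_rpow (lintegral_mono fun t => ?_) (by positivity)
            rw [← ENNReal.mul_rpow_of_nonneg _ _ p0.le]
            exact ENNReal.rpow_le_rpow (ih _) p0.le
        _ = _ := by
            rw [lintegral_const_mul' _ _ (ENNReal.rpow_ne_top_of_nonneg p0.le hB),
              ENNReal.mul_rpow_of_nonneg _ _ (by positivity), ← ENNReal.rpow_mul,
              mul_one_div_cancel p0.ne', ENNReal.rpow_one]
    · simpa [mixAux, h] using ih x

/-- the `ℓ_q` quasinorm -/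
def lq (q : ℝ≥0∞) (u : ℕ → ℝ≥0∞) : ℝ≥0∞ :=
  if q = ∞ then ⨆ k, u k else (∑' k, u k ^ q.toReal) ^ (1 / q.toReal)

lemma lq_meas {X : Type*} [MeasurableSpace X] (q : ℝ≥0∞) {u : ℕ → X → ℝ≥0∞}
    (hu : ∀ k, Measurable (u k)) : Measurable fun x => lq q fun k => u k x := by
  unfold lq
  split_ifs
  · exact .iSup hu
  · exact (Measurable.tsum fun k => (hu k).pow_const _).pow_const _

/-- coordinatewise averages -/
def Ei {n : ℕ} (i : Fin n) (c : ℕ → ℝ → ℤ) (G : ℕ → RV n → ℝ≥0∞) (k : ℕ) (x : RV n) : ℝ≥0∞ :=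
  av c volume k (fun s => G k (Function.update x i s)) (x i)

lemma Ei_meas {n : ℕ} (i : Fin n) {c : ℕ → ℝ → ℤ} (hc : Prt c) {G : ℕ → RV n → ℝ≥0∞}
    (hG : ∀ k, Measurable (G k)) (k : ℕ) : Measurable (Ei i c G k) := by
  have hz : ∀ z : ℤ, Measurable fun y : RV n => ∫⁻ s in c k ⁻¹' {z}, G k (Function.update y i s) :=
    fun z => Measurable.lintegral_prod_right' (ν := volume.restrict (c k ⁻¹' {z}))
      (f := fun y : RV n × ℝ => G k (Function.update y.1 i y.2)) ((hG k).comp measurable_update')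
  have h1 : Measurable (Function.uncurry fun (z : ℤ) (y : RV n) =>
      (volume (c k ⁻¹' {z}))⁻¹ * ∫⁻ s in c k ⁻¹' {z}, G k (Function.update y i s)) :=
    measurable_from_prod_countable_right fun z => (hz z).const_mul (volume (c k ⁻¹' {z}))⁻¹
  have h2 : Measurable fun x : RV n => (c k (x i), x) :=
    ((hc.meas k).comp (measurable_pi_apply i)).prodMk measurable_id
  have h3 := h1.comp h2
  simp only [Function.comp_def, Function.uncurry] at h3
  unfold Ei av
  exact h3

lemma AP_one {c : ℕ → ℝ → ℤ} (hv : Gd c volume) (P : ℝ) : AP c P 1 fun _ => 1 := by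
  refine ⟨measurable_const, by simp, by simp, fun k t => ?_⟩
  have : av c volume k (fun _ => 1) t = 1 := by
    simp only [av, setLIntegral_const, one_mul]; exact ENNReal.inv_mul_cancel (hv k t).1 (hv k t).2
  simp [this]

lemma vv_base {n : ℕ} (i : Fin n) {q : ℝ≥0∞} (hq : 1 < q) {P : ℝ} (hP : 1 < P) {C : ℝ≥0∞} (hC : C ≠ ∞) :
    ∃ B : ℝ≥0∞, B ≠ ∞ ∧ ∀ c, Prt c → Gd c volume → ∀ w, AP c P C w → ∀ g : ℕ → ℝ → ℝ≥0∞,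
      (∀ k, Measurable (g k)) →
      ∫⁻ t, w t * (lq q fun k => av c volume k (g k) t) ^ P ≤ B * ∫⁻ t, w t * (lq q fun k => g k t) ^ P := by
  by_cases hq1 : q = ∞
  · refine ⟨(C ^ (P / (P - 1)) * (2 ^ (P / (P - 1)) * ENNReal.ofReal (P / (P - 1) / (P / (P - 1) - 1))) *
        (2 ^ P * ENNReal.ofReal (P / (P - 1)))), ?_, fun c hc hv w hw g hg => ?_⟩
    · have hP0 : 0 < P := by linarith
      have hPQ : 0 < P / (P - 1) := div_pos hP0 (by linarith)
      have h2 : ∀ x : ℝ, 0 < x → (2 : ℝ≥0∞) ^ x ≠ ∞ := fun x hx =>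
        ENNReal.rpow_ne_top_of_nonneg hx.le (by simp)
      have h3 := ENNReal.rpow_ne_top_of_nonneg hPQ.le hC
      finiteness [h2 P hP0, h2 _ hPQ, h3]
    · simp only [lq, hq1, if_true]
      refine le_trans (lintegral_mono fun t => ?_) (muck hc hv hP hC hw (.iSup hg))
      gcongr with k
      exact av_mono_ae hc (ae_of_all _ fun s _ => le_iSup (fun k => g k s) k)
  have hQ : 1 < q.toReal := by
    rw [← ENNReal.toReal_one]; exact (ENNReal.toReal_lt_toReal (by simp) hq1).2 hq
  set Q := q.toReal
  have Q0 : 0 < Q := by linarith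
  obtain ⟨c0, hc0, h⟩ := extrap hQ hP hC
  obtain ⟨B, hB, h⟩ := h c0 hc0
  refine ⟨B, hB, fun c hc hv w hw g hg => ?_⟩
  have m1 := lq_meas q (fun k => av_meas (m := volume) hc k (g k))
  have m2 := lq_meas q hg
  refine h c hc hv _ _ m1 m2 (fun w hw => ?_) w hw
  have e : ∀ u : ℕ → ℝ≥0∞, lq q u ^ Q = ∑' k, u k ^ Q := fun u => by
    simp only [lq, hq1, if_false]
    rw [← ENNReal.rpow_mul, one_div_mul_cancel Q0.ne', ENNReal.rpow_one]
  simp only [e, ← ENNReal.tsum_mul_left]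
  rw [lintegral_tsum fun k => show AEMeasurable (fun t => w t * av c volume k (g k) t ^ Q) _ from
      (hw.m.mul ((av_meas hc k _).pow_const _)).aemeasurable,
    lintegral_tsum fun k => show AEMeasurable (fun t => w t * g k t ^ Q) _ from
      (hw.m.mul ((hg k).pow_const _)).aemeasurable, ← ENNReal.tsum_mul_left]
  refine ENNReal.tsum_le_tsum fun k => ?_
  have hQQ := Real.HolderConjugate.conjExponent hQ
  set Q' := Q.conjExponent
  have key : ∀ t, av c volume k (g k) t ^ Q * av c volume k w t ≤
      c0 * av c volume k (fun s => w s * g k s ^ Q) t := by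
    intro t
    have h1 : 0 < Q - 1 := by linarith
    have hold : av c volume k (g k) t ^ Q ≤ av c volume k (fun s => w s * g k s ^ Q) t *
        av c volume k (fun s => w s ^ (-(1 / (Q - 1)))) t ^ (Q - 1) := by
      have := jensen_ker (volume.restrict (c k ⁻¹' {c k t})) (K := fun s => w s ^ (-(1 / (Q - 1))))
        (g := fun s => g k s * w s ^ (1 / (Q - 1))) (hw.m.pow_const _)
        ((hg k).mul (hw.m.pow_const _)) hQ.le
      have e1 : ∀ s, w s ^ (-(1 / (Q - 1))) * (g k s * w s ^ (1 / (Q - 1))) = g k s := fun s => by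
        rw [mul_left_comm, ← ENNReal.rpow_add _ _ (hw.p s) (hw.f s)]; simp
      have e2 : ∀ s, w s ^ (-(1 / (Q - 1))) * (g k s * w s ^ (1 / (Q - 1))) ^ Q = w s * g k s ^ Q :=
        fun s => by
          rw [ENNReal.mul_rpow_of_nonneg _ _ Q0.le, ← ENNReal.rpow_mul, mul_left_comm,
            ← ENNReal.rpow_add _ _ (hw.p s) (hw.f s), mul_comm]
          congr 1
          conv_rhs => rw [← ENNReal.rpow_one (w s)]
          congr 1; field_simp; ring
      simp only [e1, e2] at this
      simp only [av]
      rw [ENNReal.mul_rpow_of_nonneg _ _ Q0.le, ENNReal.mul_rpow_of_nonneg _ _ h1.le]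
      refine (mul_le_mul_right this _).trans (le_of_eq ?_)
      have : ((volume (c k ⁻¹' {c k t}))⁻¹) ^ Q = (volume (c k ⁻¹' {c k t}))⁻¹ *
          ((volume (c k ⁻¹' {c k t}))⁻¹) ^ (Q - 1) := by
        conv_rhs => enter [1]; rw [← ENNReal.rpow_one (volume (c k ⁻¹' {c k t}))⁻¹]
        rw [← ENNReal.rpow_add_of_nonneg _ _ zero_le_one h1.le]; congr 1; ring
      rw [this]; ring
    refine (mul_le_mul_left hold _).trans ?_
    calc _ = (av c volume k w t * av c volume k (fun s => w s ^ (-(1 / (Q - 1)))) t ^ (Q - 1)) *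
          av c volume k (fun s => w s * g k s ^ Q) t := by ring
      _ ≤ _ := by gcongr; exact hw.b k t
  have cst : ∀ s t, c k s = c k t → av c volume k (g k) s ^ Q = av c volume k (g k) t ^ Q :=
    fun s t e => by simp only [av, e]
  calc _ = ∫⁻ t, av c volume k (g k) t ^ Q * w t := by simp only [mul_comm]
    _ = ∫⁻ t, av c volume k (g k) t ^ Q * av c volume k w t := (av_int hc hv k hw.m cst).symm
    _ ≤ ∫⁻ t, c0 * av c volume k (fun s => w s * g k s ^ Q) t := lintegral_mono key
    _ = c0 * ∫⁻ t, 1 * av c volume k (fun s => w s * g k s ^ Q) t := by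
        rw [lintegral_const_mul _ (av_meas hc k _)]; simp
    _ = _ := by rw [av_int hc hv k (show Measurable fun s => w s * g k s ^ Q from
          hw.m.mul ((hg k).pow_const _)) (by simp)]; simp

lemma vv_ind {n : ℕ} {p : Fin n → ℝ≥0∞} (hp : ∀ i, p i ≠ ∞) (hp1 : ∀ i, 1 < p i) {q : ℝ≥0∞} (hq : 1 < q)
    (i : Fin n) (m : ℕ) (hm : m ≤ i) : ∀ {P : ℝ} (_ : 1 < P) {C : ℝ≥0∞} (_ : C ≠ ∞),
    ∃ B : ℝ≥0∞, B ≠ ∞ ∧ ∀ c, Prt c → Gd c volume → ∀ w, AP c P C w → ∀ G : ℕ → RV n → ℝ≥0∞,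
      (∀ k, Measurable (G k)) → ∀ x : RV n,
      ∫⁻ t, w t * mixAux n p m (fun y => lq q fun k => Ei i c G k y) (Function.update x i t) ^ P ≤
        B * ∫⁻ t, w t * mixAux n p m (fun y => lq q fun k => G k y) (Function.update x i t) ^ P := by
  induction m with
  | zero =>
    intro P hP C hC
    obtain ⟨B, hB, h⟩ := vv_base i hq hP hC
    refine ⟨B, hB, fun c hc hv w hw G hG x => ?_⟩
    have := h c hc hv w hw (fun k t => G k (Function.update x i t))
      (fun k => (hG k).comp (measurable_update x))
    simpa [mixAux, Ei] using this
  | succ m ih =>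
    intro P hP C hC
    have hmn : m < n := by omega
    have hp' : 1 < (p ⟨m, hmn⟩).toReal := by
      rw [← ENNReal.toReal_one]; exact (ENNReal.toReal_lt_toReal (by simp) (hp _)).2 (hp1 _)
    set P0 := (p ⟨m, hmn⟩).toReal
    have hP0 : 0 < P0 := by linarith
    obtain ⟨c0, hc0, h⟩ := extrap hp' hP hC
    obtain ⟨B0, hB0, h0⟩ := ih (by omega) hp' hc0
    obtain ⟨B, hB, h⟩ := h B0 hB0
    refine ⟨B, hB, fun c hc hv w hw G hG x => ?_⟩
    have m1 := lq_meas q (fun k => Ei_meas i hc hG k)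
    have m2 := lq_meas q hG
    refine h c hc hv _ _ ((mixAux_meas hp m1 _).comp (measurable_update x))
      ((mixAux_meas hp m2 _).comp (measurable_update x)) (fun w hw => ?_) w hw
    have hne : i ≠ ⟨m, hmn⟩ := fun h => by simp [h] at hm
    have tr : ∀ F : RV n → ℝ≥0∞, Measurable F →
        ∫⁻ t, w t * mixAux n p (m + 1) F (Function.update x i t) ^ P0 =
        ∫⁻ s, ∫⁻ t, w t * mixAux n p m F (Function.update (Function.update x ⟨m, hmn⟩ s) i t) ^ P0 := by
      intro F hF
      have hF' := mixAux_meas hp hF m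
      rw [lintegral_lintegral_swap]
      · refine lintegral_congr fun t => ?_
        rw [lintegral_const_mul, mixAux_succ hp hmn]
        · rw [← ENNReal.rpow_mul, one_div_mul_cancel hP0.ne', ENNReal.rpow_one]
          congr 1
          refine lintegral_congr fun s => ?_
          rw [Function.update_comm hne]
        · refine Measurable.pow_const (hF'.comp ?_) _
          exact (measurable_update' (a := i)).comp ((measurable_update x).prodMk measurable_const)
      · refine Measurable.aemeasurable (Measurable.mul (hw.m.comp measurable_snd)
          (Measurable.pow_const (hF'.comp ?_) _))
        exact (measurable_update' (a := i)).comp (((measurable_update x).comp measurable_fst).prodMk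
          measurable_snd)
    dsimp only [Function.comp_def]
    rw [tr _ m1, tr _ m2, ← lintegral_const_mul' _ _ hB0]
    exact lintegral_mono fun s => h0 c hc hv w hw G hG _

lemma vv {n : ℕ} {p : Fin n → ℝ≥0∞} (hp : ∀ i, p i ≠ ∞) (hp1 : ∀ i, 1 < p i) {q : ℝ≥0∞} (hq : 1 < q)
    (i : Fin n) : ∃ B : ℝ≥0∞, B ≠ ∞ ∧ ∀ c, Prt c → Gd c volume → ∀ G : ℕ → RV n → ℝ≥0∞,
      (∀ k, Measurable (G k)) → seqNorm n p q (Ei i c G) ≤ B * seqNorm n p q G := by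
  have hpi : 1 < (p i).toReal := by
    rw [← ENNReal.toReal_one]; exact (ENNReal.toReal_lt_toReal (by simp) (hp _)).2 (hp1 _)
  have h0 : 0 < (p i).toReal := by linarith
  obtain ⟨B, hB, h⟩ := vv_ind hp hp1 hq i i le_rfl hpi (C := 1) (by simp)
  have hB' : B ^ (1 / (p i).toReal) ≠ ∞ := ENNReal.rpow_ne_top_of_nonneg (by positivity) hB
  refine ⟨B ^ (1 / (p i).toReal), hB', fun c hc hv G hG => ?_⟩
  refine mixAux_le hp (fun j => (zero_lt_one.trans (hp1 j)).ne') hB' (l0 := i + 1) (fun x => ?_) i.2 _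
  rw [mixAux_succ hp i.2, mixAux_succ hp i.2, ← ENNReal.mul_rpow_of_nonneg _ _ (by positivity)]
  refine ENNReal.rpow_le_rpow ?_ (by positivity)
  have := h c hc hv _ (AP_one hv _) G hG x
  simp only [one_mul] at this
  exact this


/-- shifted dyadic grids -/
def gz (τ κ : ℤ) (t : ℝ) : ℤ := ⌊(2 : ℝ) ^ κ * t - τ * (-1) ^ κ / 3⌋

lemma gz_ref1 (τ κ : ℤ) {s t : ℝ} (h : gz τ (κ + 1) s = gz τ (κ + 1) t) : gz τ κ s = gz τ κ t := by
  obtain ⟨σ, hσ⟩ : ∃ σ : ℤ, ((-1 : ℝ)) ^ (κ + 1) = σ := by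
    rcases Int.even_or_odd (κ + 1) with e | e
    · exact ⟨1, by rw [e.neg_one_zpow]; simp⟩
    · exact ⟨-1, by rw [e.neg_one_zpow]; simp⟩
  have e : ∀ t, gz τ κ t = (gz τ (κ + 1) t + τ * σ) / 2 := fun t => by
    have := Int.floor_div_cast_of_nonneg (k := ℝ) (n := 2) (by norm_num)
      ((2 : ℝ) ^ (κ + 1) * t - τ * (-1) ^ (κ + 1) / 3 + ((τ * σ : ℤ) : ℝ))
    rw [Int.floor_add_intCast] at this
    unfold gz
    rw [← this]
    congr 1
    push_cast
    rw [← hσ, zpow_add₀ (by norm_num), zpow_add₀ (by norm_num)]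
    simp only [zpow_one]
    ring
  rw [e, e, h]

lemma gz_ref (τ : ℤ) {κ κ' : ℤ} (hκ : κ ≤ κ') {s t : ℝ} (h : gz τ κ' s = gz τ κ' t) :
    gz τ κ s = gz τ κ t := by
  induction κ', hκ using Int.leInduction with
  | base => exact h
  | succ m _ ih => exact ih (gz_ref1 τ m h)

lemma gz_vol (τ κ z : ℤ) : volume (gz τ κ ⁻¹' {z}) = ENNReal.ofReal ((2 : ℝ) ^ (-κ)) := by
  have h2 : (0 : ℝ) < 2 ^ κ := by positivity
  have : gz τ κ ⁻¹' {z} = Set.Ico (((z : ℝ) + τ * (-1) ^ κ / 3) / 2 ^ κ)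
      (((z : ℝ) + 1 + τ * (-1) ^ κ / 3) / 2 ^ κ) := by
    ext t
    simp only [Set.mem_preimage, Set.mem_singleton_iff, gz, Int.floor_eq_iff, Set.mem_Ico,
      div_le_iff₀ h2, lt_div_iff₀ h2]
    constructor <;> rintro ⟨h, h'⟩ <;> constructor <;> linarith
  rw [this, Real.volume_Ico]
  congr 1
  rw [zpow_neg]; field_simp; ring

lemma gz_third {κ : ℤ} {s t : ℝ} (h : 2 ^ κ * |t - s| ≤ 1 / 3) :
    gz 0 κ s = gz 0 κ t ∨ gz 1 κ s = gz 1 κ t := by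
  have h2 : (0 : ℝ) < 2 ^ κ := by positivity
  wlog hst : s ≤ t generalizing s t
  · rcases this (s := t) (t := s) (by rwa [abs_sub_comm]) (by linarith) with h | h
    · exact .inl h.symm
    · exact .inr h.symm
  rw [abs_of_nonneg (by linarith)] at h
  by_contra! hh
  have hst' : (2 : ℝ) ^ κ * s ≤ 2 ^ κ * t := by gcongr
  have l : ∀ δ : ℝ, ⌊(2 : ℝ) ^ κ * s - δ⌋ ≠ ⌊2 ^ κ * t - δ⌋ → 2 ^ κ * s < ⌊2 ^ κ * t - δ⌋ + δ ∧
      ⌊2 ^ κ * t - δ⌋ + δ ≤ 2 ^ κ * t := by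
    intro δ hδ
    have h1 := Int.floor_le (2 ^ κ * t - δ)
    refine ⟨?_, by linarith⟩
    have h3 : ⌊(2 : ℝ) ^ κ * s - δ⌋ < ⌊2 ^ κ * t - δ⌋ := lt_of_le_of_ne (Int.floor_mono (by linarith)) hδ
    have := Int.floor_lt.1 h3
    linarith
  obtain ⟨A, B⟩ := l _ hh.1
  obtain ⟨A', B'⟩ := l _ hh.2
  set m := ⌊(2 : ℝ) ^ κ * t - ((0 : ℤ) : ℝ) * (-1) ^ κ / 3⌋
  set m' := ⌊(2 : ℝ) ^ κ * t - ((1 : ℤ) : ℝ) * (-1) ^ κ / 3⌋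
  push_cast at A B A' B'
  rw [mul_sub] at h
  have p1 : 3 * (m - m' : ℝ) - (-1) ^ κ < 1 := by linarith
  have p2 : -1 < 3 * (m - m' : ℝ) - (-1) ^ κ := by linarith
  rcases Int.even_or_odd κ with e | e
  · rw [e.neg_one_zpow] at p1 p2
    have p1' : 3 * (m - m') - 1 < 1 := by exact_mod_cast p1
    have p2' : -1 < 3 * (m - m') - 1 := by exact_mod_cast p2
    omega
  · rw [e.neg_one_zpow] at p1 p2
    have p1' : 3 * (m - m') - -1 < 1 := by exact_mod_cast p1
    have p2' : -1 < 3 * (m - m') - -1 := by exact_mod_cast p2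
    omega

/-- grid sequence adapted to `2^{ka}` -/
def gr (a : ℝ) (i : ℕ) (τ : ℤ) (k : ℕ) : ℝ → ℤ := gz τ (⌊k * a⌋ - i)

lemma gr_prt {a : ℝ} (ha : 0 ≤ a) (i : ℕ) (τ : ℤ) : Prt (gr a i τ) where
  meas k := Int.measurable_floor.comp ((measurable_const.mul measurable_id).sub measurable_const)
  ref k s t h := by
    refine gz_ref τ ?_ h
    gcongr
    simp

lemma gr_gd (a : ℝ) (i : ℕ) (τ : ℤ) : Gd (gr a i τ) volume := fun k t => by
  rw [gr, gz_vol]; refine ⟨?_, by simp⟩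
  simp; positivity

/-- one dimensional kernel -/
def ker1 (a : ℝ) (k : ℕ) (u : ℝ) : ℝ≥0∞ :=
  ENNReal.ofReal (2 ^ (k * a) / (1 + 2 ^ (k * a) * |u|) ^ 2)

lemma ker1_meas (a : ℝ) (k : ℕ) : Measurable (ker1 a k) := by unfold ker1; fun_prop

lemma ker1_le (a : ℝ) (k : ℕ) (s t : ℝ) : ∃ i : ℕ, ∃ τ ∈ ({0, 1} : Finset ℤ),
    gr a i τ k s = gr a i τ k t ∧ ker1 a k (t - s) ≤
      ENNReal.ofReal (128 * (1/2) ^ i) * (volume (gr a i τ k ⁻¹' {gr a i τ k t}))⁻¹ := by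
  set b : ℝ := 2 ^ ((k : ℝ) * a)
  have hb : 0 < b := by positivity
  set X := b * |t - s|
  have hX : 0 ≤ X := by positivity
  obtain ⟨m, h1, h2⟩ := exists_nat_pow_near (x := 1 + X) (y := (2 : ℝ)) (by linarith) (by norm_num)
  have f1 : (2 : ℝ) ^ (⌊k * a⌋ : ℤ) ≤ b := by
    rw [← Real.rpow_intCast]; exact Real.rpow_le_rpow_of_exponent_le (by norm_num) (Int.floor_le _)
  have f2 : b ≤ 2 * (2 : ℝ) ^ (⌊k * a⌋ : ℤ) := by
    rw [← zpow_one_add₀ (by norm_num), ← Real.rpow_intCast]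
    refine Real.rpow_le_rpow_of_exponent_le (by norm_num) ?_
    push_cast
    linarith [Int.lt_floor_add_one (k * a)]
  have f0 : (0 : ℝ) < (2 : ℝ) ^ (⌊k * a⌋ : ℤ) := by positivity
  have hm : (0 : ℝ) < 2 ^ m := by positivity
  have e : (2 : ℝ) ^ (⌊k * a⌋ - ((m + 3 : ℕ) : ℤ)) = (2 : ℝ) ^ (⌊k * a⌋ : ℤ) / (8 * 2 ^ m) := by
    rw [zpow_sub₀ (by norm_num), zpow_natCast, pow_add]; ring
  have hh : 2 ^ (⌊k * a⌋ - ((m + 3 : ℕ) : ℤ)) * |t - s| ≤ (1 : ℝ) / 3 := by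
    rw [e, div_mul_eq_mul_div, div_le_iff₀ (by positivity)]
    have : (2 : ℝ) ^ (⌊k * a⌋ : ℤ) * |t - s| ≤ X := mul_le_mul_of_nonneg_right f1 (abs_nonneg _)
    rw [pow_succ] at h2
    linarith
  have fin : ∀ τ, ker1 a k (t - s) ≤ ENNReal.ofReal (128 * (1/2) ^ (m + 3)) *
      (volume (gr a (m + 3) τ k ⁻¹' {gr a (m + 3) τ k t}))⁻¹ := by
    intro τ
    rw [gr, gz_vol, ← ENNReal.ofReal_inv_of_pos (by positivity), ← zpow_neg, neg_neg, e,
      ← ENNReal.ofReal_mul (by positivity)]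
    refine ENNReal.ofReal_le_ofReal ?_
    change b / (1 + X) ^ 2 ≤ _
    calc b / (1 + X) ^ 2 ≤ 2 * (2 : ℝ) ^ (⌊k * a⌋ : ℤ) / (2 ^ m) ^ 2 := by gcongr
      _ = _ := by
        rw [one_div, inv_pow, pow_add]; field_simp; norm_num
  rcases gz_third hh with h | h
  · exact ⟨m + 3, 0, by simp, h, fin 0⟩
  · exact ⟨m + 3, 1, by simp, h, fin 1⟩


lemma mixAux_tsum {n : ℕ} {p : Fin n → ℝ≥0∞} (hp : ∀ i, p i ≠ ∞) (hp1 : ∀ i, 1 ≤ p i)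
    {F : ℕ → RV n → ℝ≥0∞} (hF : ∀ j, Measurable (F j)) (l : ℕ) (x : RV n) :
    mixAux n p l (fun y => ∑' j, F j y) x ≤ ∑' j, mixAux n p l (F j) x := by
  induction l generalizing x with
  | zero => exact le_rfl
  | succ l ih =>
    by_cases h : l < n
    · have p1 : 1 ≤ (p ⟨l, h⟩).toReal := by
        rw [← ENNReal.toReal_one]; exact ENNReal.toReal_mono (hp _) (hp1 _)
      simp only [mixAux_succ hp h]
      calc _ ≤ (∫⁻ t : ℝ, (∑' j, mixAux n p l (F j) (Function.update x ⟨l, h⟩ t)) ^ (p ⟨l, h⟩).toReal) ^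
            (1 / (p ⟨l, h⟩).toReal) := by
            refine ENNReal.rpow_le_rpow (lintegral_mono fun t => ?_) (by positivity)
            exact ENNReal.rpow_le_rpow (ih _) (by positivity)
        _ ≤ _ := by
            have := wn_sum (w := fun _ => 1) (g := fun j t => mixAux n p l (F j) (Function.update x ⟨l, h⟩ t))
              measurable_const (by simp) p1 (fun j => (mixAux_meas hp (hF j) l).comp (measurable_update x))
            simpa only [wn, one_mul] using this
    · simpa [mixAux, h] using ih x

lemma lq_tsum {q : ℝ≥0∞} (hq : 1 ≤ q) (u : ℕ → ℕ → ℝ≥0∞) :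
    lq q (fun k => ∑' j, u j k) ≤ ∑' j, lq q (u j) := by
  unfold lq
  split_ifs with h
  · exact iSup_le fun k => ENNReal.tsum_le_tsum fun j => le_iSup (u j) k
  · have q1 : 1 ≤ q.toReal := by
      rw [← ENNReal.toReal_one]; exact ENNReal.toReal_mono h hq
    have := mink (Measure.count : Measure ℕ) (Measure.count : Measure ℕ) q1 (g := fun k j => u j k)
      (.of_discrete)
    simpa only [lintegral_count] using this

lemma lq_mono {q : ℝ≥0∞} {u v : ℕ → ℝ≥0∞} (h : ∀ k, u k ≤ v k) : lq q u ≤ lq q v := by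
  unfold lq
  split_ifs
  · exact iSup_mono h
  · exact ENNReal.rpow_le_rpow (ENNReal.tsum_le_tsum fun k =>
      ENNReal.rpow_le_rpow (h k) ENNReal.toReal_nonneg) (by positivity)

lemma lq_mul {q : ℝ≥0∞} (hq : q ≠ 0) (c : ℝ≥0∞) (u : ℕ → ℝ≥0∞) :
    lq q (fun k => c * u k) = c * lq q u := by
  unfold lq
  split_ifs with h
  · rw [ENNReal.mul_iSup]
  · have q0 : 0 < q.toReal := ENNReal.toReal_pos hq h
    simp only [ENNReal.mul_rpow_of_nonneg _ _ q0.le, ENNReal.tsum_mul_left]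
    rw [ENNReal.mul_rpow_of_nonneg _ _ (by positivity), ← ENNReal.rpow_mul,
              mul_one_div_cancel q0.ne', ENNReal.rpow_one]

lemma seqNorm_eq (n : ℕ) (p : Fin n → ℝ≥0∞) (q : ℝ≥0∞) (u : ℕ → RV n → ℝ≥0∞) :
    seqNorm n p q u = mixAux n p n (fun x => lq q fun k => u k x) fun _ => 0 := rfl

section
variable {n : ℕ} {p : Fin n → ℝ≥0∞} (hp : ∀ i, p i ≠ ∞)
include hp

lemma seqNorm_le (hp0 : ∀ i, p i ≠ 0) {q : ℝ≥0∞} (hq : q ≠ 0) {u v : ℕ → RV n → ℝ≥0∞} {B : ℝ≥0∞} (hB : B ≠ ∞)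
    (h : ∀ k x, u k x ≤ B * v k x) : seqNorm n p q u ≤ B * seqNorm n p q v := by
  simp only [seqNorm_eq]
  refine mixAux_le hp hp0 hB (l0 := 0) (fun x => ?_) (Nat.zero_le _) _
  simp only [mixAux]
  rw [← lq_mul hq]
  exact lq_mono fun k => h k x

lemma seqNorm_tsum (hp1 : ∀ i, 1 ≤ p i) {q : ℝ≥0∞} (hq : 1 ≤ q) {u : ℕ → ℕ → RV n → ℝ≥0∞}
    (hu : ∀ j k, Measurable (u j k)) :
    seqNorm n p q (fun k x => ∑' j, u j k x) ≤ ∑' j, seqNorm n p q (u j) := by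
  simp only [seqNorm_eq]
  refine le_trans ?_ (mixAux_tsum hp hp1 (fun j => lq_meas q (hu j)) n _)
  have := mixAux_le hp (fun i => (zero_lt_one.trans_le (hp1 i)).ne') (B := 1) (by simp) (l0 := 0) (l := n)
    (F := fun x => lq q fun k => ∑' j, u j k x)
    (G := fun x => ∑' j, lq q fun k => u j k x) (fun x => by
      simp only [mixAux, one_mul]; exact lq_tsum hq fun j k => u j k x) (Nat.zero_le _) (fun _ => 0)
  rwa [one_mul] at this

lemma seqNorm_add (hp1 : ∀ i, 1 ≤ p i) {q : ℝ≥0∞} (hq : 1 ≤ q) {u v : ℕ → RV n → ℝ≥0∞}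
    (hu : ∀ k, Measurable (u k)) (hv : ∀ k, Measurable (v k)) :
    seqNorm n p q (fun k x => u k x + v k x) ≤ seqNorm n p q u + seqNorm n p q v := by
  have hz : seqNorm n p q (fun _ _ => 0) = 0 := by
    have := seqNorm_le hp (fun i => (zero_lt_one.trans_le (hp1 i)).ne') (zero_lt_one.trans_le hq).ne' (B := 0)
      (by simp) (u := fun _ _ => 0) (v := fun _ _ => 0) (by simp)
    simpa using this
  have e : ∀ f : ℕ → ℝ≥0∞, (∀ j, f (j + 2) = 0) → ∑' j, f j = f 0 + f 1 := fun f hf => by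
    rw [tsum_eq_sum (s := Finset.range 2)]
    · simp [Finset.sum_range_succ]
    · intro j hj; obtain ⟨i, rfl⟩ := Nat.exists_eq_add_of_le' (show 2 ≤ j by simp at hj; omega); exact hf i
  have := seqNorm_tsum hp hp1 hq (u := fun j => match j with | 0 => u | 1 => v | _ + 2 => fun _ _ => 0)
    (by rintro (_ | _ | _) k; exacts [hu k, hv k, measurable_const])
  rw [e _ (fun _ => hz)] at this
  convert this using 3
  funext x
  rw [e _ (fun _ => rfl)]
end

/-- convolution in the `i`-th coordinate -/
def T1 {n : ℕ} (b : ℝ) (i : Fin n) (G : ℕ → RV n → ℝ≥0∞) (k : ℕ) (x : RV n) : ℝ≥0∞ :=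
  ∫⁻ s, ker1 b k (x i - s) * G k (Function.update x i s)

lemma T1_le {n : ℕ} {b : ℝ} (hb : 0 ≤ b) (i : Fin n) {G : ℕ → RV n → ℝ≥0∞} (hG : ∀ k, Measurable (G k))
    (k : ℕ) (x : RV n) :
    T1 b i G k x ≤ ∑' j : ℕ, (ENNReal.ofReal (128 * (1/2) ^ j) * Ei i (gr b j 0) G k x +
      ENNReal.ofReal (128 * (1/2) ^ j) * Ei i (gr b j 1) G k x) := by
  set g : ℝ → ℝ≥0∞ := fun s => G k (Function.update x i s)
  have hg : Measurable g := (hG k).comp (measurable_update x)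
  set I : ℕ → ℤ → ℝ → ℝ≥0∞ := fun j τ => (gr b j τ k ⁻¹' {gr b j τ k (x i)}).indicator (fun s =>
    ENNReal.ofReal (128 * (1/2) ^ j) * (volume (gr b j τ k ⁻¹' {gr b j τ k (x i)}))⁻¹ * g s) with hI
  have e : ∀ j τ, ENNReal.ofReal (128 * (1/2) ^ j) * Ei i (gr b j τ) G k x = ∫⁻ s, I j τ s := fun j τ => by
    simp only [hI]
    rw [lintegral_indicator ((gr_prt hb j τ).ms _ _), lintegral_const_mul _ hg, mul_assoc]; rfl
  have m : ∀ j τ, Measurable (I j τ) := fun j τ =>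
    (hg.const_mul _).indicator ((gr_prt hb j τ).ms _ _)
  simp only [e]
  simp only [← lintegral_add_left (m _ _)]
  rw [← lintegral_tsum fun j => show AEMeasurable (fun s => I j 0 s + I j 1 s) _ from
    ((m j 0).add (m j 1)).aemeasurable]
  refine lintegral_mono fun s => ?_
  obtain ⟨j, τ, hτ, h1, h2⟩ := ker1_le b k s (x i)
  refine le_trans ?_ (ENNReal.le_tsum j)
  have : ker1 b k (x i - s) * g s ≤ I j τ s := by
    simp only [hI]
    rw [Set.indicator_of_mem (by exact h1)]
    gcongr
  refine this.trans ?_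
  simp only [Finset.mem_insert, Finset.mem_singleton] at hτ
  rcases hτ with rfl | rfl
  · exact le_self_add
  · exact le_add_self

lemma T1_meas {n : ℕ} (b : ℝ) (i : Fin n) {G : ℕ → RV n → ℝ≥0∞} (hG : ∀ k, Measurable (G k)) (k : ℕ) :
    Measurable (T1 b i G k) := by
  unfold T1
  refine Measurable.lintegral_prod_right' (f := fun y : RV n × ℝ => ker1 b k (y.1 i - y.2) *
    G k (Function.update y.1 i y.2)) (.mul ((ker1_meas b k).comp ?_) ((hG k).comp measurable_update'))
  fun_prop

lemma T1_bd {n : ℕ} {p : Fin n → ℝ≥0∞} (hp : ∀ i, p i ≠ ∞) (hp1 : ∀ i, 1 < p i) {q : ℝ≥0∞} (hq : 1 < q)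
    (i : Fin n) {b : ℝ} (hb : 0 ≤ b) : ∃ B : ℝ≥0∞, B ≠ ∞ ∧ ∀ G : ℕ → RV n → ℝ≥0∞,
      (∀ k, Measurable (G k)) → seqNorm n p q (T1 b i G) ≤ B * seqNorm n p q G := by
  obtain ⟨B, hB, h⟩ := vv hp hp1 hq i
  have hp1' := fun i => (hp1 i).le
  have hp0 : ∀ i, p i ≠ 0 := fun i => (zero_lt_one.trans (hp1 i)).ne'
  have hq0 : q ≠ 0 := (zero_lt_one.trans hq).ne'
  set cc : ℕ → ℝ≥0∞ := fun j => ENNReal.ofReal (128 * (1/2) ^ j)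
  have hcc : ∑' j, cc j ≠ ∞ := by
    have : Summable fun j : ℕ => (128 : ℝ) * (1/2) ^ j := summable_geometric_two.mul_left _
    exact this.tsum_ofReal_ne_top
  refine ⟨∑' j, cc j * (B + B), ?_, fun G hG => ?_⟩
  · rw [ENNReal.tsum_mul_right]; finiteness
  have l1 : ∀ j τ, seqNorm n p q (fun k x => cc j * Ei i (gr b j τ) G k x) ≤ cc j * (B * seqNorm n p q G) :=
    fun j τ => (seqNorm_le hp hp0 hq0 ENNReal.ofReal_ne_top fun k x => le_rfl).trans
      (mul_le_mul_right (h _ (gr_prt hb j τ) (gr_gd b j τ) G hG) _)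
  have me : ∀ j τ k, Measurable (fun x => cc j * Ei i (gr b j τ) G k x) := fun j τ k =>
    (Ei_meas i (gr_prt hb j τ) hG k).const_mul _
  calc _ ≤ 1 * seqNorm n p q (fun k x => ∑' j, (cc j * Ei i (gr b j 0) G k x + cc j * Ei i (gr b j 1) G k x)) :=
        seqNorm_le hp hp0 hq0 (by simp) fun k x => by rw [one_mul]; exact T1_le hb i hG k x
    _ ≤ ∑' j, seqNorm n p q (fun k x => cc j * Ei i (gr b j 0) G k x + cc j * Ei i (gr b j 1) G k x) := by
        rw [one_mul]
        exact seqNorm_tsum hp hp1' hq.le (u := fun j k x => cc j * Ei i (gr b j 0) G k x + cc j * Ei i (gr b j 1) G k x)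
          fun j k => (me j 0 k).add (me j 1 k)
    _ ≤ ∑' j, cc j * (B + B) * seqNorm n p q G := by
        refine ENNReal.tsum_le_tsum fun j => ?_
        refine (seqNorm_add hp hp1' hq.le (me j 0) (me j 1)).trans ((add_le_add (l1 j 0) (l1 j 1)).trans_eq ?_)
        ring
    _ = _ := ENNReal.tsum_mul_right

/-- full kernel -/
def kern {n : ℕ} (a : Fin n → ℝ) (k : ℕ) (x : RV n) : ℝ≥0∞ := ∏ i, ker1 (a i) k (x i)

lemma propV {n : ℕ} {p : Fin n → ℝ≥0∞} (hp : ∀ i, p i ≠ ∞) (hp1 : ∀ i, 1 < p i) {q : ℝ≥0∞} (hq : 1 < q)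
    {a : Fin n → ℝ} (ha : ∀ i, 0 ≤ a i) : ∃ B : ℝ≥0∞, B ≠ ∞ ∧ ∀ G : ℕ → RV n → ℝ≥0∞,
      (∀ k, Measurable (G k)) →
      seqNorm n p q (fun k x => ∫⁻ y, kern a k (x - y) * G k y) ≤ B * seqNorm n p q G := by
  classical
  set μ : ∀ i : Fin n, Measure ℝ := fun _ => volume
  set T : Finset (Fin n) → (ℕ → RV n → ℝ≥0∞) → ℕ → RV n → ℝ≥0∞ := fun S G k x =>
    lmarginal μ S (fun y => (∏ i ∈ S, ker1 (a i) k (x i - y i)) * G k y) x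
  have mi : ∀ (S : Finset (Fin n)) (G : ℕ → RV n → ℝ≥0∞) (hG : ∀ k, Measurable (G k)) (k : ℕ) (x : RV n),
      Measurable (fun y => (∏ i ∈ S, ker1 (a i) k (x i - y i)) * G k y) := fun S G hG k x =>
    .mul (Finset.measurable_fun_prod _ fun i _ => (ker1_meas _ _).comp (by fun_prop)) (hG k)
  have key : ∀ S : Finset (Fin n), ∃ B : ℝ≥0∞, B ≠ ∞ ∧ ∀ G : ℕ → RV n → ℝ≥0∞, (∀ k, Measurable (G k)) →
      (∀ k, Measurable (T S G k)) ∧ seqNorm n p q (T S G) ≤ B * seqNorm n p q G := by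
    intro S
    induction S using Finset.induction_on with
    | empty => exact ⟨1, by simp, fun G hG => by simp [T, hG]⟩
    | insert i S hi ih =>
      obtain ⟨B, hB, h⟩ := ih
      obtain ⟨B', hB', h'⟩ := T1_bd hp hp1 hq i (ha i)
      refine ⟨B' * B, by finiteness, fun G hG => ?_⟩
      have e : T (insert i S) G = T1 (a i) i (T S G) := by
        funext k x
        simp only [T, T1]
        rw [lmarginal_insert _ (mi _ G hG k x) hi]
        refine lintegral_congr fun t => ?_
        simp only [Finset.prod_insert hi, mul_assoc]
        simp only [lmarginal]
        rw [← lintegral_const_mul]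
        · refine lintegral_congr fun y => ?_
          have h1 : Function.updateFinset (Function.update x i t) S y i = t := by
            simp [Function.updateFinset, hi]
          rw [h1]
          congr 2
          refine Finset.prod_congr rfl fun j hj => ?_
          rw [Function.update_of_ne (by rintro rfl; exact hi hj)]
        · exact (mi S G hG k _).comp measurable_updateFinset
      rw [e]
      obtain ⟨hm, hn⟩ := h G hG
      refine ⟨fun k => T1_meas _ _ hm k, (h' _ hm).trans ?_⟩
      rw [mul_assoc]
      gcongr
  obtain ⟨B, hB, h⟩ := key Finset.univ
  refine ⟨B, hB, fun G hG => ?_⟩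
  have := (h G hG).2
  simp only [T, lmarginal_univ] at this
  exact this


/-- power of two -/
def tp (t : ℝ) : ℝ≥0∞ := (2 : ℝ≥0∞) ^ t

lemma tp_add (s t : ℝ) : tp (s + t) = tp s * tp t := ENNReal.rpow_add _ _ (by simp) (by simp)
lemma tp_ne_top (t : ℝ) : tp t ≠ ∞ := ENNReal.rpow_ne_top_of_ne_zero (by simp) (by simp)
lemma tp_mono {s t : ℝ} (h : s ≤ t) : tp s ≤ tp t := ENNReal.rpow_le_rpow_of_exponent_le (by simp) h
lemma tp_rpow (s t : ℝ) : tp s ^ t = tp (s * t) := (ENNReal.rpow_mul _ _ _).symm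
lemma tp_of (t : ℝ) : ENNReal.ofReal ((2 : ℝ) ^ t) = tp t := by
  rw [tp, ← ENNReal.ofReal_rpow_of_pos (by norm_num)]; simp
lemma tp_ne_zero (t : ℝ) : tp t ≠ 0 := by rw [← tp_of]; simp; positivity
lemma tp_zero : tp 0 = 1 := by simp [tp]

section
variable {n : ℕ} (a : Fin n → ℝ)

/-- weight -/
def uwr (j : ℕ) (x : RV n) : ℝ := ∏ i, (1 + 2 ^ ((j : ℝ) * a i) * |x i|)
def uw (j : ℕ) (x : RV n) : ℝ≥0∞ := ENNReal.ofReal (uwr a j x)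

lemma uwr_one (j : ℕ) (x : RV n) : 1 ≤ uwr a j x := by
  unfold uwr
  refine (Finset.prod_const_one (s := (Finset.univ : Finset (Fin n)))).symm.le.trans ?_
  refine Finset.prod_le_prod (fun _ _ => zero_le_one) fun i _ => ?_
  have : 0 ≤ (2 : ℝ) ^ ((j : ℝ) * a i) * |x i| := by positivity
  linarith

lemma uw_one (j : ℕ) (x : RV n) : 1 ≤ uw a j x := by
  rw [uw, ← ENNReal.ofReal_one]; exact ENNReal.ofReal_le_ofReal (uwr_one a j x)

lemma uw_ne_top (j : ℕ) (x : RV n) : uw a j x ≠ ∞ := ENNReal.ofReal_ne_top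

lemma uw_meas (j : ℕ) : Measurable (uw a j) := by unfold uw uwr; fun_prop

lemma uw_neg (j : ℕ) (x y : RV n) : uw a j (x - y) = uw a j (y - x) := by
  simp [uw, uwr, abs_sub_comm]

lemma uwr_tri (j : ℕ) (x y z : RV n) : uwr a j (x - z) ≤ uwr a j (x - y) * uwr a j (y - z) := by
  unfold uwr
  rw [← Finset.prod_mul_distrib]
  refine Finset.prod_le_prod (fun i _ => by positivity) fun i _ => ?_
  simp only [Pi.sub_apply]
  have h := abs_sub_le (x i) (y i) (z i)
  have hb : (0 : ℝ) < 2 ^ ((j : ℝ) * a i) := by positivity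
  nlinarith [mul_nonneg (mul_nonneg hb.le (abs_nonneg (x i - y i))) (mul_nonneg hb.le (abs_nonneg (y i - z i))),
    mul_le_mul_of_nonneg_left h hb.le]

lemma uw_tri (j : ℕ) (x y z : RV n) : uw a j (x - z) ≤ uw a j (x - y) * uw a j (y - z) := by
  unfold uw
  rw [← ENNReal.ofReal_mul (by linarith [uwr_one a j (x - y)])]
  exact ENNReal.ofReal_le_ofReal (uwr_tri a j x y z)

variable {a} (ha : ∀ i, 0 ≤ a i)
include ha

lemma uw_mono {j k : ℕ} (h : j ≤ k) (x : RV n) : uw a j x ≤ uw a k x := by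
  unfold uw uwr
  refine ENNReal.ofReal_le_ofReal (Finset.prod_le_prod (fun i _ => by positivity) fun i _ => ?_)
  have := ha i
  gcongr
  norm_num

lemma uw_up (j m : ℕ) (x : RV n) : uw a (j + m) x ≤ tp (m * ∑ i, a i) * uw a j x := by
  unfold uw uwr
  rw [← tp_of, ← ENNReal.ofReal_mul (by positivity)]
  refine ENNReal.ofReal_le_ofReal ?_
  rw [Finset.mul_sum, Real.rpow_sum_of_pos (by norm_num), ← Finset.prod_mul_distrib]
  refine Finset.prod_le_prod (fun i _ => by positivity) fun i _ => ?_
  push_cast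
  rw [add_mul, Real.rpow_add (by norm_num), mul_add, mul_one]
  have : (1 : ℝ) ≤ 2 ^ ((m : ℝ) * a i) := Real.one_le_rpow (by norm_num) (mul_nonneg (by positivity) (ha i))
  nlinarith

/-- the basic averaging sum -/
def GG (a : Fin n → ℝ) (ℓ R : ℝ) (H : ℕ → RV n → ℝ≥0∞) (j : ℕ) (x : RV n) : ℝ≥0∞ :=
  ∑' l : ℕ, tp (-(l * ℓ)) * ∫⁻ z, H (j + l) z * (tp (j * ∑ i, a i) * uw a j (x - z) ^ (-R))

lemma GG_shift (ℓ : ℝ) {R : ℝ} (hR : 0 ≤ R) {H : ℕ → RV n → ℝ≥0∞} (j k : ℕ) (x y : RV n) :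
    tp (-(k * (ℓ + ∑ i, a i))) * uw a j (x - y) ^ (-R) * GG a ℓ R H (j + k) y ≤ GG a ℓ R H j x := by
  have hu : uw a j (x - y) ^ (-R) ≠ ∞ := ENNReal.rpow_ne_top_of_ne_zero
    (zero_lt_one.trans_le (uw_one a _ _)).ne' (uw_ne_top a _ _)
  unfold GG
  rw [← ENNReal.tsum_mul_left]
  refine le_trans (ENNReal.tsum_le_tsum fun m => ?_)
    (ENNReal.tsum_comp_le_tsum_of_injective (f := fun m : ℕ => k + m) (add_right_injective k) _)
  rw [← mul_assoc, ← lintegral_const_mul' _ _ (by finiteness [tp_ne_top (-(k * (ℓ + ∑ i, a i))), tp_ne_top (-(m * ℓ))]),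
    ← lintegral_const_mul' _ _ (tp_ne_top _)]
  refine lintegral_mono fun z => ?_
  have h1 : uw a j (x - y) ^ (-R) * uw a (j + k) (y - z) ^ (-R) ≤ uw a j (x - z) ^ (-R) := by
    simp only [ENNReal.rpow_neg]
    rw [← ENNReal.mul_inv (.inr (ENNReal.rpow_ne_top_of_nonneg hR (uw_ne_top a _ _)))
      (.inl (ENNReal.rpow_ne_top_of_nonneg hR (uw_ne_top a _ _))), ← ENNReal.mul_rpow_of_nonneg _ _ hR]
    gcongr
    exact (uw_tri a j x y z).trans (by gcongr; exact uw_mono ha (by omega) _)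
  have e : tp (-(k * (ℓ + ∑ i, a i))) * tp (-(m * ℓ)) * tp ((j + k : ℕ) * ∑ i, a i) =
      tp (-((k + m : ℕ) * ℓ)) * tp (j * ∑ i, a i) := by
    rw [← tp_add, ← tp_add, ← tp_add]; congr 1; push_cast; ring
  calc _ = tp (-(k * (ℓ + ∑ i, a i))) * tp (-(m * ℓ)) * tp ((j + k : ℕ) * ∑ i, a i) * H (j + k + m) z *
        (uw a j (x - y) ^ (-R) * uw a (j + k) (y - z) ^ (-R)) := by ring
    _ ≤ tp (-((k + m : ℕ) * ℓ)) * tp (j * ∑ i, a i) * H (j + k + m) z * (uw a j (x - z) ^ (-R)) := by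
        rw [e]; gcongr
    _ = _ := by rw [add_assoc]; ring

/-- Peetre type maximal function -/
def AA (a : Fin n → ℝ) (L R : ℝ) (F : ℕ → RV n → ℝ≥0∞) (j : ℕ) (x : RV n) : ℝ≥0∞ :=
  ⨆ (k : ℕ) (y : RV n), tp (-(k * L)) * F (j + k) y * uw a j (x - y) ^ (-R)

lemma st3 {L R r : ℝ} (hR : 0 ≤ R) (hr : 0 < r) {F : ℕ → RV n → ℝ≥0∞} {C : ℝ≥0∞}
    (h : ∀ j y, F j y ^ r ≤ C * GG a (L * r - ∑ i, a i) (R * r) (fun k z => F k z ^ r) j y) (j : ℕ) (x : RV n) :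
    AA a L R F j x ^ r ≤ C * GG a (L * r - ∑ i, a i) (R * r) (fun k z => F k z ^ r) j x := by
  rw [← ENNReal.le_rpow_inv_iff hr]
  refine iSup₂_le fun k y => ?_
  rw [ENNReal.le_rpow_inv_iff hr, ENNReal.mul_rpow_of_nonneg _ _ hr.le, ENNReal.mul_rpow_of_nonneg _ _ hr.le,
    tp_rpow, ← ENNReal.rpow_mul]
  calc _ ≤ tp (-(k * L) * r) * (C * GG a (L * r - ∑ i, a i) (R * r) (fun k z => F k z ^ r) (j + k) y) *
        uw a j (x - y) ^ (-R * r) := by gcongr; exact h _ _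
    _ = C * (tp (-(k * (L * r - ∑ i, a i + ∑ i, a i))) * uw a j (x - y) ^ (-(R * r)) *
        GG a (L * r - ∑ i, a i) (R * r) (fun k z => F k z ^ r) (j + k) y) := by
        rw [sub_add_cancel, neg_mul R r, show -((k : ℝ) * L) * r = -(k * (L * r)) by ring]; ring
    _ ≤ _ := by gcongr; exact GG_shift ha _ (by positivity) j k x y

lemma st1 {L R r : ℝ} (hR : 0 ≤ R) (hr : 0 < r) (hr1 : r < 1) {F : ℕ → RV n → ℝ≥0∞}
    {C : ℝ≥0∞}
    (h : ∀ j y, F j y ≤ C * GG a (L - ∑ i, a i) R F j y) (j : ℕ) (x : RV n) (hA : AA a L R F j x ≠ ∞) :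
    AA a L R F j x ^ r ≤ C * GG a (L * r - ∑ i, a i) (R * r) (fun k z => F k z ^ r) j x := by
  set A := AA a L R F j x with hAd
  set G := GG a (L * r - ∑ i, a i) (R * r) (fun k z => F k z ^ r) j x with hG
  have hA' : A ^ (1 - r) ≠ ∞ := ENNReal.rpow_ne_top_of_nonneg (by linarith) hA
  have hu : ∀ z, uw a j (x - z) ^ (-R) ≠ ∞ := fun z => ENNReal.rpow_ne_top_of_ne_zero
    (zero_lt_one.trans_le (uw_one a _ _)).ne' (uw_ne_top a _ _)
  have h2 : GG a (L - ∑ i, a i) R F j x ≤ A ^ (1 - r) * G := by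
    rw [hG]; unfold GG
    rw [← ENNReal.tsum_mul_left]
    refine ENNReal.tsum_le_tsum fun l => ?_
    rw [← lintegral_const_mul' _ _ (tp_ne_top _), ← lintegral_const_mul' _ _ (tp_ne_top _),
      ← lintegral_const_mul' _ _ hA']
    refine lintegral_mono fun z => ?_
    set X := tp (-(l * L)) * F (j + l) z * uw a j (x - z) ^ (-R) with hX
    have hXA : X ≤ A := le_iSup₂_of_le l z le_rfl
    have hX' : X ≤ A ^ (1 - r) * X ^ r := by
      by_cases h0 : X = 0
      · simp [h0]
      have hXt : X ≠ ∞ := ne_top_of_le_ne_top hA hXA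
      calc X = X ^ (1 - r) * X ^ r := by
            rw [← ENNReal.rpow_add _ _ h0 hXt]; simp
        _ ≤ _ := by gcongr
    have eX : X ^ r = tp (-(l * (L * r))) * F (j + l) z ^ r * uw a j (x - z) ^ (-(R * r)) := by
      rw [hX, ENNReal.mul_rpow_of_nonneg _ _ hr.le, ENNReal.mul_rpow_of_nonneg _ _ hr.le,
        tp_rpow, ← ENNReal.rpow_mul]
      congr 3 <;> ring
    calc _ = tp (l * ∑ i, a i) * tp (j * ∑ i, a i) * X := by
          rw [hX, show -((l : ℝ) * (L - ∑ i, a i)) = l * ∑ i, a i + -(l * L) by ring, tp_add]; ring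
      _ ≤ tp (l * ∑ i, a i) * tp (j * ∑ i, a i) * (A ^ (1 - r) * X ^ r) := by gcongr
      _ = _ := by
          rw [eX, show -((l : ℝ) * (L * r - ∑ i, a i)) = l * ∑ i, a i + -(l * (L * r)) by ring, tp_add]; ring
  have h3 : A ≤ C * (A ^ (1 - r) * G) := by
    refine iSup₂_le fun k y => ?_
    calc _ ≤ tp (-(k * L)) * (C * GG a (L - ∑ i, a i) R F (j + k) y) * uw a j (x - y) ^ (-R) := by
          gcongr; exact h _ _
      _ = C * (tp (-(k * (L - ∑ i, a i + ∑ i, a i))) * uw a j (x - y) ^ (-R) *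
          GG a (L - ∑ i, a i) R F (j + k) y) := by rw [sub_add_cancel]; ring
      _ ≤ C * GG a (L - ∑ i, a i) R F j x := by gcongr; exact GG_shift ha _ hR j k x y
      _ ≤ _ := by gcongr
  by_cases h0 : A = 0
  · simp [h0, hr]
  have hp : A ^ (1 - r) ≠ 0 := by simp [h0, hA]
  have : A ^ (1 - r) * A ^ r ≤ A ^ (1 - r) * (C * G) := by
    rw [← ENNReal.rpow_add _ _ h0 hA]; simp only [sub_add_cancel, ENNReal.rpow_one]
    exact h3.trans_eq (by ring)
  exact (ENNReal.mul_le_mul_iff_right hp hA').1 this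

lemma st {L R r L' R' : ℝ} (hR : 0 ≤ R) (hr : 0 < r) (hr1 : r < 1) (hL : L ≤ L') (hR' : R ≤ R')
    {F : ℕ → RV n → ℝ≥0∞} {C C' : ℝ≥0∞} (hC : 1 ≤ C) (hC' : C' ≠ ∞)
    (h : ∀ j y, F j y ≤ C * GG a (L - ∑ i, a i) R F j y)
    (h' : ∀ j y, F j y ≤ C' * GG a (L' - ∑ i, a i) R' F j y)
    (hA : ∀ j x, AA a L' R' F j x ≠ ∞) (j : ℕ) (x : RV n) :
    AA a L R F j x ^ r ≤ C * GG a (L * r - ∑ i, a i) (R * r) (fun k z => F k z ^ r) j x := by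
  have h3 := st3 ha (L := L) (R := R) (r := r) hR hr (F := F) (C := C') (fun j y => by
    have h1 := st1 ha (by linarith) hr hr1 h' j y (hA j y)
    have h2 : F j y ≤ AA a L' R' F j y := by
      refine le_iSup₂_of_le 0 y ?_
      simp [tp_zero, uw, uwr]
    refine (ENNReal.rpow_le_rpow h2 hr.le).trans (h1.trans ?_)
    gcongr
    unfold GG
    gcongr with l z
    · exact tp_mono (by gcongr)
    · exact uw_one a _ _)
  by_cases hG : GG a (L * r - ∑ i, a i) (R * r) (fun k z => F k z ^ r) j x = ∞
  · rw [hG, ENNReal.mul_top (by positivity)]; simp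
  refine st1 ha hR hr hr1 h j x fun hh => ?_
  have := h3 j x
  rw [hh, ENNReal.top_rpow_of_pos hr, top_le_iff] at this
  exact ENNReal.mul_ne_top hC' hG this
end


lemma int1 (c : ℝ) (hc : 0 < c) : Integrable (fun u : ℝ => c / (1 + c * |u|) ^ 2) ∧
    ∫ u : ℝ, c / (1 + c * |u|) ^ 2 = ∫ u : ℝ, 1 / (1 + |u|) ^ 2 := by
  have h0 : Integrable (fun u : ℝ => 1 / (1 + |u|) ^ 2) := by
    have := integrable_one_add_norm (E := ℝ) (r := 2) (μ := volume) (by simp)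
    refine this.congr (.of_forall fun u => ?_)
    simp only [Real.norm_eq_abs]
    rw [Real.rpow_neg (by positivity)]; norm_cast; simp
  have e : (fun u : ℝ => c / (1 + c * |u|) ^ 2) = fun u => c * (1 / (1 + |c * u|) ^ 2) := by
    ext u; rw [abs_mul, abs_of_pos hc]; ring
  rw [e]
  refine ⟨(h0.comp_mul_left' hc.ne').const_mul c, ?_⟩
  rw [integral_const_mul, Measure.integral_comp_mul_left (fun u : ℝ => 1 / (1 + |u|) ^ 2), abs_of_pos (by positivity), smul_eq_mul,
    mul_inv_cancel_left₀ hc.ne']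

lemma kern_eq {n : ℕ} (a : Fin n → ℝ) (k : ℕ) (x : RV n) :
    kern a k x = tp (k * ∑ i, a i) * uw a k x ^ (-2 : ℝ) := by
  unfold kern ker1 uw uwr
  rw [← tp_of, Finset.mul_sum, Real.rpow_sum_of_pos (by norm_num),
    ENNReal.ofReal_rpow_of_pos (Finset.prod_pos fun i _ => by positivity),
    ← ENNReal.ofReal_mul (Finset.prod_nonneg fun i _ => by positivity),
    ← ENNReal.ofReal_prod_of_nonneg (fun i _ => by positivity)]
  rw [Real.rpow_neg (Finset.prod_nonneg fun i _ => by positivity), ← div_eq_mul_inv]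
  norm_cast
  rw [← Finset.prod_pow, ← Finset.prod_div_distrib]

lemma kern_int {n : ℕ} (a : Fin n → ℝ) : ∃ K : ℝ≥0∞, K ≠ ∞ ∧ ∀ k x,
    ∫⁻ z, kern a k (x - z) ≤ K := by
  refine ⟨ENNReal.ofReal (∏ _i : Fin n, ∫ u : ℝ, 1 / (1 + |u|) ^ 2), ENNReal.ofReal_ne_top, fun k x => ?_⟩
  rw [lintegral_sub_left_eq_self (fun z => kern a k z) x]
  unfold kern ker1
  have h1 := fun i => int1 (2 ^ ((k : ℝ) * a i)) (by positivity)
  have e : ∀ z : RV n, ∏ i, ENNReal.ofReal (2 ^ ((k : ℝ) * a i) / (1 + 2 ^ ((k : ℝ) * a i) * |z i|) ^ 2) =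
    ENNReal.ofReal (∏ i, 2 ^ ((k : ℝ) * a i) / (1 + 2 ^ ((k : ℝ) * a i) * |z i|) ^ 2) := fun z =>
    (ENNReal.ofReal_prod_of_nonneg (fun i _ => by positivity)).symm
  simp only [e]
  rw [← ofReal_integral_eq_lintegral_ofReal (μ := (volume : Measure (RV n))) (Integrable.fintype_prod (f := fun i u => (2 : ℝ) ^ ((k : ℝ) * a i) / (1 + 2 ^ ((k : ℝ) * a i) * |u|) ^ 2)
    fun i => (h1 i).1) (.of_forall fun z => Finset.prod_nonneg fun i _ => by positivity),
    integral_fintype_prod_volume_eq_prod (f := fun i u => (2 : ℝ) ^ ((k : ℝ) * a i) / (1 + 2 ^ ((k : ℝ) * a i) * |u|) ^ 2)]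
  simp only [(h1 _).2]; rfl

lemma lq_pow {q : ℝ≥0∞} {r : ℝ} (hr : 0 < r) (u : ℕ → ℝ≥0∞) :
    lq (q / ENNReal.ofReal r) (fun k => u k ^ r) = lq q u ^ r := by
  unfold lq
  have hr0 : ENNReal.ofReal r ≠ 0 := by simpa using hr
  by_cases h : q = ∞
  · rw [if_pos h, if_pos (by rw [h, ENNReal.top_div_of_ne_top ENNReal.ofReal_ne_top])]
    exact ((ENNReal.orderIsoRpow r hr).map_iSup u).symm
  · rw [if_neg h, if_neg (ENNReal.div_ne_top h hr0), ENNReal.toReal_div, ENNReal.toReal_ofReal hr.le]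
    simp only [← ENNReal.rpow_mul]
    congr 1
    · congr 1; ext k; congr 1; field_simp
    · field_simp

lemma mixAux_pow {n : ℕ} {p : Fin n → ℝ≥0∞} (hp : ∀ i, p i ≠ ∞) {r : ℝ} (hr : 0 < r)
    (F : RV n → ℝ≥0∞) (l : ℕ) (x : RV n) :
    mixAux n (fun i => p i / ENNReal.ofReal r) l (fun x => F x ^ r) x = mixAux n p l F x ^ r := by
  have hr0 : ENNReal.ofReal r ≠ 0 := by simpa using hr
  induction l generalizing x with
  | zero => rfl
  | succ l ih =>
    by_cases h : l < n
    · rw [mixAux_succ hp h, mixAux_succ (fun i => ENNReal.div_ne_top (hp i) hr0) h]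
      simp only [ih, ENNReal.toReal_div, ENNReal.toReal_ofReal hr.le, ← ENNReal.rpow_mul]
      congr 1
      · congr 1; ext k; congr 1; field_simp
      · field_simp
    · simp [mixAux, h, ih]

lemma seqNorm_pow {n : ℕ} {p : Fin n → ℝ≥0∞} (hp : ∀ i, p i ≠ ∞) {q : ℝ≥0∞} {r : ℝ} (hr : 0 < r)
    (u : ℕ → RV n → ℝ≥0∞) : seqNorm n (fun i => p i / ENNReal.ofReal r) (q / ENNReal.ofReal r)
      (fun k x => u k x ^ r) = seqNorm n p q u ^ r := by
  simp only [seqNorm_eq]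
  rw [← mixAux_pow hp hr]; simp only [lq_pow hr]

lemma lq_le_of {q : ℝ≥0∞} {u v : ℕ → ℝ≥0∞} (S : Set ℕ) (σ : ℕ → ℕ) (hσ : Set.InjOn σ S)
    (h : ∀ j ∈ S, u j ≤ v (σ j)) (h0 : ∀ j ∉ S, u j = 0) (hq : q ≠ 0) : lq q u ≤ lq q v := by
  unfold lq
  split_ifs with h1
  · refine iSup_le fun j => ?_
    by_cases hj : j ∈ S
    · exact (h j hj).trans (le_iSup v _)
    · simp [h0 j hj]
  · refine ENNReal.rpow_le_rpow ?_ (by positivity)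
    have q0 : 0 < q.toReal := ENNReal.toReal_pos hq h1
    rw [← tsum_subtype_eq_of_support_subset (s := S) (f := fun j => u j ^ q.toReal)]
    · refine le_trans (ENNReal.tsum_le_tsum fun j : S => ENNReal.rpow_le_rpow (h j j.2) q0.le) ?_
      exact ENNReal.tsum_comp_le_tsum_of_injective (f := fun j : S => σ j) (fun i j hij => Subtype.ext (hσ i.2 j.2 hij)) fun k => v k ^ q.toReal
    · intro j hj
      by_contra hjs
      simp [h0 j hjs, q0] at hj

lemma tp_sum {η : ℝ} (hη : 0 < η) : ∑' d : ℕ, tp (-(d * η)) ≠ ∞ := by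
  have : ∀ d : ℕ, tp (-(d * η)) = tp (-η) ^ d := fun d => by
    rw [← ENNReal.rpow_natCast, tp_rpow]; congr 1; ring
  simp only [this, ENNReal.tsum_geometric]
  simp only [ne_eq, ENNReal.inv_eq_top, tsub_eq_zero_iff_le, not_le]
  unfold tp; exact ENNReal.rpow_lt_one_of_one_lt_of_neg (by simp) (by linarith)

lemma rpow_tsum_le {r : ℝ} (hr : 0 < r) (hr1 : r ≤ 1) (u : ℕ → ℝ≥0∞) :
    (∑' k, u k) ^ r ≤ ∑' k, u k ^ r := by
  rw [← ENNReal.le_rpow_inv_iff hr, ENNReal.tsum_eq_iSup_sum]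
  refine iSup_le fun s => ?_
  rw [ENNReal.le_rpow_inv_iff hr]
  refine le_trans ?_ (ENNReal.sum_le_tsum s)
  induction s using Finset.cons_induction with
  | empty => simp [hr]
  | cons i s hi ih =>
    rw [Finset.sum_cons, Finset.sum_cons]
    exact (ENNReal.rpow_add_le_add_rpow _ _ hr.le hr1).trans (by gcongr)

lemma seq_shift {n : ℕ} {p : Fin n → ℝ≥0∞} (hp : ∀ i, p i ≠ ∞) (hp1 : ∀ i, 1 ≤ p i) {q : ℝ≥0∞} (hq : 1 ≤ q)
    {η : ℝ} {v : ℕ → RV n → ℝ≥0∞} {w : ℕ → ℕ → RV n → ℝ≥0∞} (hw : ∀ d j, Measurable (w d j))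
    (h : ∀ d x, lq q (fun j => w d j x) ≤ lq q fun j => v j x) :
    seqNorm n p q (fun j x => ∑' d : ℕ, tp (-(d * η)) * w d j x) ≤ (∑' d : ℕ, tp (-(d * η))) * seqNorm n p q v := by
  refine (seqNorm_tsum hp hp1 hq (fun d j => (hw d j).const_mul _)).trans ?_
  rw [← ENNReal.tsum_mul_right]
  refine ENNReal.tsum_le_tsum fun d => ?_
  have hp0 := fun i => (zero_lt_one.trans_le (hp1 i)).ne'
  have q0 := (zero_lt_one.trans_le hq).ne'
  refine (seqNorm_le hp hp0 q0 (tp_ne_top _) fun k x => le_rfl).trans ?_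
  gcongr
  simp only [seqNorm_eq]
  have := mixAux_le hp hp0 (B := 1) (by simp) (l0 := 0) (l := n) (F := fun x => lq q fun k => w d k x)
    (G := fun x => lq q fun k => v k x) (by simpa [mixAux] using h d) (by simp) fun _ => 0
  simpa using this


lemma exists_r {n : ℕ} {p : Fin n → ℝ≥0∞} (hp : ∀ i, 0 < p i) {q : ℝ≥0∞} (hq : 0 < q) :
    ∃ r : ℝ, 0 < r ∧ r < 1 ∧ (∀ i, ENNReal.ofReal r < p i) ∧ ENNReal.ofReal r < q := by
  have : 0 < min (min 1 q) (Finset.univ.inf p) := by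
    refine lt_min (lt_min one_pos hq) ?_
    rw [Finset.lt_inf_iff (by simp)]; exact fun i _ => hp i
  obtain ⟨r, h0, h1⟩ := ENNReal.lt_iff_exists_nnreal_btwn.1 this
  rw [lt_min_iff, lt_min_iff, Finset.lt_inf_iff (by simp)] at h1
  refine ⟨r, by exact_mod_cast h0, by exact_mod_cast h1.1.1, fun i => ?_, ?_⟩
  · simpa using h1.2 i
  · simpa using h1.1.2

section
variable {n : ℕ} {a : Fin n → ℝ} (ha : ∀ i, 0 ≤ a i)

lemma uw_pow_mul (j : ℕ) (x : RV n) (s t : ℝ) : uw a j x ^ s * uw a j x ^ t = uw a j x ^ (s + t) :=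
  (ENNReal.rpow_add _ _ (zero_lt_one.trans_le (uw_one a j x)).ne' (uw_ne_top a j x)).symm

lemma AA_int {K : ℝ≥0∞} (hK : ∀ k x, ∫⁻ z, kern a k (x - z) ≤ K) (L R : ℝ) (F : ℕ → RV n → ℝ≥0∞) (j l : ℕ) (x : RV n) :
    ∫⁻ z, F (j + l) z * (tp (j * ∑ i, a i) * uw a j (x - z) ^ (-(R + 2))) ≤ tp (l * L) * AA a L R F j x * K := by
  have h : ∀ z, F (j + l) z * (tp (j * ∑ i, a i) * uw a j (x - z) ^ (-(R + 2))) ≤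
      tp (l * L) * AA a L R F j x * kern a j (x - z) := fun z => by
    calc _ = tp (l * L) * (tp (-(l * L)) * F (j + l) z * uw a j (x - z) ^ (-R)) * kern a j (x - z) := by
          rw [kern_eq, show -(R + 2) = -R + -2 by ring, ← uw_pow_mul]
          have : tp (l * L) * tp (-(l * L)) = 1 := by rw [← tp_add]; simp [tp_zero]
          calc _ = (1 : ℝ≥0∞) * _ := (one_mul _).symm
            _ = _ := by rw [← this]; ring
      _ ≤ _ := by
          gcongr
          exact le_iSup₂ (f := fun (k : ℕ) y => tp (-(k * L)) * F (j + k) y * uw a j (x - y) ^ (-R)) l z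
  refine (lintegral_mono h).trans ?_
  rw [lintegral_const_mul]
  · gcongr; exact hK j x
  · simp only [kern_eq]; exact (((uw_meas a j).comp (measurable_const.sub measurable_id)).pow_const _).const_mul _

include ha

lemma AA_fin {F : ℕ → RV n → ℝ≥0∞} {A : ℝ≥0∞} (hA : A ≠ ∞) {L0 R0 L R : ℝ} (hR0 : 0 ≤ R0) (hL : L0 ≤ L) (hR : R0 ≤ R)
    (h : ∀ j y, F j y ≤ A * tp (j * L0) * uw a 0 y ^ R0) (j : ℕ) (x : RV n) : AA a L R F j x ≠ ∞ := by
  refine ne_top_of_le_ne_top (b := A * tp (j * L0) * uw a 0 x ^ R0) (ENNReal.mul_ne_top (ENNReal.mul_ne_top hA (tp_ne_top _))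
    (ENNReal.rpow_ne_top_of_nonneg hR0 (uw_ne_top _ _ _))) (iSup₂_le fun k y => ?_)
  have h1 : uw a 0 y ≤ uw a j (x - y) * uw a 0 x := by
    have := uw_tri a 0 y x 0
    simp only [sub_zero] at this
    refine this.trans ?_
    rw [uw_neg]; gcongr; exact uw_mono ha (Nat.zero_le _) _
  calc _ ≤ tp (-(k * L)) * (A * tp ((j + k : ℕ) * L0) * (uw a j (x - y) * uw a 0 x) ^ R0) * uw a j (x - y) ^ (-R) := by
        gcongr; refine (h _ _).trans ?_; gcongr
    _ = A * (tp (-(k * L)) * tp ((j + k : ℕ) * L0)) * uw a 0 x ^ R0 * (uw a j (x - y) ^ R0 * uw a j (x - y) ^ (-R)) := by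
        rw [ENNReal.mul_rpow_of_nonneg _ _ hR0]; ring
    _ ≤ A * tp (j * L0) * uw a 0 x ^ R0 * 1 := by
        rw [uw_pow_mul, ← tp_add]
        gcongr
        · refine tp_mono ?_
          push_cast
          nlinarith [mul_le_mul_of_nonneg_left hL (Nat.cast_nonneg (α := ℝ) k)]
        · exact (ENNReal.rpow_le_rpow_of_exponent_le (uw_one a _ _) (by linarith : R0 + -R ≤ 0)).trans (by simp)
    _ = _ := mul_one _

lemma GG_kern {s r L : ℝ} (hr : 0 < r) (hL : L * r - 2 * ∑ i, a i + s * r = 1) (F : ℕ → RV n → ℝ≥0∞) (j : ℕ) (x : RV n) :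
    tp (j * s * r) * GG a (L * r - ∑ i, a i) 2 (fun k z => F k z ^ r) j x ≤
      ∑' l : ℕ, tp (-(l * 1)) * ∫⁻ z, kern a (j + l) (x - z) * (tp ((j + l : ℕ) * s) * F (j + l) z) ^ r := by
  unfold GG
  rw [← ENNReal.tsum_mul_left]
  refine ENNReal.tsum_le_tsum fun l => ?_
  rw [← mul_assoc, ← lintegral_const_mul' _ _ (ENNReal.mul_ne_top (tp_ne_top _) (tp_ne_top _)),
    ← lintegral_const_mul' _ _ (tp_ne_top _)]
  refine lintegral_mono fun z => ?_
  have h1 : uw a j (x - z) ^ (-2 : ℝ) ≤ tp (l * (2 * ∑ i, a i)) * uw a (j + l) (x - z) ^ (-2 : ℝ) := by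
    have h2 : uw a j (x - z) ^ (-2 : ℝ) ≤ (tp (-(l * ∑ i, a i)) * uw a (j + l) (x - z)) ^ (-2 : ℝ) := by
      rw [ENNReal.rpow_neg, ENNReal.rpow_neg]
      refine ENNReal.inv_le_inv.2 (ENNReal.rpow_le_rpow ?_ (by norm_num))
      calc _ ≤ tp (-(l * ∑ i, a i)) * (tp (l * ∑ i, a i) * uw a j (x - z)) := by gcongr; exact uw_up ha _ _ _
        _ = _ := by rw [← mul_assoc, ← tp_add]; simp [tp_zero]
    refine h2.trans_eq ?_
    rw [ENNReal.mul_rpow_of_ne_top (tp_ne_top _) (uw_ne_top _ _ _), tp_rpow]; congr 2; ring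
  rw [kern_eq, ENNReal.mul_rpow_of_nonneg _ _ hr.le, tp_rpow]
  calc _ ≤ tp (j * s * r) * tp (-(l * (L * r - ∑ i, a i))) * (F (j + l) z ^ r * (tp (j * ∑ i, a i) *
          (tp (l * (2 * ∑ i, a i)) * uw a (j + l) (x - z) ^ (-2 : ℝ)))) := by gcongr
    _ = (tp (j * s * r) * tp (-(l * (L * r - ∑ i, a i))) * tp (j * ∑ i, a i) * tp (l * (2 * ∑ i, a i))) *
          (F (j + l) z ^ r * uw a (j + l) (x - z) ^ (-2 : ℝ)) := by ring
    _ = (tp (-(l * 1)) * tp ((j + l : ℕ) * ∑ i, a i) * tp ((j + l : ℕ) * s * r)) *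
          (F (j + l) z ^ r * uw a (j + l) (x - z) ^ (-2 : ℝ)) := by
        simp only [← tp_add]; congr 2; rw [← hL]; push_cast; ring
    _ = _ := by ring

theorem MT {ι : Type*} {p : Fin n → ℝ≥0∞} (hp : ∀ i, 0 < p i ∧ p i ≠ ∞) {q : ℝ≥0∞} (hq : 0 < q) {s M : ℝ} (hs : s < M)
    (F Φ : ι → ℕ → RV n → ℝ≥0∞) (hF : ∀ f j, Measurable (F f j))
    (H1 : ∀ L R : ℝ, 0 ≤ R → ∃ C : ℝ≥0∞, C ≠ ∞ ∧ ∀ f j y, F f j y ≤ C * GG a L R (F f) j y)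
    (H2 : ∀ f, ∃ A : ℝ≥0∞, A ≠ ∞ ∧ ∃ L0 R0 : ℝ, 0 ≤ R0 ∧ ∀ j y, F f j y ≤ A * tp (j * L0) * uw a 0 y ^ R0)
    (H3 : ∀ L R : ℝ, 0 ≤ R → ∃ C : ℝ≥0∞, C ≠ ∞ ∧ ∀ f j x, Φ f j x ≤ C * (GG a L R (F f) j x + ∑' d : ℕ, if d ≤ j then
      tp (-(d * M)) * ∫⁻ z, F f (j - d) z * (tp ((j - d : ℕ) * ∑ i, a i) * uw a (j - d) (x - z) ^ (-R)) else 0)) :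
    ∃ C : ℝ≥0∞, C ≠ ∞ ∧ ∀ f, seqNorm n p q (fun j x => tp (j * s) * Φ f j x) ≤
      C * seqNorm n p q (fun j x => tp (j * s) * F f j x) := by
  obtain ⟨r, hr, hr1, hrp, hrq⟩ := exists_r (fun i => (hp i).1) hq
  have hr0 : ENNReal.ofReal r ≠ 0 := by simpa using hr
  set R := 2 / r with hRd
  have hR : 0 ≤ R := by positivity
  set L := (1 + 2 * ∑ i, a i - s * r) / r with hLd
  have hL : L * r - 2 * ∑ i, a i + s * r = 1 := by rw [hLd]; field_simp; ring
  have hRr : R * r = 2 := by rw [hRd]; field_simp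
  obtain ⟨K, hK, hK'⟩ := kern_int a
  obtain ⟨C1, hC1, h1⟩ := H1 (L - ∑ i, a i) R hR
  obtain ⟨C3, hC3, h3⟩ := H3 (L + 1) (R + 2) (by positivity)
  set C := max C1 1
  have hC : C ≠ ∞ := by simp [C, hC1]
  have hA : ∀ f j x, AA a L R (F f) j x ^ r ≤ C * GG a (L * r - ∑ i, a i) 2 (fun k z => F f k z ^ r) j x := fun f j x => by
    obtain ⟨A, hA, L0, R0, hR0, h2⟩ := H2 f
    obtain ⟨C', hC', h1'⟩ := H1 (max L L0 - ∑ i, a i) (max R R0) (hR.trans (le_max_left _ _))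
    rw [← hRr]
    exact st ha hR hr hr1 (le_max_left _ _) (le_max_left _ _) (le_max_right _ _) hC'
      (fun j y => (h1 f j y).trans (by gcongr; exact le_max_left _ _)) (h1' f)
      (AA_fin ha hA hR0 (le_max_right _ _) (le_max_right _ _) h2) j x
  set S := ∑' l : ℕ, tp (-(l * 1)) with hSd
  have hS : S ≠ ∞ := tp_sum one_pos
  set D := C3 * (K * (S + 1))
  have hD : D ≠ ∞ := ENNReal.mul_ne_top hC3 (ENNReal.mul_ne_top hK (by simp [hS]))
  have hΦ : ∀ f j x, Φ f j x ≤ D * ∑' d : ℕ, if d ≤ j then tp (-(d * M)) * AA a L R (F f) (j - d) x else 0 := fun f j x => by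
    refine (h3 f j x).trans ?_
    rw [mul_assoc]; gcongr
    rw [mul_add, mul_one, add_mul]
    gcongr
    · refine le_trans (b := K * S * AA a L R (F f) j x) ?_ ?_
      · unfold GG
        calc _ ≤ ∑' l : ℕ, tp (-(l * (L + 1))) * (tp (l * L) * AA a L R (F f) j x * K) := by
              gcongr with l; exact AA_int hK' _ _ _ _ _ _
          _ = ∑' l : ℕ, tp (-(l * 1)) * (K * AA a L R (F f) j x) := by
              congr 1; ext l
              rw [show -((l : ℝ) * 1) = -(l * (L + 1)) + l * L by ring, tp_add]; ring
          _ = _ := by rw [ENNReal.tsum_mul_right]; ring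
      · gcongr
        refine le_trans ?_ (ENNReal.le_tsum 0)
        simp [tp_zero]
    · rw [← ENNReal.tsum_mul_left]
      gcongr with d
      split_ifs
      · have := AA_int hK' L R (F f) (j - d) 0 x
        simp only [add_zero, Nat.cast_zero, zero_mul, tp_zero, one_mul] at this
        calc _ ≤ tp (-(d * M)) * (AA a L R (F f) (j - d) x * K) := by gcongr
          _ = _ := by ring
      · simp
  set P : Fin n → ℝ≥0∞ := fun i => p i / ENNReal.ofReal r
  set Q := q / ENNReal.ofReal r
  have hP : ∀ i, P i ≠ ∞ := fun i => ENNReal.div_ne_top (hp i).2 hr0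
  have hP1 : ∀ i, 1 < P i := fun i => by
    rw [ENNReal.lt_div_iff_mul_lt (.inl hr0) (.inl ENNReal.ofReal_ne_top)]; simpa using hrp i
  have hQ1 : 1 < Q := by
    rw [ENNReal.lt_div_iff_mul_lt (.inl hr0) (.inl ENNReal.ofReal_ne_top)]; simpa using hrq
  have hQ0 : Q ≠ 0 := (zero_lt_one.trans hQ1).ne'
  obtain ⟨B, hB, hV⟩ := propV hP hP1 hQ1 ha
  have hη : 0 < (M - s) * r := mul_pos (by linarith) hr
  set S' := ∑' d : ℕ, tp (-(d * ((M - s) * r))) with hSd'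
  have hS' : S' ≠ ∞ := tp_sum hη
  set E := D ^ r * C * (S' * (S * B))
  have hE : E ≠ ∞ := ENNReal.mul_ne_top (ENNReal.mul_ne_top (ENNReal.rpow_ne_top_of_nonneg hr.le hD) hC)
    (ENNReal.mul_ne_top hS' (ENNReal.mul_ne_top hS hB))
  refine ⟨E ^ r⁻¹, ENNReal.rpow_ne_top_of_nonneg (by positivity) hE, fun f => ?_⟩
  rw [← ENNReal.rpow_le_rpow_iff hr, ENNReal.mul_rpow_of_nonneg _ _ hr.le, ← ENNReal.rpow_mul, inv_mul_cancel₀ hr.ne',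
    ENNReal.rpow_one, ← seqNorm_pow (fun i => (hp i).2) hr, ← seqNorm_pow (fun i => (hp i).2) hr]
  set G : ℕ → RV n → ℝ≥0∞ := fun k z => (tp (k * s) * F f k z) ^ r
  have hG : ∀ k, Measurable (G k) := fun k => ((hF f k).const_mul _).pow_const _
  set v : ℕ → RV n → ℝ≥0∞ := fun k x => ∫⁻ z, kern a k (x - z) * G k z
  have hv : ∀ k, Measurable (v k) := fun k => by
    refine Measurable.lintegral_prod_right' (f := fun w : RV n × RV n => kern a k (w.1 - w.2) * G k w.2) ?_
    simp only [kern_eq]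
    exact ((((uw_meas a k).comp (measurable_fst.sub measurable_snd)).pow_const _).const_mul _).mul ((hG k).comp measurable_snd)
  set w : ℕ → RV n → ℝ≥0∞ := fun j x => ∑' l : ℕ, tp (-(l * 1)) * v (j + l) x
  have hw : ∀ k, Measurable (w k) := fun k => Measurable.tsum fun l => (hv _).const_mul _
  have key : ∀ (j : ℕ) x, (tp (j * s) * Φ f j x) ^ r ≤ D ^ r * C * ∑' d : ℕ, tp (-(d * ((M - s) * r))) *
      (if d ≤ j then w (j - d) x else 0) := fun j x => by
    calc _ ≤ (tp (j * s) * (D * ∑' d : ℕ, if d ≤ j then tp (-(d * M)) * AA a L R (F f) (j - d) x else 0)) ^ r := by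
          gcongr; exact hΦ f j x
      _ = D ^ r * (∑' d : ℕ, tp (j * s) * if d ≤ j then tp (-(d * M)) * AA a L R (F f) (j - d) x else 0) ^ r := by
          rw [← ENNReal.mul_rpow_of_nonneg _ _ hr.le, ENNReal.tsum_mul_left]; congr 1; ring
      _ ≤ D ^ r * ∑' d : ℕ, (tp (j * s) * if d ≤ j then tp (-(d * M)) * AA a L R (F f) (j - d) x else 0) ^ r := by
          gcongr; exact rpow_tsum_le hr hr1.le _
      _ ≤ _ := by
          rw [mul_assoc]; gcongr
          rw [← ENNReal.tsum_mul_left]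
          gcongr with d
          split_ifs with hd
          · have e : tp (j * s) * (tp (-(d * M)) * AA a L R (F f) (j - d) x) =
                tp (-(d * (M - s))) * tp ((j - d : ℕ) * s) * AA a L R (F f) (j - d) x := by
              rw [← mul_assoc, ← tp_add, ← tp_add]; congr 2; rw [Nat.cast_sub hd]; ring
            rw [e, ENNReal.mul_rpow_of_nonneg _ _ hr.le, ENNReal.mul_rpow_of_nonneg _ _ hr.le, tp_rpow, tp_rpow]
            calc _ ≤ tp (-(d * (M - s)) * r) * tp ((j - d : ℕ) * s * r) * (C * GG a (L * r - ∑ i, a i) 2 (fun k z => F f k z ^ r) (j - d) x) := by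
                  gcongr; exact hA _ _ _
              _ = C * (tp (-(d * ((M - s) * r))) * (tp ((j - d : ℕ) * s * r) * GG a (L * r - ∑ i, a i) 2 (fun k z => F f k z ^ r) (j - d) x)) := by
                  rw [show -((d : ℝ) * (M - s)) * r = -(d * ((M - s) * r)) by ring]; ring
              _ ≤ _ := by gcongr; exact GG_kern ha hr hL _ _ _
          · simp [hr]
  refine (seqNorm_le hP (fun i => (zero_lt_one.trans (hP1 i)).ne') hQ0
    (ENNReal.mul_ne_top (ENNReal.rpow_ne_top_of_nonneg hr.le hD) hC) key).trans ?_
  simp only [E, mul_assoc]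
  gcongr
  refine (seq_shift (v := w) hP (fun i => (hP1 i).le) hQ1.le (fun d j => by
    split_ifs
    · exact hw _
    · exact measurable_const) fun d x => ?_).trans ?_
  · refine lq_le_of {j | d ≤ j} (fun j => j - d) (fun i hi j hj hij => ?_) (fun j hj => ?_) (fun j hj => ?_) hQ0
    · have hi : d ≤ i := hi
      have hj : d ≤ j := hj
      simp only at hij; omega
    · have hj : d ≤ j := hj
      simp [hj]
    · have hj : ¬ d ≤ j := hj
      simp [hj]
  · gcongr
    refine (seq_shift (v := v) hP (fun i => (hP1 i).le) hQ1.le (fun d j => hv _) fun d x => ?_).trans ?_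
    · exact lq_le_of Set.univ (fun j => j + d) (fun i _ j _ hij => by simpa using hij) (fun j _ => le_rfl) (fun j hj => absurd trivial hj) hQ0
    · gcongr; exact hV G hG
end


section
variable {V : Type*} [NormedAddCommGroup V] [NormedSpace ℝ V]

/-- translation -/
def tau (x : V) : SchwartzMap V ℂ →L[ℂ] SchwartzMap V ℂ := SchwartzMap.compSubConstCLM ℂ (-x)
lemma tau_apply (x y : V) (φ : SchwartzMap V ℂ) : tau x φ y = φ (y + x) := by
  simp [tau]

lemma tau_it (x y : V) (φ : SchwartzMap V ℂ) (l : ℕ) :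
    iteratedFDeriv ℝ l (tau x φ) y = iteratedFDeriv ℝ l φ (y + x) := by
  have : (tau x φ : V → ℂ) = fun y => φ (y + x) := funext fun y => tau_apply x y φ
  rw [this, iteratedFDeriv_comp_add_right]

lemma sbd (φ : SchwartzMap V ℂ) (K : ℕ) : ∃ B : ℝ, 0 ≤ B ∧ ∀ l ≤ K, ∀ y, (1 + ‖y‖) ^ K * ‖iteratedFDeriv ℝ l φ y‖ ≤ B :=
  ⟨_, (by positivity : 0 ≤ 2 ^ K * (Finset.Iic (K, K)).sup (fun m => SchwartzMap.seminorm ℂ m.1 m.2) φ),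
    fun _ hl y => SchwartzMap.one_add_le_sup_seminorm_apply (m := (K, K)) le_rfl hl φ y⟩

lemma fbd (F : SchwartzMap V ℂ →L[ℂ] ℂ) : ∃ C : ℝ, 0 ≤ C ∧ ∃ K : ℕ, ∀ (φ : SchwartzMap V ℂ) (B : ℝ), 0 ≤ B →
    (∀ l ≤ K, ∀ y, (1 + ‖y‖) ^ K * ‖iteratedFDeriv ℝ l φ y‖ ≤ B) → ‖F φ‖ ≤ C * B := by
  obtain ⟨s, C, -, hC⟩ := Seminorm.bound_of_continuous (schwartz_withSeminorms ℂ V ℂ)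
    ((normSeminorm ℂ ℂ).comp F.toLinearMap) (by exact continuous_norm.comp F.continuous)
  refine ⟨C, C.2, s.sup (fun m => max m.1 m.2), fun φ B hB h => (hC φ).trans ?_⟩
  refine mul_le_mul_of_nonneg_left ?_ C.2
  refine Seminorm.finset_sup_apply_le hB fun m hm => ?_
  have h1 : max m.1 m.2 ≤ s.sup (fun m => max m.1 m.2) := Finset.le_sup (f := fun m : ℕ × ℕ => max m.1 m.2) hm
  refine SchwartzMap.seminorm_le_bound ℂ _ _ φ hB fun y => le_trans ?_ (h m.2 ((le_max_right _ _).trans h1) y)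
  gcongr
  calc ‖y‖ ^ m.1 ≤ (1 + ‖y‖) ^ m.1 := by gcongr; linarith
    _ ≤ _ := pow_le_pow_right₀ (by linarith [norm_nonneg y]) ((le_max_left _ _).trans h1)

lemma peetre (x y : V) (K : ℕ) : (1 + ‖y‖) ^ K ≤ (1 + ‖x‖) ^ K * (1 + ‖y + x‖) ^ K := by
  rw [← mul_pow]; gcongr
  have := norm_sub_le (y + x) x
  rw [add_sub_cancel_right] at this
  nlinarith [norm_nonneg x, norm_nonneg (y + x)]

lemma tau_bd {φ : SchwartzMap V ℂ} {K : ℕ} {B : ℝ} (h : ∀ l ≤ K, ∀ y, (1 + ‖y‖) ^ K * ‖iteratedFDeriv ℝ l φ y‖ ≤ B) (x : V) :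
    ∀ l ≤ K, ∀ y, (1 + ‖y‖) ^ K * ‖iteratedFDeriv ℝ l (tau x φ) y‖ ≤ (1 + ‖x‖) ^ K * B := fun l hl y => by
  rw [tau_it]
  calc _ ≤ (1 + ‖x‖) ^ K * (1 + ‖y + x‖) ^ K * ‖iteratedFDeriv ℝ l φ (y + x)‖ := by gcongr; exact peetre x y K
    _ ≤ _ := by rw [mul_assoc]; gcongr; exact h l hl _

lemma tau_sub_bd (φ : SchwartzMap V ℂ) (K : ℕ) (ρ : ℝ) : ∃ B : ℝ, 0 ≤ B ∧ ∀ x x' : V, ‖x‖ ≤ ρ → ‖x'‖ ≤ ρ → ∀ l ≤ K, ∀ y,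
    (1 + ‖y‖) ^ K * ‖iteratedFDeriv ℝ l (tau x φ - tau x' φ) y‖ ≤ B * ‖x - x'‖ := by
  obtain ⟨B, hB, h⟩ := sbd φ (K + 1)
  refine ⟨(1 + |ρ|) ^ K * B, by positivity, fun x x' hx hx' l hl y => ?_⟩
  have e : iteratedFDeriv ℝ l (tau x φ - tau x' φ) y = iteratedFDeriv ℝ l φ (y + x) - iteratedFDeriv ℝ l φ (y + x') := by
    rw [← tau_it, ← tau_it]
    have : ⇑(tau x φ - tau x' φ) = ⇑(tau x φ) - ⇑(tau x' φ) := rfl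
    rw [this, iteratedFDeriv_sub ((tau x φ).smooth l) ((tau x' φ).smooth l)]; rfl
  rw [e]
  have hd : Differentiable ℝ (iteratedFDeriv ℝ l φ) := (φ.smooth ⊤).differentiable_iteratedFDeriv (mod_cast ENat.natCast_lt_top l)
  have := (convex_closedBall (0 : V) ρ).norm_image_sub_le_of_norm_hasFDerivWithin_le (𝕜 := ℝ) (C := (1 + |ρ|) ^ K * B / (1 + ‖y‖) ^ K)
    (f := fun w => iteratedFDeriv ℝ l φ (y + w)) (f' := fun w => fderiv ℝ (iteratedFDeriv ℝ l φ) (y + w))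
    (fun w _ => ((hasFDerivAt_comp_add_left y).2 (hd (y + w)).hasFDerivAt).hasFDerivWithinAt) (fun w hw => ?_)
    (by simpa using hx' : x' ∈ _) (by simpa using hx : x ∈ _)
  · calc _ ≤ (1 + ‖y‖) ^ K * ((1 + |ρ|) ^ K * B / (1 + ‖y‖) ^ K * ‖x - x'‖) := by gcongr
      _ = _ := by field_simp
  · rw [norm_fderiv_iteratedFDeriv, le_div_iff₀ (by positivity), mul_comm]
    have hw : ‖w‖ ≤ |ρ| := (by simpa using hw : ‖w‖ ≤ ρ).trans (le_abs_self _)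
    calc _ ≤ ((1 + ‖w‖) ^ K * (1 + ‖y + w‖) ^ K) * ‖iteratedFDeriv ℝ (l + 1) φ (y + w)‖ := by gcongr; exact peetre w y K
      _ ≤ ((1 + |ρ|) ^ K * (1 + ‖y + w‖) ^ (K + 1)) * ‖iteratedFDeriv ℝ (l + 1) φ (y + w)‖ := by
          gcongr
          · linarith [norm_nonneg (y + w)]
          · simp
      _ ≤ _ := by rw [mul_assoc]; gcongr; exact h _ (by omega) _

/-- index type of the Banach space -/
structure DI (V : Type*) (K : ℕ) where
  y : V
  l : Fin (K + 1)
  m : Fin l → V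
instance (K : ℕ) : TopologicalSpace (DI V K) := ⊥
instance (K : ℕ) : DiscreteTopology (DI V K) := ⟨rfl⟩

def Jv {K : ℕ} (φ : SchwartzMap V ℂ) (i : DI V K) : ℂ :=
  (((1 + ‖i.y‖) ^ K * (∏ j, ‖i.m j‖)⁻¹ : ℝ) : ℂ) * iteratedFDeriv ℝ i.l φ i.y i.m

lemma Jv_le {K : ℕ} {φ : SchwartzMap V ℂ} {B : ℝ}
    (h : ∀ l ≤ K, ∀ y, (1 + ‖y‖) ^ K * ‖iteratedFDeriv ℝ l φ y‖ ≤ B) (i : DI V K) : ‖Jv φ i‖ ≤ B := by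
  refine le_trans ?_ (h i.l (by omega) i.y)
  rw [Jv, norm_mul, Complex.norm_real, Real.norm_of_nonneg (by positivity), mul_assoc]
  gcongr
  calc _ ≤ (∏ j, ‖i.m j‖)⁻¹ * (‖iteratedFDeriv ℝ i.l φ i.y‖ * ∏ j, ‖i.m j‖) := by
        gcongr; exact ContinuousMultilinearMap.le_opNorm _ _
    _ = ‖iteratedFDeriv ℝ i.l φ i.y‖ * ((∏ j, ‖i.m j‖)⁻¹ * ∏ j, ‖i.m j‖) := by ring
    _ ≤ _ := mul_le_of_le_one_right (norm_nonneg _) inv_mul_le_one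

def JB (K : ℕ) : SchwartzMap V ℂ →ₗ[ℂ] BoundedContinuousFunction (DI V K) ℂ where
  toFun φ := BoundedContinuousFunction.ofNormedAddCommGroupDiscrete (Jv φ) (sbd φ K).choose (Jv_le (sbd φ K).choose_spec.2)
  map_add' φ ψ := by
    ext i
    simp only [BoundedContinuousFunction.add_apply, BoundedContinuousFunction.coe_ofNormedAddCommGroupDiscrete, Jv]
    have : ⇑(φ + ψ) = ⇑φ + ⇑ψ := rfl
    rw [this, iteratedFDeriv_add (φ.smooth _) (ψ.smooth _)]; simp [mul_add]
  map_smul' c φ := by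
    ext i
    simp only [BoundedContinuousFunction.smul_apply, BoundedContinuousFunction.coe_ofNormedAddCommGroupDiscrete, Jv]
    have : ⇑(c • φ) = c • ⇑φ := rfl
    rw [this, iteratedFDeriv_const_smul_apply (φ.smooth _).contDiffAt]; simp; ring

lemma JB_apply (K : ℕ) (φ : SchwartzMap V ℂ) (i : DI V K) : JB K φ i = Jv φ i := rfl

lemma JB_norm {K : ℕ} {φ : SchwartzMap V ℂ} {B : ℝ} (hB : 0 ≤ B)
    (h : ∀ l ≤ K, ∀ y, (1 + ‖y‖) ^ K * ‖iteratedFDeriv ℝ l φ y‖ ≤ B) : ‖JB K φ‖ ≤ B :=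
  (BoundedContinuousFunction.norm_le hB).2 (Jv_le h)

lemma JB_ge {K : ℕ} (φ : SchwartzMap V ℂ) : ∀ l ≤ K, ∀ y, (1 + ‖y‖) ^ K * ‖iteratedFDeriv ℝ l φ y‖ ≤ ‖JB K φ‖ := by
  intro l hl y
  rw [mul_comm, ← le_div_iff₀ (by positivity)]
  refine ContinuousMultilinearMap.opNorm_le_bound (by positivity) fun m => ?_
  by_cases hm : ∏ j, ‖m j‖ = 0
  · obtain ⟨j, -, hj⟩ := Finset.prod_eq_zero_iff.1 hm
    rw [ContinuousMultilinearMap.map_coord_zero _ j (by simpa using hj)]; simp [hm]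
  have h1 := (JB K φ).norm_coe_le_norm ⟨y, ⟨l, by omega⟩, m⟩
  rw [JB_apply, Jv, norm_mul, Complex.norm_real, Real.norm_of_nonneg (by positivity)] at h1
  have hp : 0 < ∏ j, ‖m j‖ := lt_of_le_of_ne (by positivity) (Ne.symm hm)
  rw [div_mul_eq_mul_div, le_div_iff₀ (by positivity)]
  calc _ = ((1 + ‖y‖) ^ K * (∏ j, ‖m j‖)⁻¹ * ‖iteratedFDeriv ℝ l φ y m‖) * ∏ j, ‖m j‖ := by field_simp
    _ ≤ _ := by gcongr

lemma factor (F : SchwartzMap V ℂ →L[ℂ] ℂ) : ∃ K : ℕ, ∃ G : BoundedContinuousFunction (DI V K) ℂ →L[ℂ] ℂ, ∀ φ, F φ = G (JB K φ) := by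
  obtain ⟨C, hC, K, h⟩ := fbd F
  have hi : Function.Injective (JB (V := V) K) := fun φ ψ hh => by
    ext y
    have := DFunLike.congr_fun hh ⟨y, 0, fun i => i.elim0⟩
    have hy : (((1 + ‖y‖) ^ K * (∏ j : Fin ((0 : Fin (K + 1)) : ℕ), ‖(j.elim0 : V)‖)⁻¹ : ℝ) : ℂ) ≠ 0 := by
      rw [Complex.ofReal_ne_zero]
      have : (∏ j : Fin ((0 : Fin (K + 1)) : ℕ), ‖(j.elim0 : V)‖) = 1 := Finset.prod_eq_one fun j _ => j.elim0
      rw [this]; positivity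
    have := mul_left_cancel₀ hy this
    exact this
  obtain ⟨G, hG, -⟩ := exists_extension_norm_eq (LinearMap.range (JB (V := V) K))
    (LinearMap.mkContinuous (F.toLinearMap ∘ₗ (LinearEquiv.ofInjective (JB K) hi).symm.toLinearMap) C fun u => by
      obtain ⟨φ, rfl⟩ := (LinearEquiv.ofInjective (JB K) hi).surjective u
      change ‖F ((LinearEquiv.ofInjective (JB K) hi).symm _)‖ ≤ _
      rw [LinearEquiv.symm_apply_apply]; exact h φ _ (norm_nonneg (JB K φ)) (JB_ge φ))
  refine ⟨K, G, fun φ => ?_⟩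
  have := hG (LinearEquiv.ofInjective (JB K) hi φ)
  change _ = F ((LinearEquiv.ofInjective (JB K) hi).symm _) at this
  rw [LinearEquiv.symm_apply_apply] at this
  exact this.symm

lemma JB_tau_cont (K : ℕ) (φ : SchwartzMap V ℂ) : Continuous fun x => JB K (tau x φ) := by
  refine continuous_iff_continuousAt.2 fun x => ?_
  obtain ⟨B, hB, h⟩ := tau_sub_bd φ K (‖x‖ + 1)
  rw [ContinuousAt, tendsto_iff_norm_sub_tendsto_zero]
  have h0 : Filter.Tendsto (fun x' : V => B * ‖x' - x‖) (nhds x) (nhds 0) := by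
    have : Continuous fun x' : V => B * ‖x' - x‖ := by fun_prop
    simpa using this.tendsto x
  refine squeeze_zero' (.of_forall fun _ => norm_nonneg _) ?_ h0
  filter_upwards [Metric.ball_mem_nhds x one_pos] with x' hx'
  rw [← map_sub]
  refine JB_norm (by positivity) (h x' x ?_ (by linarith))
  rw [mem_ball_iff_norm] at hx'
  linarith [norm_le_insert' x' x]

lemma tau_cont (F : SchwartzMap V ℂ →L[ℂ] ℂ) (φ : SchwartzMap V ℂ) : Continuous fun x => F (tau x φ) := by
  obtain ⟨K, G, h⟩ := factor F
  simp only [h]; exact G.continuous.comp (JB_tau_cont K φ)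

variable [MeasurableSpace V] [BorelSpace V] [SecondCountableTopology V] {μ : Measure V} [μ.HasTemperateGrowth]

lemma int_poly (g : SchwartzMap V ℂ) (K : ℕ) : Integrable (fun z => (1 + ‖z‖) ^ K * ‖g z‖) μ := by
  simp only [add_comm (1 : ℝ), add_pow, one_pow, mul_one, Finset.sum_mul]
  refine integrable_finsetSum _ fun k _ => ?_
  refine ((g.integrable_pow_mul μ k).const_mul (K.choose k : ℝ)).congr (.of_forall fun z => ?_)
  simp only; ring

lemma tau_conv (F : SchwartzMap V ℂ →L[ℂ] ℂ) (c g h : SchwartzMap V ℂ)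
    (H : ∀ (l : ℕ) (m : Fin l → V) (x : V), iteratedFDeriv ℝ l c x m = ∫ z, g z * iteratedFDeriv ℝ l h (x - z) m ∂μ) (x : V) :
    F (tau x c) = ∫ z, g z * F (tau (x - z) h) ∂μ := by
  obtain ⟨K, G, hG⟩ := factor F
  obtain ⟨B, hB, hb⟩ := sbd h K
  have hint : Integrable (fun z => g z • JB K (tau (x - z) h)) μ := by
    refine ((int_poly g K).const_mul ((1 + ‖x‖) ^ K * B)).mono' ?_ (.of_forall fun z => ?_)
    · exact (g.continuous.smul ((JB_tau_cont K h).comp (continuous_const.sub continuous_id))).aestronglyMeasurable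
    · rw [norm_smul]
      calc _ ≤ ‖g z‖ * ((1 + ‖x - z‖) ^ K * B) := by
            gcongr; exact JB_norm (by positivity) (tau_bd hb _)
        _ ≤ ‖g z‖ * (((1 + ‖z‖) ^ K * (1 + ‖x - z + z‖) ^ K) * B) := by gcongr; exact peetre _ _ _
        _ = _ := by rw [sub_add_cancel]; ring
  have key : JB K (tau x c) = ∫ z, g z • JB K (tau (x - z) h) ∂μ := by
    ext i
    have := (BoundedContinuousFunction.evalCLM ℂ i).integral_comp_comm hint
    simp only [BoundedContinuousFunction.evalCLM_apply] at this
    rw [← this, JB_apply, Jv, tau_it, H, ← integral_const_mul]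
    congr 1; ext z
    simp only [BoundedContinuousFunction.smul_apply, JB_apply, Jv, tau_it, smul_eq_mul]
    rw [show i.y + x - z = i.y + (x - z) by abel]; ring
  rw [hG, key, ← G.integral_comp_comm hint]
  simp [hG]
end


abbrev Sz (n : ℕ) := SchwartzMap (RV n) ℂ

section
open FourierTransform LineDeriv Real
abbrev EU (n : ℕ) := EuclideanSpace ℝ (Fin n)
variable {n : ℕ}
def eE (n : ℕ) : EU n ≃L[ℝ] RV n := EuclideanSpace.equiv (Fin n) ℝ
def up (g : Sz n) : SchwartzMap (EU n) ℂ := SchwartzMap.compCLMOfContinuousLinearEquiv ℂ (eE n) g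
def dn (g : SchwartzMap (EU n) ℂ) : Sz n := SchwartzMap.compCLMOfContinuousLinearEquiv ℂ (eE n).symm g
lemma up_apply (g : Sz n) (x) : up g x = g (eE n x) := rfl
lemma dn_apply (g : SchwartzMap (EU n) ℂ) (x) : dn g x = g ((eE n).symm x) := rfl
lemma up_dn (g : SchwartzMap (EU n) ℂ) : up (dn g) = g := by ext x; simp [up_apply, dn_apply]
lemma dn_up (g : Sz n) : dn (up g) = g := by ext x; simp [up_apply, dn_apply]

lemma eE_int (F : RV n → ℂ) : ∫ v : EU n, F (eE n v) = ∫ x, F x :=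
  (PiLp.volume_preserving_ofLp (Fin n)).integral_comp (MeasurableEquiv.toLp 2 (RV n)).symm.measurableEmbedding F

lemma FT_up (g : Sz n) (ξ : RV n) : FT n g ξ = 𝓕 (up g) ((eE n).symm ((2 * π)⁻¹ • ξ)) := by
  rw [SchwartzMap.fourier_coe, Real.fourier_eq', FT, ← eE_int]
  congr 1; ext v
  rw [smul_eq_mul, up_apply]
  congr 2
  have : inner ℝ v ((eE n).symm ((2 * π)⁻¹ • ξ)) = (2 * π)⁻¹ * ∑ i, (eE n v) i * ξ i := by
    rw [PiLp.inner_apply, Finset.mul_sum]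
    refine Finset.sum_congr rfl fun i _ => ?_
    simp [eE]; ring
  rw [this]
  have : -2 * π * ((2 * π)⁻¹ * ∑ i, (eE n v) i * ξ i) = - ∑ i, (eE n v) i * ξ i := by
    field_simp [Real.pi_ne_zero]
  rw [this]; push_cast; ring

lemma FT_inj {g h : Sz n} (H : ∀ ξ, FT n g ξ = FT n h ξ) : g = h := by
  have : 𝓕 (up g) = 𝓕 (up h) := by
    ext w
    have := H ((2 * π) • eE n w)
    rw [FT_up, FT_up, smul_smul, inv_mul_cancel₀ (by positivity), one_smul, ContinuousLinearEquiv.symm_apply_apply] at this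
    exact this
  have h2 := congrArg (fun g => dn (𝓕⁻ g)) this
  simpa [dn_up] using h2

def sc2 (n : ℕ) : RV n ≃L[ℝ] RV n := ContinuousLinearEquiv.smulLeft (Units.mk0 (2 * π) (by positivity) : ℝˣ)
lemma sc2_apply (x : RV n) : sc2 n x = (2 * π) • x := rfl

/-- inverse Fourier transform -/
def FI (g : Sz n) : Sz n := dn (𝓕⁻ (SchwartzMap.compCLMOfContinuousLinearEquiv ℂ ((eE n).trans (sc2 n)) g))
lemma FT_FI (g : Sz n) (ξ) : FT n (FI g) ξ = g ξ := by
  rw [FT_up, FI, up_dn, fourier_fourierInv_eq]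
  simp only [SchwartzMap.compCLMOfContinuousLinearEquiv_apply, Function.comp_apply, ContinuousLinearEquiv.trans_apply,
    ContinuousLinearEquiv.apply_symm_apply, sc2_apply, smul_smul]
  rw [mul_inv_cancel₀ (by positivity), one_smul]

lemma FT_cont (g : Sz n) : Continuous (FT n g) := by
  have : FT n g = fun ξ => 𝓕 (up g) ((eE n).symm ((2 * π)⁻¹ • ξ)) := funext (FT_up g)
  rw [this]; have := (𝓕 (up g)).continuous; fun_prop

/-- convolution -/
def cv (g h : Sz n) : Sz n := dn (SchwartzMap.convolution (ContinuousLinearMap.mul ℂ ℂ) (up g) (up h))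

lemma cv_apply (g h : Sz n) (x) : cv g h x = ∫ y, g y * h (x - y) := by
  rw [cv, dn_apply, SchwartzMap.convolution_apply, convolution_def, ← eE_int]
  congr 1

lemma FT_cv (g h : Sz n) (ξ) : FT n (cv g h) ξ = FT n g ξ * FT n h ξ := by
  simp only [FT_up, cv, up_dn, SchwartzMap.fourier_convolution]; simp

lemma cv_comm (g h : Sz n) : cv g h = cv h g := FT_inj fun ξ => by rw [FT_cv, FT_cv, mul_comm]
lemma cv_assoc (g h k : Sz n) : cv (cv g h) k = cv g (cv h k) := FT_inj fun ξ => by simp only [FT_cv, mul_assoc]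

lemma FT_add (g h : Sz n) (ξ) : FT n (g + h : Sz n) ξ = FT n g ξ + FT n h ξ := by
  have : up (g + h) = up g + up h := rfl
  simp only [FT_up, this, FourierTransform.fourier_add]; rfl
lemma FT_smul (c : ℂ) (g : Sz n) (ξ) : FT n (c • g : Sz n) ξ = c * FT n g ξ := by
  have : up (c • g) = c • up g := rfl
  simp only [FT_up, this, FourierTransform.fourier_smul]; rfl
lemma FT_sub (g h : Sz n) (ξ) : FT n (g - h : Sz n) ξ = FT n g ξ - FT n h ξ := by
  have := FT_add (g - h) h ξ
  rw [sub_add_cancel] at this; rw [this]; ring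

lemma FT_deriv (g : Sz n) (v ξ : RV n) : FT n (∂_{v} g : Sz n) ξ = I * (∑ i, v i * ξ i : ℝ) * FT n g ξ := by
  have : up (∂_{v} g) = ∂_{(eE n).symm v} (up g) := by
    rw [up, up, SchwartzMap.lineDerivOp_compCLMOfContinuousLinearEquiv]; simp
  rw [FT_up, FT_up, this, SchwartzMap.fourier_lineDerivOp_eq]
  have hT : (fun x : EU n => inner ℝ x ((eE n).symm v)).HasTemperateGrowth := by fun_prop
  rw [_root_.smul_apply, SchwartzMap.smulLeftCLM_apply_apply hT]
  have : inner ℝ ((eE n).symm ((2 * π)⁻¹ • ξ)) ((eE n).symm v) = (2 * π)⁻¹ * ∑ i, v i * ξ i := by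
    rw [PiLp.inner_apply, Finset.mul_sum]
    refine Finset.sum_congr rfl fun i _ => ?_
    simp [eE]; ring
  rw [this, smul_eq_mul, Complex.real_smul]
  push_cast; field_simp

/-- multiplication by a coordinate -/
def Xm (i : Fin n) (g : Sz n) : Sz n := SchwartzMap.smulLeftCLM ℂ (fun x : RV n => x i) g
lemma Xm_apply (i : Fin n) (g : Sz n) (x) : Xm i g x = x i * g x := by
  have hT : (fun x : RV n => x i).HasTemperateGrowth :=
    (ContinuousLinearMap.proj (R := ℝ) (φ := fun _ : Fin n => ℝ) i).hasTemperateGrowth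
  rw [Xm, SchwartzMap.smulLeftCLM_apply_apply hT, Complex.real_smul]

lemma pderiv_FT (g : Sz n) (i : Fin n) : pderiv1 n i (FT n g) = FT n (-I • Xm i g : Sz n) := by
  have h0 : FT n g = fun ξ => (𝓕 (up g)) ((((eE n).symm : RV n →L[ℝ] EU n).comp ((2 * π)⁻¹ • ContinuousLinearMap.id ℝ (RV n))) ξ) :=
    funext fun ξ => by rw [FT_up]; rfl
  ext ξ
  rw [pderiv1, h0, fderiv_fun_comp ξ (𝓕 (up g)).differentiableAt (ContinuousLinearMap.differentiableAt _), ContinuousLinearMap.fderiv, FT_up]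
  simp only [ContinuousLinearMap.comp_apply]
  rw [← SchwartzMap.lineDerivOp_apply_eq_fderiv, SchwartzMap.lineDerivOp_fourier_eq]
  simp only [_root_.smul_apply, ContinuousLinearMap.id_apply]
  change (𝓕 (_ : SchwartzMap (EU n) ℂ) : SchwartzMap (EU n) ℂ) ((eE n).symm ((2 * π)⁻¹ • ξ)) = _
  congr 2
  ext x
  have hT : (fun x : EU n => inner ℝ x ((eE n).symm ((2 * π)⁻¹ • Pi.single i 1))).HasTemperateGrowth := by fun_prop
  rw [_root_.smul_apply, up_apply, _root_.smul_apply, Xm_apply]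
  erw [SchwartzMap.smulLeftCLM_apply_apply hT]
  have : inner ℝ x ((eE n).symm ((2 * π)⁻¹ • Pi.single i 1)) = (2 * π)⁻¹ * eE n x i := by
    rw [PiLp.inner_apply, Finset.sum_eq_single i]
    · simp [eE]
    · intro j _ hj; simp [eE, hj]
    · simp
  rw [this, up_apply, smul_eq_mul, smul_eq_mul, Complex.real_smul]; push_cast; field_simp

lemma cv_deriv (g h : Sz n) (v : RV n) : ∂_{v} (cv g h) = cv g (∂_{v} h) := FT_inj fun ξ => by
  simp only [FT_deriv, FT_cv]; ring

lemma cv_it (g h : Sz n) (l : ℕ) (m : Fin l → RV n) (x : RV n) :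
    iteratedFDeriv ℝ l (cv g h) x m = ∫ z, g z * iteratedFDeriv ℝ l h (x - z) m := by
  have : ∀ l (m : Fin l → RV n), ∂^{m} (cv g h) = cv g (∂^{m} h) := by
    intro l; induction l with
    | zero => intro m; simp
    | succ l ih => intro m; rw [iteratedLineDerivOp_succ_left, iteratedLineDerivOp_succ_left, ih, cv_deriv]
  rw [← SchwartzMap.iteratedLineDerivOp_eq_iteratedFDeriv, this, cv_apply]
  simp only [SchwartzMap.iteratedLineDerivOp_eq_iteratedFDeriv]
end


section
variable {n : ℕ} (a : Fin n → ℝ)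

/-- anisotropic dilation -/
def DD (t : ℝ) : RV n ≃L[ℝ] RV n := ContinuousLinearEquiv.piCongrRight fun i =>
  ContinuousLinearEquiv.smulLeft (Units.mk0 ((2 : ℝ) ^ (t * a i)) (by positivity) : ℝˣ)
lemma DD_apply (t : ℝ) (x : RV n) (i) : DD a t x i = 2 ^ (t * a i) * x i := rfl
lemma DD_add (s t : ℝ) (x : RV n) : DD a (s + t) x = DD a s (DD a t x) := by
  ext i; simp only [DD_apply]; rw [add_mul, Real.rpow_add (by norm_num), mul_assoc]
lemma DD_zero (x : RV n) : DD a 0 x = x := by ext i; simp [DD_apply]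

lemma DD_map (t : ℝ) : Measure.map (DD a t) (volume : Measure (RV n)) = tp (-(t * ∑ i, a i)) • volume := by
  have hd : (Matrix.diagonal fun i => (2 : ℝ) ^ (t * a i)).det = 2 ^ (t * ∑ i, a i) := by
    rw [Matrix.det_diagonal, Finset.mul_sum, Real.rpow_sum_of_pos (by norm_num)]
  have := Real.smul_map_diagonal_volume_pi (D := fun i => (2 : ℝ) ^ (t * a i)) (by rw [hd]; positivity)
  rw [hd, abs_of_nonneg (by positivity), tp_of] at this
  have e : (⇑(Matrix.toLin' (Matrix.diagonal fun i => (2 : ℝ) ^ (t * a i)))) = DD a t := by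
    ext x i; simp [Matrix.toLin'_apply, Matrix.mulVec_diagonal, DD_apply]
  rw [e] at this
  conv_rhs => rw [← this]
  rw [smul_smul, ← tp_add, neg_add_cancel, tp_zero, one_smul]

lemma int_DD (t : ℝ) (G : RV n → ℂ) : ∫ x, G (DD a t x) = ((2 ^ (-(t * ∑ i, a i)) : ℝ) : ℂ) * ∫ x, G x := by
  refine ((DD a t).toHomeomorph.measurableEmbedding.integral_map (μ := volume) G).symm.trans ?_
  change ∫ y, G y ∂(Measure.map (DD a t) volume) = _
  rw [DD_map, integral_smul_measure, ← tp_of, ENNReal.toReal_ofReal (by positivity), Complex.real_smul]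

/-- `dil j g` -/
def dil (j : ℕ) (g : Sz n) : Sz n :=
  ((2 ^ ((j : ℝ) * ∑ i, a i) : ℝ) : ℂ) • SchwartzMap.compCLMOfContinuousLinearEquiv ℂ (DD a j) g
lemma dil_apply (j : ℕ) (g : Sz n) (x) : dil a j g x = ((2 ^ ((j : ℝ) * ∑ i, a i) : ℝ) : ℂ) * g (DD a j x) := rfl
lemma dil_zero (g : Sz n) : dil a 0 g = g := by
  ext x; rw [dil_apply]; simp [DD_zero]

lemma int_dil (j : ℕ) (g : Sz n) : ∫ x, dil a j g x = ∫ x, g x := by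
  simp only [dil_apply]
  rw [integral_const_mul, int_DD, ← mul_assoc, ← Complex.ofReal_mul, ← Real.rpow_add (by norm_num)]; simp

lemma int_dil_mul (j : ℕ) (g : Sz n) (G : RV n → ℂ) : ∫ x, dil a j g x * G x = ∫ x, g x * G (DD a (-j) x) := by
  have := int_DD a j fun x => g x * G (DD a (-j) x)
  rw [← mul_right_inj' (a := (((2 : ℝ) ^ ((j : ℝ) * ∑ i, a i) : ℝ) : ℂ)) (by norm_cast; positivity), ← mul_assoc,
    ← Complex.ofReal_mul, ← Real.rpow_add (by norm_num), add_neg_cancel, Real.rpow_zero, Complex.ofReal_one, one_mul] at this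
  rw [← this, ← integral_const_mul]
  congr 1; ext x
  rw [← DD_add, neg_add_cancel, DD_zero, dil_apply]; ring

lemma FT_dil (j : ℕ) (g : Sz n) (ξ) : FT n (dil a j g) ξ = FT n g (DD a (-j) ξ) := by
  unfold FT
  have := int_dil_mul a j g (fun x => Complex.exp (-Complex.I * ((∑ i, x i * ξ i : ℝ) : ℂ)))
  simp only [mul_comm (cexp _)]
  rw [this]
  congr 1; ext x; simp only [DD_apply]; congr 6; ext i; ring_nf

lemma dil_dil (j m : ℕ) (g : Sz n) : dil a j (dil a m g) = dil a (j + m) g := FT_inj fun ξ => by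
  simp only [FT_dil, ← DD_add]; congr 2; push_cast; ring
lemma dil_cv (j : ℕ) (g h : Sz n) : dil a j (cv g h) = cv (dil a j g) (dil a j h) := FT_inj fun ξ => by
  simp only [FT_dil, FT_cv]
lemma dil_sub (j : ℕ) (g h : Sz n) : dil a j (g - h) = dil a j g - dil a j h := FT_inj fun ξ => by
  simp only [FT_dil, FT_sub]

/-- reflection -/
def ngS : Sz n →L[ℂ] Sz n := SchwartzMap.compCLMOfContinuousLinearEquiv ℂ (ContinuousLinearEquiv.neg ℝ)
/-- convolution with a distribution -/
def Tf (f : TD n) (h : Sz n) (x : RV n) : ℂ := f (ngS (tau x h))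
lemma ngS_tau (h : Sz n) (x y : RV n) : ngS (tau x h) y = h (x - y) := by
  change tau x h (-y) = _; rw [tau_apply, sub_eq_neg_add]
lemma Tf_cont (f : TD n) (h : Sz n) : Continuous (Tf f h) := tau_cont (f ∘L ngS) h
lemma Tf_cv (f : TD n) (g h : Sz n) (x) : Tf f (cv g h) x = ∫ z, g z * Tf f h (x - z) :=
  tau_conv (μ := volume) (f ∘L ngS) (cv g h) g h (cv_it g h) x
lemma Tf_add (f : TD n) (g h : Sz n) (x) : Tf f (g + h) x = Tf f g x + Tf f h x := by simp [Tf]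
lemma Tf_sub (f : TD n) (g h : Sz n) (x) : Tf f (g - h) x = Tf f g x - Tf f h x := by simp [Tf]

lemma Tf_cv_le (f : TD n) (g h : Sz n) (x) : ‖Tf f (cv g h) x‖ₑ ≤ ∫⁻ z, ‖g (x - z)‖ₑ * ‖Tf f h z‖ₑ := by
  rw [Tf_cv]
  refine (enorm_integral_le_lintegral_enorm _).trans (le_of_eq ?_)
  rw [← lintegral_sub_left_eq_self _ x]
  congr 1; ext z; rw [enorm_mul, sub_sub_cancel]

variable {a} in
lemma DD_ge (ha : ∀ i, 0 ≤ a i) (j : ℕ) (y : RV n) : ‖y‖ ≤ ‖DD a j y‖ := by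
  refine (pi_norm_le_iff_of_nonneg (norm_nonneg _)).2 fun i => le_trans ?_ (norm_le_pi_norm _ i)
  rw [DD_apply, norm_mul]
  refine le_mul_of_one_le_left (norm_nonneg _) ?_
  rw [Real.norm_of_nonneg (by positivity)]
  exact Real.one_le_rpow (by norm_num) (mul_nonneg (Nat.cast_nonneg _) (ha i))

variable {a} in
lemma DD_le (ha : ∀ i, 0 ≤ a i) (j : ℕ) : ‖(DD a j : RV n →L[ℝ] RV n)‖ ≤ 2 ^ ((j : ℝ) * ∑ i, a i) := by
  refine ContinuousLinearMap.opNorm_le_bound _ (by positivity) fun x => ?_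
  refine (pi_norm_le_iff_of_nonneg (by positivity)).2 fun i => ?_
  change ‖DD a j x i‖ ≤ _
  rw [DD_apply, norm_mul, Real.norm_of_nonneg (by positivity)]
  gcongr
  · norm_num
  · exact Finset.single_le_sum (fun i _ => ha i) (Finset.mem_univ i)
  · exact norm_le_pi_norm _ i

lemma uwr_ge (x : RV n) : 1 + ‖x‖ ≤ uwr a 0 x := by
  have h1 : ‖x‖ ≤ uwr a 0 x - 1 := by
    refine (pi_norm_le_iff_of_nonneg (by linarith [uwr_one a 0 x])).2 fun i => ?_
    have : 1 + |x i| ≤ uwr a 0 x := by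
      unfold uwr
      rw [← Finset.mul_prod_erase _ _ (Finset.mem_univ i)]
      simp only [Nat.cast_zero, zero_mul, Real.rpow_zero, one_mul]
      refine le_mul_of_one_le_right (by positivity) ?_
      refine (Finset.prod_const_one (s := Finset.univ.erase i)).symm.le.trans ?_
      exact Finset.prod_le_prod (fun _ _ => zero_le_one) fun i _ => by linarith [abs_nonneg (x i)]
    rw [Real.norm_eq_abs]; linarith
  linarith

variable {a} in
lemma Tf_growth (ha : ∀ i, 0 ≤ a i) (f : TD n) (g : Sz n) : ∃ (A L : ℝ) (K : ℕ), 0 ≤ A ∧ ∀ (j : ℕ) x,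
    ‖Tf f (dil a j g) x‖ ≤ A * 2 ^ ((j : ℝ) * L) * (1 + ‖x‖) ^ K := by
  obtain ⟨C, hC, K, h⟩ := fbd (f ∘L ngS)
  obtain ⟨B, hB, hb⟩ := sbd g K
  refine ⟨C * B, (∑ i, a i) * (K + 1), K, by positivity, fun j x => ?_⟩
  have hS : 0 ≤ ∑ i, a i := Finset.sum_nonneg fun i _ => ha i
  have h1 : (1 : ℝ) ≤ 2 ^ ((j : ℝ) * ∑ i, a i) := Real.one_le_rpow (by norm_num) (by positivity)
  refine (h _ _ (by positivity) (tau_bd (B := 2 ^ ((j : ℝ) * ((∑ i, a i) * (K + 1))) * B) (fun l hl y => ?_) x)).trans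
    (by ring_nf; rfl)
  have e : ‖iteratedFDeriv ℝ l (dil a j g) y‖ ≤ 2 ^ ((j : ℝ) * ∑ i, a i) * ((2 ^ ((j : ℝ) * ∑ i, a i)) ^ K * ‖iteratedFDeriv ℝ l g (DD a j y)‖) := by
    have e0 : ⇑(dil a j g) = ((2 ^ ((j : ℝ) * ∑ i, a i) : ℝ) : ℂ) • (⇑g ∘ (DD a j : RV n →L[ℝ] RV n)) := rfl
    rw [e0, iteratedFDeriv_const_smul_apply ((g.smooth l).comp (ContinuousLinearMap.contDiff _)).contDiffAt, norm_smul,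
      Complex.norm_real, Real.norm_of_nonneg (by positivity)]
    gcongr
    rw [ContinuousLinearMap.iteratedFDeriv_comp_right _ (g.smooth l) _ le_rfl]
    refine (ContinuousMultilinearMap.norm_compContinuousLinearMap_le _ _).trans ?_
    rw [Finset.prod_const, Finset.card_univ, Fintype.card_fin, mul_comm]
    gcongr
    · calc _ ≤ (2 ^ ((j : ℝ) * ∑ i, a i)) ^ l := by gcongr; exact DD_le ha j
        _ ≤ _ := pow_le_pow_right₀ h1 hl
    · rfl
  calc _ ≤ (1 + ‖DD a j y‖) ^ K * (2 ^ ((j : ℝ) * ∑ i, a i) * ((2 ^ ((j : ℝ) * ∑ i, a i)) ^ K * ‖iteratedFDeriv ℝ l g (DD a j y)‖)) := by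
        gcongr; exact DD_ge ha j y
    _ = (2 ^ ((j : ℝ) * ∑ i, a i)) ^ (K + 1) * ((1 + ‖DD a j y‖) ^ K * ‖iteratedFDeriv ℝ l g (DD a j y)‖) := by ring
    _ ≤ (2 ^ ((j : ℝ) * ∑ i, a i)) ^ (K + 1) * B := by gcongr; exact hb l hl _
    _ = _ := by rw [← Real.rpow_natCast, ← Real.rpow_mul (by norm_num)]; push_cast; ring_nf
end


section
variable {n : ℕ} (a : Fin n → ℝ)

/-- the family as Schwartz functions -/
def sf (φ0 φ : Sz n) (j : ℕ) : Sz n := if j = 0 then φ0 else dil a j φ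

lemma dil_neg_tendsto (ha : ∀ i, 0 < a i) (u : RV n) :
    Filter.Tendsto (fun K : ℕ => DD a (-(K : ℝ)) u) Filter.atTop (nhds 0) := by
  rw [tendsto_pi_nhds]; intro i
  simp only [DD_apply, Pi.zero_apply]
  have : Filter.Tendsto (fun K : ℕ => ((2 : ℝ) ^ (-a i)) ^ K * u i) Filter.atTop (nhds (0 * u i)) :=
    (tendsto_pow_atTop_nhds_zero_of_lt_one (by positivity) (Real.rpow_lt_one_of_one_lt_of_neg (by norm_num) (by linarith [ha i]))).mul_const _
  rw [zero_mul] at this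
  refine this.congr fun K => ?_
  rw [← Real.rpow_natCast, ← Real.rpow_mul (by norm_num)]; ring_nf

variable {a}
lemma DD_neg_le (ha : ∀ i, 0 ≤ a i) (j : ℕ) (y : RV n) : ‖DD a (-j) y‖ ≤ ‖y‖ := by
  have := DD_ge ha j (DD a (-j) y)
  rwa [← DD_add, add_neg_cancel, DD_zero] at this

lemma Tf_lim (ha : ∀ i, 0 < a i) (f : TD n) {ρ : Sz n} (hρ : ∫ x, ρ x = 1) (χ : Sz n) (x : RV n) :
    Filter.Tendsto (fun K : ℕ => Tf f (cv (dil a K ρ) χ) x) Filter.atTop (nhds (Tf f χ x)) := by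
  obtain ⟨A, L, K, hA, h⟩ := Tf_growth (fun i => (ha i).le) f χ
  have h0 : ∀ x, ‖Tf f χ x‖ ≤ A * (1 + ‖x‖) ^ K := fun x => by have := h 0 x; rw [dil_zero] at this; simpa using this
  have e : ∀ K : ℕ, Tf f (cv (dil a K ρ) χ) x = ∫ u, ρ u * Tf f χ (x - DD a (-K) u) := fun K => by
    rw [Tf_cv, int_dil_mul a K ρ fun z => Tf f χ (x - z)]
  simp only [e]
  have e2 : Tf f χ x = ∫ u, ρ u * Tf f χ x := by rw [integral_mul_const, hρ, one_mul]
  rw [e2]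
  refine tendsto_integral_of_dominated_convergence (fun u => A * (1 + ‖x‖) ^ K * ((1 + ‖u‖) ^ K * ‖ρ u‖)) (fun K => ?_)
    ((int_poly ρ K).const_mul _) (fun k => .of_forall fun u => ?_) (.of_forall fun u => ?_)
  · have := Tf_cont f χ; have := ρ.continuous
    exact Continuous.aestronglyMeasurable (by fun_prop)
  · rw [norm_mul]
    calc _ ≤ ‖ρ u‖ * (A * (1 + ‖x - DD a (-k) u‖) ^ K) := by gcongr; exact h0 _
      _ ≤ ‖ρ u‖ * (A * ((1 + ‖x‖) * (1 + ‖u‖)) ^ K) := by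
          gcongr
          have := norm_sub_le x (DD a (-k) u)
          have := DD_neg_le (fun i => (ha i).le) k u
          nlinarith [norm_nonneg x, norm_nonneg u]
      _ = _ := by rw [mul_pow]; ring
  · refine Filter.Tendsto.const_mul _ ?_
    have := ((Tf_cont f χ).tendsto x).comp (f := fun k : ℕ => x - DD a (-k) u) (x := Filter.atTop)
      (by simpa using (dil_neg_tendsto a ha u).const_sub x)
    exact this

lemma repro (ha : ∀ i, 0 < a i) {ψ0 ψ lam0 lam ρ : Sz n} (hρ : ∫ x, ρ x = 1)
    (h1 : cv (dil a 1 lam) (dil a 1 ψ) = dil a 1 ρ - ρ) (f : TD n) (χ : Sz n) (j : ℕ) (x : RV n) :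
    ‖Tf f χ x‖ₑ ≤ ‖Tf f (cv (dil a j ρ) χ) x‖ₑ +
      ∑' l : ℕ, ∫⁻ z, ‖cv χ (sf a lam0 lam (j + l + 1)) (x - z)‖ₑ * ‖Tf f (sf a ψ0 ψ (j + l + 1)) z‖ₑ := by
  have hk : ∀ k, cv (sf a lam0 lam (k + 1)) (sf a ψ0 ψ (k + 1)) = dil a (k + 1) ρ - dil a k ρ := fun k => by
    have := congrArg (dil a k) h1
    rw [dil_cv, dil_sub] at this
    simpa [sf, dil_dil] using this
  have key : ∀ K, ‖Tf f (cv (dil a (j + K) ρ) χ) x‖ₑ ≤ ‖Tf f (cv (dil a j ρ) χ) x‖ₑ +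
      ∑ l ∈ Finset.range K, ∫⁻ z, ‖cv χ (sf a lam0 lam (j + l + 1)) (x - z)‖ₑ * ‖Tf f (sf a ψ0 ψ (j + l + 1)) z‖ₑ := by
    intro K; induction K with
    | zero => simp
    | succ K ih =>
      have e : cv (dil a (j + (K + 1)) ρ) χ = cv (dil a (j + K) ρ) χ + cv (cv χ (sf a lam0 lam (j + K + 1))) (sf a ψ0 ψ (j + K + 1)) := by
        refine FT_inj fun ξ => ?_
        have := congrArg (fun g : Sz n => FT n g ξ) (hk (j + K))
        simp only [FT_cv, FT_sub, FT_add] at this ⊢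
        rw [mul_assoc, this, ← add_assoc]; ring
      rw [e, Tf_add, Finset.sum_range_succ, ← add_assoc]
      exact (enorm_add_le _ _).trans (add_le_add ih (Tf_cv_le _ _ _ _))
  have hl := (Tf_lim ha f hρ χ x).enorm
  have hl2 : Filter.Tendsto (fun K : ℕ => ‖Tf f (cv (dil a (j + K) ρ) χ) x‖ₑ) Filter.atTop (nhds ‖Tf f χ x‖ₑ) :=
    hl.comp (Filter.tendsto_atTop_mono (fun K => Nat.le_add_left K j) Filter.tendsto_id)
  refine le_of_tendsto hl2 (.of_forall fun K => (key K).trans ?_)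
  gcongr
  exact ENNReal.sum_le_tsum _
end


section
variable {n : ℕ} {a : Fin n → ℝ}

/-- vanishing moments of order `< M` -/
def MomC : ℕ → Sz n → Prop
  | 0, _ => True
  | M + 1, g => (∫ x, g x = 0) ∧ ∀ i, MomC M (Xm i g)

lemma MomC_pred {M : ℕ} {g : Sz n} (h : MomC (M + 1) g) : MomC M g := by
  induction M generalizing g with
  | zero => trivial
  | succ M ih => exact ⟨h.1, fun i => ih (h.2 i)⟩

lemma MomC_mono {M K : ℕ} (hK : K ≤ M) {g : Sz n} (h : MomC M g) : MomC K g := by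
  induction hK with
  | refl => exact h
  | step _ ih => exact ih (MomC_pred h)

lemma MomC_mon {k : ℕ} {g : Sz n} (h : MomC (k + 1) g) (ι : Fin k → Fin n) : ∫ y : RV n, g y * ((∏ j, y (ι j) : ℝ) : ℂ) = 0 := by
  induction k generalizing g with
  | zero => simpa using h.1
  | succ k ih =>
    rw [← ih (h.2 (ι 0)) fun j => ι j.succ]
    congr 1; ext y
    rw [Xm_apply, Fin.prod_univ_succ]; push_cast; ring

lemma MomC_form {k : ℕ} {g : Sz n} (h : MomC (k + 1) g) (Λ : RV n [×k]→L[ℝ] ℂ) : ∫ y : RV n, g y * Λ (fun _ => y) = 0 := by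
  have e : ∀ y : RV n, Λ (fun _ => y) = ∑ ι : Fin k → Fin n, ((∏ j, y (ι j) : ℝ) : ℂ) * Λ fun j => Pi.single (ι j) 1 := fun y => by
    conv_lhs => rw [pi_eq_sum_univ' y]
    rw [Λ.map_sum]
    refine Finset.sum_congr rfl fun ι _ => ?_
    rw [Λ.map_smul_univ, Complex.real_smul]
  simp only [e, Finset.mul_sum, ← mul_assoc]
  rw [integral_finsetSum]
  · refine Finset.sum_eq_zero fun ι _ => ?_
    rw [integral_mul_const, MomC_mon h, zero_mul]
  · intro ι _
    refine Integrable.mul_const ?_ _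
    refine (int_poly g k).mono' (Continuous.aestronglyMeasurable (by have := g.continuous; fun_prop)) (.of_forall fun y => ?_)
    rw [norm_mul, mul_comm, Complex.norm_real, norm_prod]
    gcongr
    calc _ ≤ ∏ _j : Fin k, (1 + ‖y‖) := Finset.prod_le_prod (fun _ _ => norm_nonneg _) fun j _ => by
          linarith [norm_le_pi_norm y (ι j)]
      _ = _ := by simp

lemma tay (χ : Sz n) (x v : RV n) (M : ℕ) (S : ℝ) (hS : ∀ t ∈ Set.Icc (0 : ℝ) 1, ‖iteratedFDeriv ℝ M χ (x + t • v)‖ ≤ S) :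
    ‖χ (x + v) - ∑ k ∈ Finset.range M, (k.factorial : ℝ)⁻¹ • iteratedFDeriv ℝ k χ x (fun _ => v)‖ ≤ S * ‖v‖ ^ M := by
  cases M with
  | zero => simpa using hS 1 (by simp)
  | succ M =>
    rw [map_add_eq_sum_add_integral_iteratedFDeriv (n := M) (fun t _ => (χ.smooth (M + 1 : ℕ)).contDiffAt), add_sub_cancel_left, norm_smul]
    have hS0 : 0 ≤ S := (norm_nonneg _).trans (hS 0 (by simp))
    have := intervalIntegral.norm_integral_le_of_norm_le_const (a := 0) (b := 1) (C := S * ‖v‖ ^ (M + 1))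
      (f := fun t : ℝ => (1 - t) ^ M • iteratedFDeriv ℝ (M + 1) χ (x + t • v) fun _ => v) fun t ht => ?_
    · rw [sub_zero, abs_one, mul_one] at this
      refine (mul_le_of_le_one_left (norm_nonneg _) ?_).trans this
      rw [Real.norm_of_nonneg (by positivity)]
      exact inv_le_one_of_one_le₀ (mod_cast Nat.one_le_iff_ne_zero.2 (Nat.factorial_ne_zero _))
    · rw [Set.uIoc_of_le zero_le_one] at ht
      rw [norm_smul]
      refine (mul_le_of_le_one_left (norm_nonneg _) ?_).trans ?_
      · rw [norm_pow]; refine pow_le_one₀ (norm_nonneg _) ?_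
        rw [Real.norm_of_nonneg (by linarith [ht.2])]; linarith [ht.1]
      · refine (ContinuousMultilinearMap.le_opNorm _ _).trans ?_
        simp only [Finset.prod_const, Finset.card_univ, Fintype.card_fin]
        gcongr
        exact hS t ⟨ht.1.le, ht.2⟩

lemma DD_neg_le2 {b : ℝ} (hb : ∀ i, b ≤ a i) (m : ℕ) (y : RV n) : ‖DD a (-m) y‖ ≤ 2 ^ (-(m * b)) * ‖y‖ := by
  refine (pi_norm_le_iff_of_nonneg (by positivity)).2 fun i => ?_
  rw [DD_apply, norm_mul, Real.norm_of_nonneg (by positivity)]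
  gcongr
  · norm_num
  · have := hb i
    have : (m : ℝ) * b ≤ m * a i := by gcongr
    linarith
  · exact norm_le_pi_norm _ i

lemma ker0 {b : ℝ} (hb0 : 0 ≤ b) (hb : ∀ i, b ≤ a i) (χ μ : Sz n) {M : ℕ} (hμ : MomC M μ) (R : ℕ) : ∃ C : ℝ, 0 ≤ C ∧ ∀ (m : ℕ) x,
    ‖cv χ (dil a m μ) x‖ * (1 + ‖x‖) ^ R ≤ C * 2 ^ (-(m * (M * b))) := by
  obtain ⟨B, hB, h⟩ := sbd χ (R + M)
  refine ⟨B * ∫ y, (1 + ‖y‖) ^ (R + M) * ‖μ y‖, by positivity, fun m x => ?_⟩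
  set E : RV n →L[ℝ] RV n := -(DD a (-m) : RV n →L[ℝ] RV n) with hE
  have hEn : ∀ y, ‖E y‖ ≤ 2 ^ (-(m * b)) * ‖y‖ := fun y => by
    simp only [hE, neg_apply, norm_neg]; exact DD_neg_le2 hb m y
  have hE1 : ∀ y, ‖E y‖ ≤ ‖y‖ := fun y => (hEn y).trans (mul_le_of_le_one_left (norm_nonneg _)
    (Real.rpow_le_one_of_one_le_of_nonpos (by norm_num) (by simp; positivity)))
  have e1 : cv χ (dil a m μ) x = ∫ y, μ y * χ (x + E y) := by
    rw [cv_comm, cv_apply, int_dil_mul a m μ fun y => χ (x - y)]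
    congr 1
  have hi : ∀ k, Integrable fun y => μ y * ((k.factorial : ℝ)⁻¹ • iteratedFDeriv ℝ k χ x (fun _ => E y)) := fun k => by
    refine ((int_poly μ k).const_mul (‖(k.factorial : ℝ)⁻¹‖ * ‖iteratedFDeriv ℝ k χ x‖)).mono' (Continuous.aestronglyMeasurable ?_) (.of_forall fun y => ?_)
    · have hc : Continuous fun y => iteratedFDeriv ℝ k χ x (fun _ => E y) := (iteratedFDeriv ℝ k χ x).cont.comp (continuous_pi fun _ => E.continuous)
      have := μ.continuous
      fun_prop
    · rw [norm_mul, norm_smul]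
      calc _ ≤ ‖μ y‖ * (‖(k.factorial : ℝ)⁻¹‖ * (‖iteratedFDeriv ℝ k χ x‖ * (1 + ‖y‖) ^ k)) := by
            gcongr
            refine (ContinuousMultilinearMap.le_opNorm _ _).trans ?_
            simp only [Finset.prod_const, Finset.card_univ, Fintype.card_fin]
            gcongr
            linarith [hE1 y]
        _ = _ := by ring
  have e2 : ∫ y, μ y * χ (x + E y) = ∫ y, μ y * (χ (x + E y) - ∑ k ∈ Finset.range M, (k.factorial : ℝ)⁻¹ • iteratedFDeriv ℝ k χ x (fun _ => E y)) := by
    simp only [mul_sub, Finset.mul_sum]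
    rw [integral_sub, integral_finsetSum _ fun k _ => hi k, Finset.sum_eq_zero, sub_zero]
    · intro k hk
      have := MomC_form (MomC_mono (Finset.mem_range.1 hk) hμ) ((k.factorial : ℝ)⁻¹ • (iteratedFDeriv ℝ k χ x).compContinuousLinearMap fun _ => E)
      exact this
    · refine ((int_poly μ 0).mul_const (SchwartzMap.seminorm ℝ 0 0 χ)).mono' (Continuous.aestronglyMeasurable
        (by have := μ.continuous; have := χ.continuous; fun_prop)) (.of_forall fun y => ?_)
      rw [norm_mul, pow_zero, one_mul]; gcongr; exact SchwartzMap.norm_le_seminorm ℝ χ _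
    · exact integrable_finsetSum _ fun k _ => hi k
  have hx : (0 : ℝ) < (1 + ‖x‖) ^ R := by positivity
  rw [e1, e2, ← le_div_iff₀ hx]
  refine (norm_integral_le_of_norm_le (((int_poly μ (R + M)).const_mul (B * 2 ^ (-(m * (M * b))) / (1 + ‖x‖) ^ R))) (.of_forall fun y => ?_)).trans (le_of_eq ?_)
  · rw [norm_mul]
    calc _ ≤ ‖μ y‖ * ((B * (1 + ‖y‖) ^ R / (1 + ‖x‖) ^ R) * ‖E y‖ ^ M) := by
          gcongr
          refine tay χ x _ M _ fun t ht => ?_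
          rw [le_div_iff₀ hx]
          have h1 := h M (by omega) (x + t • E y)
          have h2 : (1 + ‖x‖) ^ R ≤ (1 + ‖y‖) ^ R * (1 + ‖x + t • E y‖) ^ (R + M) := by
            calc _ ≤ (1 + ‖t • E y‖) ^ R * (1 + ‖x + t • E y‖) ^ R := peetre _ _ _
              _ ≤ _ := by
                gcongr
                · rw [norm_smul]
                  exact (mul_le_of_le_one_left (norm_nonneg _) (by rw [Real.norm_of_nonneg ht.1]; exact ht.2)).trans (hE1 y)
                · linarith [norm_nonneg (x + t • E y)]
                · omega
          calc _ ≤ ‖iteratedFDeriv ℝ M χ (x + t • E y)‖ * ((1 + ‖y‖) ^ R * (1 + ‖x + t • E y‖) ^ (R + M)) := by gcongr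
            _ = (1 + ‖y‖) ^ R * ((1 + ‖x + t • E y‖) ^ (R + M) * ‖iteratedFDeriv ℝ M χ (x + t • E y)‖) := by ring
            _ ≤ (1 + ‖y‖) ^ R * B := by gcongr
            _ = _ := by ring
      _ ≤ ‖μ y‖ * ((B * (1 + ‖y‖) ^ R / (1 + ‖x‖) ^ R) * (2 ^ (-(m * b)) * (1 + ‖y‖)) ^ M) := by
          gcongr
          refine (hEn y).trans ?_
          gcongr
          linarith
      _ = _ := by
          have : (2 : ℝ) ^ (-(m * (M * b))) = (2 ^ (-(m * b))) ^ M := by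
            rw [← Real.rpow_natCast, ← Real.rpow_mul (by norm_num)]; ring_nf
          rw [this, mul_pow, pow_add]; ring
  · rw [integral_const_mul]; ring
end


section
variable {n : ℕ} {a : Fin n → ℝ}

lemma sf_zero (φ0 φ : Sz n) : sf a φ0 φ 0 = φ0 := if_pos rfl
lemma sf_pos {φ0 φ : Sz n} {j : ℕ} (h : j ≠ 0) : sf a φ0 φ j = dil a j φ := if_neg h

lemma dilE {g : Sz n} {B R : ℝ} (hB : 0 ≤ B) (h : ∀ x, ‖g x‖ * (1 + ‖x‖) ^ (n * ⌈R⌉₊) ≤ B) (j : ℕ) (x : RV n) :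
    ‖dil a j g x‖ₑ ≤ ENNReal.ofReal B * (tp (j * ∑ i, a i) * uw a j x ^ (-R)) := by
  have h1 : 0 < uwr a j x := lt_of_lt_of_le one_pos (uwr_one a j x)
  have h2 : uwr a j x ≤ (1 + ‖DD a j x‖) ^ n := by
    calc uwr a j x ≤ ∏ _i : Fin n, (1 + ‖DD a j x‖) := by
          refine Finset.prod_le_prod (fun i _ => by positivity) fun i _ => ?_
          have := norm_le_pi_norm (DD a j x) i
          rw [DD_apply, norm_mul, Real.norm_of_nonneg (by positivity), Real.norm_eq_abs] at this
          linarith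
      _ = _ := by simp
  rw [← ofReal_norm, uw, ENNReal.ofReal_rpow_of_pos h1, ← tp_of, ← ENNReal.ofReal_mul (by positivity), ← ENNReal.ofReal_mul hB]
  refine ENNReal.ofReal_le_ofReal ?_
  rw [dil_apply, norm_mul, Complex.norm_real, Real.norm_of_nonneg (by positivity), mul_left_comm]
  refine mul_le_mul_of_nonneg_left ?_ (by positivity)
  rw [Real.rpow_neg h1.le, ← div_eq_mul_inv, le_div_iff₀ (by positivity)]
  refine le_trans (mul_le_mul_of_nonneg_left ?_ (norm_nonneg _)) (h _)
  calc uwr a j x ^ R ≤ uwr a j x ^ (⌈R⌉₊ : ℝ) := Real.rpow_le_rpow_of_exponent_le (uwr_one a j x) (Nat.le_ceil R)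
    _ = uwr a j x ^ ⌈R⌉₊ := Real.rpow_natCast _ _
    _ ≤ ((1 + ‖DD a j x‖) ^ n) ^ ⌈R⌉₊ := by gcongr
    _ = _ := (pow_mul _ _ _).symm

lemma dilE1 (g : Sz n) (R : ℝ) : ∃ C, C ≠ ∞ ∧ ∀ (j : ℕ) x, ‖dil a j g x‖ₑ ≤ C * (tp (j * ∑ i, a i) * uw a j x ^ (-R)) := by
  obtain ⟨B, hB, h⟩ := sbd g (n * ⌈R⌉₊)
  refine ⟨_, ENNReal.ofReal_ne_top, dilE hB fun x => ?_⟩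
  have := h 0 (Nat.zero_le _) x
  rwa [norm_iteratedFDeriv_zero, mul_comm] at this

lemma kerE {b : ℝ} (hb0 : 0 ≤ b) (hb : ∀ i, b ≤ a i) (χ μ : Sz n) {M : ℕ} (hμ : MomC M μ) (R : ℝ) : ∃ C, C ≠ ∞ ∧ ∀ (j m : ℕ) x,
    ‖cv (dil a j χ) (dil a (j + m) μ) x‖ₑ ≤ C * (tp (-(m * (M * b))) * (tp (j * ∑ i, a i) * uw a j x ^ (-R))) := by
  obtain ⟨C, hC, h⟩ := ker0 hb0 hb χ μ hμ (n * ⌈R⌉₊)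
  refine ⟨_, ENNReal.ofReal_ne_top (r := C), fun j m x => ?_⟩
  rw [← dil_dil, ← dil_cv]
  refine (dilE (by positivity) (h m) j x).trans (le_of_eq ?_)
  rw [ENNReal.ofReal_mul hC, tp_of, mul_assoc]

lemma kerS {b : ℝ} (hb0 : 0 ≤ b) (hb : ∀ i, b ≤ a i) (χ0 χ μ : Sz n) {M : ℕ} (hμ : MomC M μ) (R : ℝ) : ∃ C, C ≠ ∞ ∧ ∀ (j m : ℕ) x,
    ‖cv (sf a χ0 χ j) (dil a (j + m) μ) x‖ₑ ≤ C * (tp (-(m * (M * b))) * (tp (j * ∑ i, a i) * uw a j x ^ (-R))) := by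
  obtain ⟨C, hC, h⟩ := kerE hb0 hb χ μ hμ R
  obtain ⟨C', hC', h'⟩ := kerE hb0 hb χ0 μ hμ R
  refine ⟨C' + C, ENNReal.add_ne_top.2 ⟨hC', hC⟩, fun j m x => ?_⟩
  by_cases hj : j = 0
  · subst hj
    rw [sf, if_pos rfl, ← dil_zero a χ0]
    refine (h' 0 m x).trans ?_; gcongr; exact le_self_add
  · rw [sf, if_neg hj]
    refine (h j m x).trans ?_; gcongr; exact le_add_self

lemma kerU {b : ℝ} (hb1 : 1 ≤ b) (hb : ∀ i, b ≤ a i) (χ0 χ μ : Sz n) (hμ : ∀ M, MomC M μ) (L R : ℝ) : ∃ C, C ≠ ∞ ∧ ∀ (j m : ℕ) x,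
    ‖cv (sf a χ0 χ j) (dil a (j + m) μ) x‖ₑ ≤ C * (tp (-(m * L)) * (tp (j * ∑ i, a i) * uw a j x ^ (-R))) := by
  obtain ⟨C, hC, h⟩ := kerS (zero_le_one.trans hb1) hb χ0 χ μ (hμ ⌈L⌉₊) R
  refine ⟨C, hC, fun j m x => (h j m x).trans ?_⟩
  gcongr
  refine tp_mono (neg_le_neg (mul_le_mul_of_nonneg_left ?_ (Nat.cast_nonneg m)))
  exact (Nat.le_ceil L).trans (le_mul_of_one_le_right (Nat.cast_nonneg _) hb1)

/-- the existence of a Calderón reproducing system -/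
def RepS (a : Fin n → ℝ) (ψ0 ψ : Sz n) : Prop := ∃ lam0 lam ρ : Sz n, cv lam0 ψ0 = ρ ∧
  cv (dil a 1 lam) (dil a 1 ψ) = dil a 1 ρ - ρ ∧ ∫ x, ρ x = 1 ∧ ∀ M, MomC M lam

/-- moduli of the convolutions -/
def Fs (a : Fin n → ℝ) (ψ0 ψ : Sz n) (f : TD n) (j : ℕ) (x : RV n) : ℝ≥0∞ := ‖Tf f (sf a ψ0 ψ j) x‖ₑ

lemma Fs_meas (ψ0 ψ : Sz n) (f : TD n) (j : ℕ) : Measurable (Fs a ψ0 ψ f j) := (Tf_cont f _).measurable.enorm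

lemma kint {K : RV n → ℂ} {H W : RV n → ℝ≥0∞} {x : RV n} {C t : ℝ≥0∞} (hC : C ≠ ∞) (ht : t ≠ ∞)
    (h : ∀ y, ‖K y‖ₑ ≤ C * (t * W y)) : ∫⁻ z, ‖K (x - z)‖ₑ * H z ≤ C * (t * ∫⁻ z, H z * W (x - z)) := by
  rw [← lintegral_const_mul' _ _ ht, ← lintegral_const_mul' _ _ hC]
  refine lintegral_mono fun z => ?_
  calc _ ≤ (C * (t * W (x - z))) * H z := by gcongr; exact h _
    _ = _ := by ring

lemma H1r {b : ℝ} (hb1 : 1 ≤ b) (hb : ∀ i, b ≤ a i) {ψ0 ψ : Sz n} (hr : RepS a ψ0 ψ) (L R : ℝ) :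
    ∃ C, C ≠ ∞ ∧ ∀ f j y, Fs a ψ0 ψ f j y ≤ C * GG a L R (Fs a ψ0 ψ f) j y := by
  obtain ⟨lam0, lam, ρ, -, h1, hρ, hM⟩ := hr
  obtain ⟨C, hC, hc⟩ := dilE1 (a := a) ρ R
  obtain ⟨C', hC', hc'⟩ := kerU hb1 hb ψ0 ψ lam hM L R
  refine ⟨C + C', ENNReal.add_ne_top.2 ⟨hC, hC'⟩, fun f j x => ?_⟩
  refine (repro (lam0 := lam0) (ψ0 := ψ0) (fun i => by linarith [hb i]) hρ h1 f (sf a ψ0 ψ j) j x).trans ?_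
  rw [add_mul]
  refine add_le_add ?_ ?_
  · refine (Tf_cv_le _ _ _ _).trans ((kint hC ENNReal.one_ne_top fun y => by rw [one_mul]; exact hc j y).trans ?_)
    gcongr
    refine le_trans (le_of_eq ?_) (ENNReal.le_tsum 0)
    simp [tp_zero, Fs]
  · rw [GG, ← ENNReal.tsum_mul_left]
    refine le_trans (ENNReal.tsum_le_tsum fun l => ?_) (ENNReal.tsum_comp_le_tsum_of_injective (f := fun l : ℕ => l + 1) (fun _ _ => by simp) _)
    exact kint (K := cv (sf a ψ0 ψ j) (sf a lam0 lam (j + l + 1))) (H := Fs a ψ0 ψ f (j + l + 1))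
      (W := fun y => tp (j * ∑ i, a i) * uw a j y ^ (-R)) hC' (tp_ne_top _) fun y => hc' j (l + 1) y

lemma H2r (ha : ∀ i, 0 ≤ a i) (ψ0 ψ : Sz n) (f : TD n) : ∃ A, A ≠ ∞ ∧ ∃ L0 R0 : ℝ, 0 ≤ R0 ∧
    ∀ (j : ℕ) y, Fs a ψ0 ψ f j y ≤ A * tp (j * L0) * uw a 0 y ^ R0 := by
  obtain ⟨A, L, K, hA, h⟩ := Tf_growth ha f ψ0
  obtain ⟨A', L', K', hA', h'⟩ := Tf_growth ha f ψ
  refine ⟨ENNReal.ofReal (A + A'), ENNReal.ofReal_ne_top, L', (K + K' : ℕ), Nat.cast_nonneg _, fun j y => ?_⟩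
  rw [ENNReal.rpow_natCast, uw, ← ENNReal.ofReal_pow (zero_le_one.trans (uwr_one a 0 y)), ← tp_of, ← ENNReal.ofReal_mul (by positivity),
    ← ENNReal.ofReal_mul (by positivity), Fs, ← ofReal_norm]
  refine ENNReal.ofReal_le_ofReal ?_
  have hu : ∀ {k}, k ≤ K + K' → (1 + ‖y‖) ^ k ≤ uwr a 0 y ^ (K + K') := fun {k} hk =>
    (pow_le_pow_left₀ (by positivity) (uwr_ge a y) _).trans (pow_le_pow_right₀ (uwr_one a 0 y) hk)
  by_cases hj : j = 0
  · subst hj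
    have := h 0 y
    rw [dil_zero] at this
    rw [sf, if_pos rfl]
    refine this.trans ?_
    simp only [Nat.cast_zero, zero_mul, Real.rpow_zero, mul_one]
    gcongr
    · linarith
    · exact hu (by omega)
  · rw [sf, if_neg hj]
    refine (h' j y).trans ?_
    gcongr
    · linarith
    · exact hu (by omega)

lemma splitS (T A B : ℕ → ℝ≥0∞) (C : ℝ≥0∞) (j : ℕ) (hA : ∀ l, T (j + l) ≤ C * A l) (hB : ∀ d, 1 ≤ d → d ≤ j → T (j - d) ≤ C * B d) :
    ∑' k, T k ≤ C * (∑' l, A l + ∑' d, if d ≤ j then B d else 0) := by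
  rw [← Summable.sum_add_tsum_nat_add' (k := j) ENNReal.summable, add_comm, mul_add, ← ENNReal.tsum_mul_left]
  refine add_le_add (ENNReal.tsum_le_tsum fun l => by rw [add_comm l j]; exact hA l) ?_
  rw [← Finset.sum_range_reflect, ← ENNReal.tsum_mul_left]
  refine le_trans (Finset.sum_le_sum fun i hi => ?_) ((ENNReal.sum_le_tsum (Finset.range j)).trans
    (ENNReal.tsum_comp_le_tsum_of_injective (f := fun l : ℕ => l + 1) (fun _ _ => by simp) _))
  have hij : i + 1 ≤ j := Finset.mem_range.1 hi
  simp only [if_pos hij]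
  rw [show j - 1 - i = j - (i + 1) by omega]
  exact hB _ (by omega) hij

lemma H3r {b : ℝ} (hb1 : 1 ≤ b) (hb : ∀ i, b ≤ a i) {ψ0 ψ φ0 φ : Sz n} (hr : RepS a ψ0 ψ) {M : ℕ} (hφ : MomC M φ) (L R : ℝ) :
    ∃ C, C ≠ ∞ ∧ ∀ f (j : ℕ) x, Fs a φ0 φ f j x ≤ C * (GG a L R (Fs a ψ0 ψ f) j x + ∑' d : ℕ, if d ≤ j then
      tp (-(d * (M * b))) * ∫⁻ z, Fs a ψ0 ψ f (j - d) z * (tp ((j - d : ℕ) * ∑ i, a i) * uw a (j - d) (x - z) ^ (-R)) else 0) := by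
  obtain ⟨lam0, lam, ρ, h0, h1, hρ, hM⟩ := hr
  have hb0 := zero_le_one.trans hb1
  obtain ⟨C1, hC1, hc1⟩ := kerU hb1 hb φ0 φ lam hM L R
  obtain ⟨C2, hC2, hc2⟩ := kerS hb0 hb lam0 lam φ hφ R
  obtain ⟨C3, hC3, hc3⟩ := kerS hb0 hb φ0 φ lam0 (M := 0) trivial R
  have hC : C1 + C2 + C3 ≠ ∞ := by simp [hC1, hC2, hC3]
  refine ⟨C1 + C2 + C3, hC, fun f j x => ?_⟩
  set T : ℕ → ℝ≥0∞ := fun k => ∫⁻ z, ‖cv (sf a φ0 φ j) (sf a lam0 lam k) (x - z)‖ₑ * Fs a ψ0 ψ f k z with hT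
  have e1 : Fs a φ0 φ f j x ≤ ∑' k, T k := by
    rw [tsum_eq_zero_add' ENNReal.summable]
    refine (repro (lam0 := lam0) (ψ0 := ψ0) (fun i => by linarith [hb i]) hρ h1 f (sf a φ0 φ j) 0 x).trans ?_
    refine add_le_add ?_ (le_of_eq ?_)
    · rw [dil_zero, ← h0, cv_comm, ← cv_assoc]
      exact (Tf_cv_le _ _ _ _).trans (le_of_eq rfl)
    · simp only [hT, zero_add, Fs]
  refine e1.trans ((splitS T _ _ (C1 + C2 + C3) j ?_ ?_).trans_eq (by rw [GG]))
  · intro l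
    refine kint (K := cv (sf a φ0 φ j) (sf a lam0 lam (j + l))) (H := Fs a ψ0 ψ f (j + l))
      (W := fun y => tp (j * ∑ i, a i) * uw a j y ^ (-R)) hC (tp_ne_top _) fun y => ?_
    by_cases hl : j + l = 0
    · obtain ⟨rfl, rfl⟩ : l = 0 ∧ j = 0 := by omega
      have := hc3 0 0 y
      rw [add_zero, dil_zero] at this
      rw [add_zero, sf_zero lam0]
      refine this.trans ?_
      simp only [Nat.cast_zero, zero_mul]
      gcongr; exact le_add_self
    · rw [sf_pos (φ0 := lam0) hl]
      refine (hc1 j l y).trans ?_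
      gcongr; rw [add_assoc]; exact le_self_add
  · intro d hd hdj
    refine kint (K := cv (sf a φ0 φ j) (sf a lam0 lam (j - d))) (H := Fs a ψ0 ψ f (j - d))
      (W := fun y => tp ((j - d : ℕ) * ∑ i, a i) * uw a (j - d) y ^ (-R)) hC (tp_ne_top _) fun y => ?_
    have := hc2 (j - d) d y
    rw [Nat.sub_add_cancel hdj] at this
    rw [cv_comm, sf_pos (φ0 := φ0) (by omega)]
    refine this.trans ?_
    gcongr
    rw [add_right_comm]; exact le_add_self

/-- comparison of two systems -/
theorem cmpS {b : ℝ} (hb1 : 1 ≤ b) (hb : ∀ i, b ≤ a i) {ψ0 ψ φ0 φ : Sz n} (hr : RepS a ψ0 ψ) {M : ℕ} (hφ : MomC M φ)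
    {p : Fin n → ℝ≥0∞} (hp : ∀ i, 0 < p i ∧ p i ≠ ∞) {q : ℝ≥0∞} (hq : 0 < q) {s : ℝ} (hs : s < M * b) :
    ∃ C, C ≠ ∞ ∧ ∀ f, seqNorm n p q (fun j x => tp (j * s) * Fs a φ0 φ f j x) ≤ C * seqNorm n p q (fun j x => tp (j * s) * Fs a ψ0 ψ f j x) :=
  MT (fun i => by linarith [hb i]) hp hq hs (Fs a ψ0 ψ) (Fs a φ0 φ) (Fs_meas ψ0 ψ) (fun L R _ => H1r hb1 hb hr L R)
    (H2r (fun i => by linarith [hb i]) ψ0 ψ) (fun L R _ => H3r hb1 hb hr hφ L R)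
end


section
open LineDeriv
variable {n : ℕ} {a : Fin n → ℝ}

lemma FT0 (g : RV n → ℂ) : FT n g 0 = ∫ x, g x := by simp [FT]
lemma Xm_add (i : Fin n) (g h : Sz n) : Xm i (g + h) = Xm i g + Xm i h := map_add _ _ _
lemma Xm_smul (i : Fin n) (c : ℂ) (g : Sz n) : Xm i (c • g) = c • Xm i g := by
  ext x; simp only [_root_.smul_apply, Xm_apply, smul_eq_mul]; ring

lemma MomC_add {M : ℕ} {g h : Sz n} (hg : MomC M g) (hh : MomC M h) : MomC M (g + h) := by
  induction M generalizing g h with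
  | zero => trivial
  | succ M ih =>
    refine ⟨?_, fun i => by rw [Xm_add]; exact ih (hg.2 i) (hh.2 i)⟩
    rw [← FT0, FT_add, FT0, FT0, hg.1, hh.1, add_zero]

lemma MomC_smul {M : ℕ} (c : ℂ) {g : Sz n} (hg : MomC M g) : MomC M (c • g) := by
  induction M generalizing g with
  | zero => trivial
  | succ M ih =>
    refine ⟨?_, fun i => by rw [Xm_smul]; exact ih (hg.2 i)⟩
    rw [← FT0, FT_smul, FT0, hg.1, mul_zero]

lemma Xm_deriv (i : Fin n) (v : RV n) (g : Sz n) : Xm i (∂_{v} g) = ∂_{v} (Xm i g) + (-(v i : ℂ)) • g := by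
  ext x
  rw [_root_.add_apply, _root_.smul_apply, Xm_apply, SchwartzMap.lineDerivOp_apply_eq_fderiv, SchwartzMap.lineDerivOp_apply_eq_fderiv]
  have e : (Xm i g : RV n → ℂ) = fun x => (x i : ℂ) * g x := funext fun x => Xm_apply i g x
  have h1 : HasFDerivAt (fun x : RV n => ((x i : ℝ) : ℂ)) (Complex.ofRealCLM ∘L ContinuousLinearMap.proj i) x :=
    (Complex.ofRealCLM ∘L ContinuousLinearMap.proj (R := ℝ) (φ := fun _ : Fin n => ℝ) i).hasFDerivAt
  have h2 : HasFDerivAt (fun x : RV n => (x i : ℂ) * g x) _ x := h1.mul g.differentiableAt.hasFDerivAt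
  rw [e, h2.fderiv]
  simp; ring

lemma MomC_deriv {M : ℕ} (v : RV n) {g : Sz n} (hg : MomC M g) : MomC (M + 1) (∂_{v} g) := by
  induction M generalizing g with
  | zero => exact ⟨by rw [← FT0, FT_deriv]; simp, fun _ => trivial⟩
  | succ M ih =>
    refine ⟨by rw [← FT0, FT_deriv]; simp, fun i => ?_⟩
    rw [Xm_deriv]
    exact MomC_add (ih (hg.2 i)) (MomC_smul _ hg)

/-- iterated Laplacian on Schwartz functions -/
def lapS : ℕ → Sz n → Sz n
  | 0, g => g
  | N + 1, g => ∑ i, ∂_{(Pi.single i 1 : RV n)} (∂_{(Pi.single i 1 : RV n)} (lapS N g))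

lemma lapS_coe (N : ℕ) (g : Sz n) : (lapS N g : RV n → ℂ) = lapIter n N g := by
  induction N with
  | zero => rfl
  | succ N ih =>
    ext x
    rw [lapS, lapIter, _root_.sum_apply]
    refine Finset.sum_congr rfl fun i _ => ?_
    rw [SchwartzMap.lineDerivOp_apply_eq_fderiv, ← ih, pderiv1]
    congr 2

lemma lapS_mom (N : ℕ) (g : Sz n) : MomC (2 * N) (lapS N g) := by
  induction N with
  | zero => trivial
  | succ N ih =>
    rw [lapS]
    refine Finset.sum_induction _ (MomC (2 * (N + 1))) (fun _ _ => MomC_add) ?_ fun i _ => MomC_deriv _ (MomC_deriv _ ih)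
    have : (0 : Sz n) = (0 : ℂ) • ∂_{(0 : RV n)} (∂_{(0 : RV n)} (lapS N g)) := (zero_smul _ _).symm
    rw [this]; exact MomC_smul _ (MomC_deriv _ (MomC_deriv _ ih))

lemma FT_lapS (N : ℕ) (g : Sz n) (ξ : RV n) : FT n (lapS N g) ξ = (-((∑ i, ξ i ^ 2 : ℝ) : ℂ)) ^ N * FT n g ξ := by
  induction N with
  | zero => simp [lapS]
  | succ N ih =>
    have hs : ∀ (s : Finset (Fin n)) (F : Fin n → Sz n), FT n (∑ i ∈ s, F i : Sz n) ξ = ∑ i ∈ s, FT n (F i) ξ := fun s F => by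
      induction s using Finset.cons_induction with
      | empty => simp [FT]
      | cons i s hi h => rw [Finset.sum_cons, FT_add, h, Finset.sum_cons]
    rw [lapS, hs, pow_succ', mul_assoc, ← ih]
    push_cast
    rw [← Finset.sum_neg_distrib, Finset.sum_mul]
    refine Finset.sum_congr rfl fun i _ => ?_
    rw [FT_deriv, FT_deriv, ← mul_assoc]
    congr 1
    simp [Pi.single_apply]
    rw [mul_mul_mul_comm, I_mul_I]; ring

lemma MomC_of_zero {g : Sz n} (h : ∀ᶠ ξ in nhds 0, FT n g ξ = 0) (M : ℕ) : MomC M g := by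
  induction M generalizing g with
  | zero => trivial
  | succ M ih =>
    refine ⟨by rw [← FT0]; exact h.self_of_nhds, fun i => ih ?_⟩
    have h1 : fderiv ℝ (FT n g) =ᶠ[nhds 0] fderiv ℝ fun _ => (0 : ℂ) := Filter.EventuallyEq.fderiv h
    filter_upwards [h1] with ξ hξ
    have := congrFun (pderiv_FT g i) ξ
    rw [pderiv1, hξ, FT_smul] at this
    simpa using this

lemma fold_FT (α : Fin n → ℕ) (g : Sz n) (l : List (Fin n)) : ∃ G : Sz n, l.foldr (fun i h => pderivIter n i (α i) h) (FT n g) = FT n G ∧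
    ∀ x, G x = (l.map fun i => (-I * (x i : ℂ)) ^ α i).prod * g x := by
  have key : ∀ (i : Fin n) (k : ℕ) (g : Sz n), ∃ G : Sz n, pderivIter n i k (FT n g) = FT n G ∧ ∀ x, G x = (-I * (x i : ℂ)) ^ k * g x := fun i k g => by
    induction k with
    | zero => exact ⟨g, rfl, by simp⟩
    | succ k ih =>
      obtain ⟨G, h1, h2⟩ := ih
      refine ⟨-I • Xm i G, by rw [pderivIter, h1, pderiv_FT], fun x => ?_⟩
      rw [_root_.smul_apply, Xm_apply, h2, smul_eq_mul]; ring
  induction l with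
  | nil => exact ⟨g, rfl, by simp⟩
  | cons i l ih =>
    obtain ⟨G, h1, h2⟩ := ih
    obtain ⟨G', h3, h4⟩ := key i (α i) G
    exact ⟨G', by rw [List.foldr_cons, h1, h3], fun x => by rw [h4, h2, List.map_cons, List.prod_cons, mul_assoc]⟩

lemma MomC_of_cond {M : ℤ} {ψ : Sz n} (h : MomentCond n M ψ) : MomC (M + 1).toNat ψ := by
  have h1 : ∀ β : Fin n → ℕ, (∑ i, (β i : ℤ)) ≤ M → ∫ x : RV n, (∏ i, ((x i : ℂ)) ^ β i) * ψ x = 0 := fun β hβ => by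
    have := h β hβ
    obtain ⟨G, e1, e2⟩ := fold_FT β ψ (List.finRange n)
    rw [Dop, e1, FT0, mul_eq_zero] at this
    have := this.resolve_left (pow_ne_zero _ (by simp))
    simp only [e2, mul_pow, ← List.ofFn_eq_map, List.prod_ofFn, Finset.prod_mul_distrib, mul_assoc] at this
    rw [integral_const_mul, mul_eq_zero] at this
    exact this.resolve_left (Finset.prod_ne_zero_iff.2 fun i _ => pow_ne_zero _ (by simp))
  have h2 : ∀ (K : ℕ) (β : Fin n → ℕ) (g : Sz n), (∀ x, g x = (∏ i, ((x i : ℂ)) ^ β i) * ψ x) → (∑ i, (β i : ℤ)) + K ≤ M + 1 → MomC K g := fun K => by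
    induction K with
    | zero => intros; trivial
    | succ K ih =>
      intro β g hg hK
      push_cast at hK
      refine ⟨by simp only [hg]; exact h1 β (by linarith), fun i => ih (β + Pi.single i 1) _ (fun x => ?_) ?_⟩
      · rw [Xm_apply, hg, ← mul_assoc]
        congr 1
        simp only [Pi.add_apply, pow_add, Finset.prod_mul_distrib]
        rw [mul_comm]
        congr 1
        rw [Finset.prod_eq_single i] <;> simp +contextual
      · simp only [Pi.add_apply, Nat.cast_add, Finset.sum_add_distrib]
        rw [Finset.sum_eq_single (f := fun j => ((Pi.single i 1 : Fin n → ℕ) j : ℤ)) i] <;> simp +contextual <;> linarith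
  by_cases hM : 0 ≤ M + 1
  · exact h2 _ 0 ψ (by simp) (by simp [Int.toNat_of_nonneg hM])
  · rw [Int.toNat_of_nonpos (by omega)]; trivial
end


section
open scoped ContDiff
variable {n : ℕ} {a : Fin n → ℝ}

lemma FT_smooth (g : Sz n) : ContDiff ℝ ∞ (FT n g) := by
  have : FT n g = fun ξ => FourierTransform.fourier (up g) ((eE n).symm ((2 * Real.pi)⁻¹ • ξ)) := funext (FT_up g)
  rw [this]
  exact ((FourierTransform.fourier (up g)).smooth ⊤).comp ((eE n).symm.contDiff.comp (contDiff_const_smul _))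

lemma divS {m w : RV n → ℂ} (hm : ContDiff ℝ ∞ m) (hc : HasCompactSupport m) (hw : ContDiff ℝ ∞ w) (h0 : ∀ x ∈ tsupport m, w x ≠ 0) :
    ∃ G : Sz n, (∀ ξ, G ξ = m ξ / w ξ) ∧ ∀ ξ, G ξ * w ξ = m ξ := by
  have hs : ContDiff ℝ ∞ fun ξ => m ξ / w ξ := contDiff_iff_contDiffAt.2 fun x => by
    by_cases hx : x ∈ tsupport m
    · simp only [div_eq_mul_inv]; exact hm.contDiffAt.mul (hw.contDiffAt.inv (h0 x hx))
    · refine (contDiffAt_const (c := (0 : ℂ))).congr_of_eventuallyEq ?_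
      filter_upwards [notMem_tsupport_iff_eventuallyEq.1 hx] with y hy
      rw [hy]; simp
  have hcs : HasCompactSupport fun ξ => m ξ / w ξ := hc.mono fun x hx hm0 => hx (by simp [hm0])
  refine ⟨hcs.toSchwartzMap hs, fun ξ => rfl, fun ξ => ?_⟩
  change m ξ / w ξ * w ξ = m ξ
  by_cases hx : m ξ = 0
  · simp [hx]
  · exact div_mul_cancel₀ _ (h0 ξ (subset_tsupport _ hx))

/-- anisotropic quadratic forms -/
def Qs (a : Fin n → ℝ) (t : ℝ) (ξ : RV n) : ℝ := ∑ i, ξ i ^ 2 / t ^ (2 * a i)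

lemma Qs_smooth (t : ℝ) : ContDiff ℝ ∞ (Qs a t) := by unfold Qs; fun_prop

lemma Qs_scale (ha : ∀ i, 1 ≤ a i) {t γ : ℝ} (ht : 0 < t) (hγ : 1 ≤ γ) (ξ : RV n) : γ ^ 2 * Qs a (γ * t) ξ ≤ Qs a t ξ := by
  rw [Qs, Qs, Finset.mul_sum]
  refine Finset.sum_le_sum fun i _ => ?_
  have h1 : 0 < γ := by linarith
  rw [Real.mul_rpow h1.le ht.le, ← mul_div_assoc, div_le_div_iff₀ (by positivity) (by positivity)]
  have : γ ^ 2 ≤ γ ^ (2 * a i) := by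
    rw [← Real.rpow_natCast]
    exact Real.rpow_le_rpow_of_exponent_le hγ (by have := ha i; push_cast; linarith)
  calc _ = γ ^ 2 * (ξ i ^ 2 * t ^ (2 * a i)) := by ring
    _ ≤ γ ^ (2 * a i) * (ξ i ^ 2 * t ^ (2 * a i)) := by gcongr
    _ = _ := by ring

lemma Qs_DD {t : ℝ} (ht : 0 < t) (ξ : RV n) : Qs a (2 * t) (DD a 1 ξ) = Qs a t ξ := by
  refine Finset.sum_congr rfl fun i _ => ?_
  rw [DD_apply, Real.mul_rpow (by norm_num) ht.le, mul_pow, one_mul, ← Real.rpow_natCast (2 ^ a i), ← Real.rpow_mul (by norm_num), mul_comm (a i)]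
  exact mul_div_mul_left _ _ (by positivity)

lemma Qs_nonneg {t : ℝ} (ht : 0 < t) (ξ : RV n) : 0 ≤ Qs a t ξ := Finset.sum_nonneg fun i _ => by positivity

lemma Qs_anti (ha : ∀ i, 1 ≤ a i) {t u : ℝ} (ht : 0 < t) (hu : t ≤ u) (ξ : RV n) : Qs a u ξ ≤ Qs a t ξ := by
  have h1 : 1 ≤ u / t := (one_le_div ht).2 hu
  have := Qs_scale ha ht h1 ξ
  rw [div_mul_cancel₀ _ ht.ne'] at this
  have h2 := Qs_nonneg (a := a) (ht.trans_le hu) ξ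
  exact (le_mul_of_one_le_left h2 (one_le_pow₀ h1)).trans this

variable {anorm : RV n → ℝ}
lemma an_lt (ha : ∀ i, 1 ≤ a i) (h : IsAnorm n a anorm) {t : ℝ} (ht : 0 < t) {ξ : RV n} (hξ : Qs a t ξ < 1) : anorm ξ < t := by
  by_cases h0 : ξ = 0
  · rw [h0, h.1]; exact ht
  · by_contra! hc
    have := Qs_anti ha ht hc ξ
    rw [Qs, (h.2 ξ h0).2] at this
    linarith

lemma an_gt (ha : ∀ i, 1 ≤ a i) (h : IsAnorm n a anorm) {t : ℝ} {ξ : RV n} (hξ : 1 < Qs a t ξ) : t < anorm ξ := by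
  have h0 : ξ ≠ 0 := by rintro rfl; simp [Qs] at hξ; linarith
  by_contra! hc
  have := Qs_anti ha (h.2 ξ h0).1 hc ξ
  rw [Qs.eq_def a (anorm ξ), (h.2 ξ h0).2] at this
  linarith

lemma Qs_cpt {t : ℝ} (ht : 0 < t) : IsCompact {ξ | Qs a t ξ ≤ 2} := by
  refine (isCompact_univ_pi (s := fun i => Set.Icc (-(1 + 2 * t ^ (2 * a i))) (1 + 2 * t ^ (2 * a i))) fun i => isCompact_Icc).of_isClosed_subset
    (isClosed_le (Qs_smooth t).continuous continuous_const) fun ξ hξ i _ => ?_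
  have h1 : ξ i ^ 2 / t ^ (2 * a i) ≤ 2 := (Finset.single_le_sum (f := fun i => ξ i ^ 2 / t ^ (2 * a i)) (fun i _ => by positivity) (Finset.mem_univ i)).trans hξ
  rw [div_le_iff₀ (by positivity)] at h1
  constructor <;> nlinarith

/-- Tauberian conditions give a reproducing system -/
lemma repS_of (ha : ∀ i, 1 ≤ a i) (h : IsAnorm n a anorm) {ψ0 ψ : Sz n} {ε : ℝ} (hε : 0 < ε) (hT : Tauber n anorm ψ0 ψ ε) : RepS a ψ0 ψ := by
  set b : ℝ := 2 * (5 / 8 * ε) with hb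
  have hb0 : 0 < b := by positivity
  set θ : RV n → ℂ := fun ξ => ((Real.smoothTransition (2 - Qs a b ξ) : ℝ) : ℂ) with hθ
  have θ1 : ∀ ξ, Qs a b ξ ≤ 1 → θ ξ = 1 := fun ξ hξ => by
    simp only [hθ]; rw [Real.smoothTransition.one_of_one_le (by linarith)]; simp
  have θ0 : ∀ ξ, 2 ≤ Qs a b ξ → θ ξ = 0 := fun ξ hξ => by
    simp only [hθ]; rw [Real.smoothTransition.zero_of_nonpos (by linarith)]; simp
  have θs : ContDiff ℝ ∞ θ := Complex.ofRealCLM.contDiff.comp (Real.smoothTransition.contDiff.comp (contDiff_const.sub (Qs_smooth b)))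
  have hK : ∀ ξ, Qs a b ξ ≤ 2 → anorm ξ < 2 * ε := fun ξ hξ => by
    refine an_lt ha h (by positivity) ?_
    have := Qs_scale ha hb0 (γ := 8 / 5) (by norm_num) ξ
    rw [show 8 / 5 * b = 2 * ε by rw [hb]; ring] at this
    linarith
  have hKc : IsClosed {ξ | Qs a b ξ ≤ 2} := isClosed_le (Qs_smooth b).continuous continuous_const
  have sup : ∀ m : RV n → ℂ, (∀ ξ, 2 ≤ Qs a b ξ → m ξ = 0) → HasCompactSupport m ∧ tsupport m ⊆ {ξ | Qs a b ξ ≤ 2} := fun m hm => by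
    refine ⟨HasCompactSupport.intro (Qs_cpt hb0) fun ξ hξ => hm ξ (not_le.1 hξ).le, closure_minimal (fun ξ hξ => ?_) hKc⟩
    by_contra hc; exact hξ (hm ξ (not_le.1 hc).le)
  set m : RV n → ℂ := fun ξ => θ ξ - θ (DD a 1 ξ) with hm
  have hQ : ∀ ξ, Qs a b ξ ≤ Qs a b (DD a 1 ξ) := fun ξ => by
    rw [hb, Qs_DD (by positivity)]; exact Qs_anti ha (by positivity) (by linarith) ξ
  have ms : ContDiff ℝ ∞ m := θs.sub (θs.comp (DD a 1).contDiff)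
  have m0 : ∀ ξ, 2 ≤ Qs a b ξ → m ξ = 0 := fun ξ hξ => by simp only [hm]; rw [θ0 ξ hξ, θ0 _ (hξ.trans (hQ ξ)), sub_zero]
  have m1 : ∀ ξ, Qs a b (DD a 1 ξ) < 1 → m ξ = 0 := fun ξ hξ => by simp only [hm]; rw [θ1 _ hξ.le, θ1 ξ ((hQ ξ).trans hξ.le), sub_self]
  have cQ : Continuous fun ξ => Qs a b (DD a 1 ξ) := (Qs_smooth b).continuous.comp (DD a 1).continuous
  have msup : tsupport m ⊆ {ξ | 1 ≤ Qs a b (DD a 1 ξ)} := closure_minimal (fun ξ hξ => by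
    by_contra hc; exact hξ (m1 ξ (not_le.1 hc))) (isClosed_le continuous_const cQ)
  obtain ⟨G, hG, -⟩ := divS θs (sup θ θ0).1 contDiff_const (w := fun _ => 1) (by simp)
  obtain ⟨G0, -, hG0⟩ := divS θs (sup θ θ0).1 (FT_smooth ψ0) fun ξ hξ => norm_pos_iff.1 (hT.1 ξ (hK ξ ((sup θ θ0).2 hξ)))
  obtain ⟨G1, hG1', hG1⟩ := divS ms (sup m m0).1 (FT_smooth ψ) fun ξ hξ => norm_pos_iff.1 (hT.2 ξ (by
    refine an_gt ha h ?_
    have h1 := Qs_scale ha (t := ε / 2) (by positivity) (γ := 5 / 4) (by norm_num) ξ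
    rw [show 5 / 4 * (ε / 2) = 5 / 8 * ε by ring, ← Qs_DD (by positivity)] at h1
    have h2 : 1 ≤ Qs a b (DD a 1 ξ) := msup hξ
    linarith) (hK ξ ((sup m m0).2 hξ)))
  have hG : ∀ ξ, G ξ = θ ξ := fun ξ => by rw [hG, div_one]
  refine ⟨FI G0, FI G1, FI G, FT_inj fun ξ => ?_, FT_inj fun ξ => ?_, ?_, MomC_of_zero ?_⟩
  · rw [FT_cv, FT_FI, FT_FI, hG0, hG]
  · rw [FT_cv, FT_sub, FT_dil, FT_dil, FT_dil, FT_FI, FT_FI, FT_FI, hG1, hG, hG]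
    simp only [hm]
    rw [← DD_add]; simp [DD_zero]
  · rw [← FT0, FT_FI, hG, θ1 0 (by simp [Qs])]
  · have : ∀ᶠ ξ in nhds (0 : RV n), Qs a b (DD a 1 ξ) < 1 := cQ.continuousAt.eventually_lt continuousAt_const (by simp [Qs])
    filter_upwards [this] with ξ hξ
    rw [FT_FI, hG1', m1 ξ hξ, zero_div]

lemma tauber_lap (ha : ∀ i, 1 ≤ a i) (h : IsAnorm n a anorm) {k0 k1 : Sz n} (h0 : ∫ x, k0 x ≠ 0) (h1 : ∫ x, k1 x ≠ 0) (N : ℕ) :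
    ∃ ε, 0 < ε ∧ Tauber n anorm k0 (lapS N k1) ε := by
  rw [← FT0] at h0 h1
  have e1 := ((FT_cont k0).continuousAt (x := 0)).eventually_ne h0
  have e2 := ((FT_cont k1).continuousAt (x := 0)).eventually_ne h1
  obtain ⟨δ, hδ, hd⟩ := Metric.eventually_nhds_iff_ball.1 (e1.and e2)
  have key : ∀ ξ, anorm ξ < min δ 1 → FT n k0 ξ ≠ 0 ∧ FT n k1 ξ ≠ 0 := fun ξ hξ => by
    refine hd ξ ?_
    rw [mem_ball_zero_iff, pi_norm_lt_iff hδ]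
    intro i
    by_cases hx : ξ = 0
    · simp [hx, hδ]
    obtain ⟨p1, p2⟩ := h.2 ξ hx
    have h3 : ξ i ^ 2 / anorm ξ ^ (2 * a i) ≤ 1 := (Finset.single_le_sum (f := fun i => ξ i ^ 2 / anorm ξ ^ (2 * a i)) (fun i _ => by positivity) (Finset.mem_univ i)).trans p2.le
    rw [div_le_one (by positivity)] at h3
    have h4 : anorm ξ ^ (2 * a i) ≤ anorm ξ ^ 2 := by
      rw [← Real.rpow_natCast]
      exact Real.rpow_le_rpow_of_exponent_ge p1 (hξ.le.trans (min_le_right _ _)) (by have := ha i; push_cast; linarith)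
    exact (abs_le_of_sq_le_sq (h3.trans h4) p1.le).trans_lt (hξ.trans_le (min_le_left _ _))
  refine ⟨min δ 1 / 2, by positivity, fun ξ hξ => norm_pos_iff.2 (key ξ (by linarith)).1, fun ξ hl hu => ?_⟩
  have hx : ξ ≠ 0 := by
    rintro rfl
    rw [h.1] at hl
    have : 0 < min δ 1 := by positivity
    linarith
  rw [norm_pos_iff, FT_lapS]
  refine mul_ne_zero (pow_ne_zero _ (neg_ne_zero.2 (Complex.ofReal_ne_zero.2 ?_))) (key ξ (by linarith)).2
  obtain ⟨i, hi⟩ := Function.ne_iff.1 hx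
  exact (Finset.sum_pos' (fun i _ => sq_nonneg _) ⟨i, Finset.mem_univ i, by have : ξ i ≠ 0 := hi; positivity⟩).ne'
end


section
variable {n : ℕ} {a : Fin n → ℝ} {p : Fin n → ℝ≥0∞} {q : ℝ≥0∞}

lemma mixN_mono (hp : ∀ i, 0 < p i ∧ p i ≠ ∞) {F G : RV n → ℝ≥0∞} (h : ∀ x, F x ≤ G x) : mixedNorm n p F ≤ mixedNorm n p G := by
  have := mixAux_le (fun i => (hp i).2) (fun i => (hp i).1.ne') (B := 1) (by simp) (l0 := 0) (F := F) (G := G) (fun x => by simpa [mixAux] using h x)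
    (Nat.zero_le n) (fun _ => 0)
  rwa [one_mul] at this

lemma seq_split (hp : ∀ i, 0 < p i ∧ p i ≠ ∞) (hq : 0 < q) : ∃ C, C ≠ ∞ ∧ ∀ u : ℕ → RV n → ℝ≥0∞, (∀ k, Measurable (u k)) →
    mixedNorm n p (u 0) + seqNorm n p q (fun j => u (j + 1)) ≤ 2 * seqNorm n p q u ∧
    seqNorm n p q u ≤ C * (mixedNorm n p (u 0) + seqNorm n p q (fun j => u (j + 1))) := by
  obtain ⟨r, hr, -, hrp, hrq⟩ := exists_r (fun i => (hp i).1) hq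
  refine ⟨2 ^ (1 / r), ENNReal.rpow_ne_top_of_nonneg (by positivity) (by simp), fun u hu => ⟨?_, ?_⟩⟩
  · rw [two_mul]
    refine add_le_add (mixN_mono hp fun x => ?_) (mixN_mono hp fun x => ?_)
    · split_ifs with h
      · exact le_iSup (fun k => u k x) 0
      · have h0 := ENNReal.toReal_pos hq.ne' h
        rw [one_div, ENNReal.le_rpow_inv_iff h0]
        exact ENNReal.le_tsum 0
    · exact lq_le_of Set.univ (fun j => j + 1) (fun _ _ _ _ h => by simpa using h) (fun _ _ => le_rfl) (by simp) hq.ne'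
  · set v : ℕ → RV n → ℝ≥0∞ := fun k x => if k = 0 then u 0 x else 0 with hv
    set w : ℕ → RV n → ℝ≥0∞ := fun k x => if k = 0 then 0 else u k x with hw
    have hv1 : seqNorm n p q v ≤ mixedNorm n p (u 0) := mixN_mono hp fun x => by
      split_ifs with h
      · refine iSup_le fun k => ?_
        simp only [hv]; split_ifs <;> simp
      · have h0 := ENNReal.toReal_pos hq.ne' h
        rw [tsum_eq_single 0 fun k hk => by simp [hv, hk, h0], one_div, ENNReal.rpow_rpow_inv h0.ne']
        simp [hv]
    have hw1 : seqNorm n p q w ≤ seqNorm n p q (fun j => u (j + 1)) := mixN_mono hp fun x => by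
      refine lq_le_of {k | k ≠ 0} (fun k => k - 1) (fun i hi j hj h => ?_) (fun j hj => ?_) (fun j hj => ?_) hq.ne'
      · have h1 : i ≠ 0 := hi
        have h2 : j ≠ 0 := hj
        simp only at h; omega
      · have h2 : j ≠ 0 := hj
        simp only [hw, if_neg h2]; rw [Nat.sub_add_cancel (by omega)]
      · simp only [Set.mem_setOf_eq, not_not] at hj; simp [hw, hj]
    have hr0 : ENNReal.ofReal r ≠ 0 := by simpa using hr
    have hd : ∀ {t : ℝ≥0∞}, ENNReal.ofReal r < t → 1 ≤ t / ENNReal.ofReal r := fun {t} ht => by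
      rw [ENNReal.le_div_iff_mul_le (.inl hr0) (.inl (by simp)), one_mul]; exact ht.le
    have key := seqNorm_add (p := fun i => p i / ENNReal.ofReal r) (fun i => ENNReal.div_ne_top (hp i).2 hr0) (fun i => hd (hrp i)) (hd hrq)
      (u := fun k x => v k x ^ r) (v := fun k x => w k x ^ r)
      (fun k => by simp only [hv]; split_ifs; exacts [(hu 0).pow_const _, measurable_const])
      (fun k => by simp only [hw]; split_ifs; exacts [measurable_const, (hu k).pow_const _])
    have e : (fun k x => v k x ^ r + w k x ^ r) = fun k x => u k x ^ r := by
      ext k x; by_cases hk : k = 0 <;> simp [hv, hw, hk, hr]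
    rw [e, seqNorm_pow (fun i => (hp i).2) hr, seqNorm_pow (fun i => (hp i).2) hr, seqNorm_pow (fun i => (hp i).2) hr] at key
    rw [← ENNReal.rpow_le_rpow_iff hr, ENNReal.mul_rpow_of_nonneg _ _ hr.le, ← ENNReal.rpow_mul, one_div, inv_mul_cancel₀ hr.ne', ENNReal.rpow_one, two_mul]
    refine key.trans (add_le_add ?_ ?_)
    · gcongr; exact hv1.trans le_self_add
    · gcongr; exact hw1.trans le_add_self

lemma fam_sf (φ0 φ : Sz n) (j : ℕ) : fam n a φ0 φ j = sf a φ0 φ j := by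
  cases j with
  | zero => rfl
  | succ j =>
    rw [sf_pos (by omega)]
    ext x
    rw [dil_apply, fam, Nat.cast_succ]
    congr 2

lemma conv_Fs {conv : TD n → (RV n → ℂ) → RV n → ℂ}
    (hconv : ∀ (f : TD n) (g : RV n → ℂ) (x : RV n) (Ψ : SchwartzMap (RV n) ℂ), (∀ y, Ψ y = g (x - y)) → conv f g x = f Ψ)
    (φ0 φ : Sz n) (f : TD n) (j : ℕ) (x : RV n) : (‖conv f (fam n a φ0 φ j) x‖₊ : ℝ≥0∞) = Fs a φ0 φ f j x := by
  rw [fam_sf, hconv f _ x (ngS (tau x (sf a φ0 φ j))) fun y => ngS_tau _ _ _]; rfl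

lemma le_pos {X Y C : ℝ≥0∞} (hC : C ≠ ∞) (h : X ≤ C * Y) : X ≤ ENNReal.ofReal (C.toReal + 1) * Y := by
  refine h.trans ?_
  gcongr
  rw [ENNReal.ofReal_add ENNReal.toReal_nonneg zero_le_one, ENNReal.ofReal_toReal hC]; exact le_self_add
end

theorem stmt17 (n : ℕ) (hn : 1 ≤ n) (a : Fin n → ℝ) (ha : ∀ i, 1 ≤ a i)
    (anorm : RV n → ℝ) (h : IsAnorm n a anorm)
    (conv : TD n → (RV n → ℂ) → RV n → ℂ)
    (hconv : ∀ (f : TD n) (g : RV n → ℂ) (x : RV n) (Ψ : SchwartzMap (RV n) ℂ),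
      (∀ y, Ψ y = g (x - y)) → conv f g x = f Ψ)
    (k0 k0' : SchwartzMap (RV n) ℂ)
    (hk0 : (∫ x : RV n, k0 x) ≠ 0) (hk0' : (∫ x : RV n, k0' x) ≠ 0)
    (N : ℕ) (hN : 1 ≤ N)
    (p : Fin n → ℝ≥0∞) (hp : ∀ i, 0 < p i ∧ p i ≠ ∞) (q : ℝ≥0∞) (hq : 0 < q)
    (s : ℝ) (hsN : s < 2 * (N:ℝ) * ⨅ i, a i)
    (ψ0 ψ : SchwartzMap (RV n) ℂ) (ε : ℝ) (hε : 0 < ε)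
    (hT : Tauber n anorm (⇑ψ0) (⇑ψ) ε)
    (Mψ : ℤ) (hMψ : -1 ≤ Mψ) (hmomψ : MomentCond n Mψ (⇑ψ))
    (hs : s < ((Mψ:ℝ) + 1) * ⨅ i, a i) :
    ∃ c₁ c₂ : ℝ, 0 < c₁ ∧ 0 < c₂ ∧
      ∀ f : TD n, ∀ Nψ Nk : ℝ≥0∞,
        Nψ = seqNorm n p q
            (fun j x => ENNReal.ofReal ((2:ℝ) ^ ((j:ℝ) * s)) *
              (‖conv f (fam n a (⇑ψ0) (⇑ψ) j) x‖₊ : ℝ≥0∞)) →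
        Nk = mixedNorm n p (fun x => (‖conv f (⇑k0) x‖₊ : ℝ≥0∞)) +
            seqNorm n p q
              (fun j x => ENNReal.ofReal ((2:ℝ) ^ (((j:ℝ) + 1) * s)) *
                (‖conv f (fam n a (⇑k0) (lapIter n N ⇑k0') (j + 1)) x‖₊ : ℝ≥0∞)) →
        ENNReal.ofReal c₁ * Nψ ≤ Nk ∧ Nk ≤ ENNReal.ofReal c₂ * Nψ ∧ (Nψ ≠ ∞ ↔ Nk ≠ ∞) := by
  haveI : Nonempty (Fin n) := ⟨⟨0, hn⟩⟩
  have hbb : BddBelow (Set.range a) := ⟨1, by rintro _ ⟨i, rfl⟩; exact ha i⟩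
  have hb1 : 1 ≤ ⨅ i, a i := le_ciInf ha
  have hb : ∀ i, ⨅ i, a i ≤ a i := fun i => ciInf_le hbb i
  obtain ⟨δ, hδ, hTk⟩ := tauber_lap ha h hk0 hk0' N
  have hM : (((Mψ + 1).toNat : ℕ) : ℝ) = (Mψ : ℝ) + 1 := by
    have : (((Mψ + 1).toNat : ℤ) : ℝ) = ((Mψ + 1 : ℤ) : ℝ) := by rw [Int.toNat_of_nonneg (by omega)]
    push_cast at this; exact this
  obtain ⟨A, hA, hA'⟩ := cmpS (φ0 := ψ0) hb1 hb (repS_of ha h hδ hTk) (MomC_of_cond hmomψ) hp hq (s := s) (by rw [hM]; exact hs)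
  obtain ⟨B, hB, hB'⟩ := cmpS (φ0 := k0) hb1 hb (repS_of ha h hε hT) (lapS_mom N k0') hp hq (s := s) (by push_cast; exact hsN)
  obtain ⟨C, hC, hC'⟩ := seq_split hp hq
  have hAC : A * C ≠ ∞ := ENNReal.mul_ne_top hA hC
  have h2B : 2 * B ≠ ∞ := ENNReal.mul_ne_top (by simp) hB
  set c := (A * C).toReal + 1 with hc
  have hc0 : 0 < c := by positivity
  refine ⟨c⁻¹, (2 * B).toReal + 1, by positivity, by positivity, ?_⟩
  intro f Nψ Nk h1 h2
  simp only [← lapS_coe, conv_Fs hconv, tp_of] at h1 h2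
  set u : ℕ → RV n → ℝ≥0∞ := fun j x => tp (j * s) * Fs a k0 (lapS N k0') f j x with hu
  obtain ⟨s1, s2⟩ := hC' u fun k => (Fs_meas _ _ f k).const_mul _
  have e : Nk = mixedNorm n p (u 0) + seqNorm n p q fun j => u (j + 1) := by
    rw [h2]
    congr 2
    · ext x
      have : conv f k0 x = conv f (fam n a k0 (lapS N k0') 0) x := rfl
      rw [this, conv_Fs hconv]; simp [hu, tp_zero]
    · ext j x; simp [hu]
  rw [← e] at s1 s2
  have up1 : Nψ ≤ ENNReal.ofReal c * Nk := le_pos hAC (by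
    rw [h1, mul_assoc]; exact (hA' f).trans (by gcongr))
  have up2 : Nk ≤ ENNReal.ofReal ((2 * B).toReal + 1) * Nψ := le_pos h2B (by
    rw [h1, mul_assoc]; exact s1.trans (by gcongr; exact hB' f))
  refine ⟨?_, up2, fun hh => ?_, fun hh => ?_⟩
  · rw [ENNReal.ofReal_inv_of_pos hc0, mul_comm, ← div_eq_mul_inv]
    refine ENNReal.div_le_of_le_mul ?_
    rwa [mul_comm]
  · exact ne_top_of_le_ne_top (ENNReal.mul_ne_top ENNReal.ofReal_ne_top hh) up2
  · exact ne_top_of_le_ne_top (ENNReal.mul_ne_top ENNReal.ofReal_ne_top hh) up1
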